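/- Let K be a totally real number field and Q a positive definite quadratic form in n ≥ 5 variables with coefficients in 𝓞_K. Then there exists a finite set S ⊆ 𝓞_K⁺ \ Q(𝓞_K) with the following property: for every extension L/K of number fields of odd degree one has Q(𝓞_L) ∩ 𝓞_K⁺ ⊆ Q(𝓞_K) ∪ S·𝓞_K^{×2}, and if moreover L is not totally real, then (Q(𝓞_L) ∩ 𝓞_K⁺) ∪ {0} = Q(𝓞_K) ∪ S·𝓞_K^{×2}. -/

import Mathlib

set_option linter.unusedSectionVars false

namespace QuadRep

open Matrix

/-- The quadratic form attached to a square matrix. -/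
def qf {R κ : Type*} [CommRing R] [Fintype κ] (M : Matrix κ κ R) (x : κ → R) : R :=
  x ⬝ᵥ M *ᵥ x

/-- The polar bilinear form of `qf M`. -/
def bl {R κ : Type*} [CommRing R] [Fintype κ] (M : Matrix κ κ R) (x y : κ → R) : R :=
  x ⬝ᵥ (M + Mᵀ) *ᵥ y

section Forms

variable {R S κ : Type*} [CommRing R] [CommRing S] [Fintype κ] (M : Matrix κ κ R)

theorem bl_eq (x y : κ → R) : bl M x y = x ⬝ᵥ M *ᵥ y + y ⬝ᵥ M *ᵥ x := by
  rw [bl, add_mulVec, dotProduct_add, mulVec_transpose, dotProduct_comm x (y ᵥ* M), ← dotProduct_mulVec]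

theorem qf_add (x y : κ → R) : qf M (x + y) = qf M x + qf M y + bl M x y := by
  rw [bl_eq]; simp only [qf, mulVec_add, dotProduct_add, add_dotProduct]; ring

theorem qf_smul (c : R) (x : κ → R) : qf M (c • x) = c ^ 2 * qf M x := by
  simp only [qf, mulVec_smul, dotProduct_smul, smul_dotProduct, smul_eq_mul]; ring

@[simp] theorem qf_zero : qf M 0 = 0 := by simp [qf]

theorem bl_add_left (x y z : κ → R) : bl M (x + y) z = bl M x z + bl M y z := by
  simp only [bl, add_dotProduct]

theorem bl_add_right (x y z : κ → R) : bl M x (y + z) = bl M x y + bl M x z := by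
  simp only [bl, mulVec_add, dotProduct_add]

theorem bl_smul_left (c : R) (x y : κ → R) : bl M (c • x) y = c * bl M x y := by
  simp only [bl, smul_dotProduct, smul_eq_mul]

theorem bl_smul_right (c : R) (x y : κ → R) : bl M x (c • y) = c * bl M x y := by
  simp only [bl, mulVec_smul, dotProduct_smul, smul_eq_mul]

theorem bl_sub_left (x y z : κ → R) : bl M (x - y) z = bl M x z - bl M y z := by
  simp only [bl, sub_dotProduct]

@[simp] theorem bl_zero_left (x : κ → R) : bl M 0 x = 0 := by simp [bl]

@[simp] theorem bl_zero_right (x : κ → R) : bl M x 0 = 0 := by simp [bl]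

theorem bl_self (x : κ → R) : bl M x x = 2 * qf M x := by
  rw [bl_eq, qf, two_mul]

theorem qf_map (φ : R →+* S) (x : κ → R) : qf (M.map φ) (φ ∘ x) = φ (qf M x) := by
  rw [qf, qf, RingHom.map_dotProduct]
  congr 1
  funext i
  simp [Function.comp, RingHom.map_mulVec]

theorem bl_map (φ : R →+* S) (x y : κ → R) : bl (M.map φ) (φ ∘ x) (φ ∘ y) = φ (bl M x y) := by
  rw [bl_eq, bl_eq, map_add, RingHom.map_dotProduct, RingHom.map_dotProduct]
  congr 2 <;> (funext i; simp [Function.comp, RingHom.map_mulVec])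

theorem qf_add_smul (x u : κ → R) (t : R) :
    qf M (x + t • u) = qf M x + t * bl M x u + t ^ 2 * qf M u := by
  rw [qf_add, qf_smul, bl_smul_right]; ring

theorem qf_eq_sum (x : κ → R) : qf M x = ∑ i, ∑ j, M i j * x i * x j := by
  simp only [qf, dotProduct, mulVec, Finset.mul_sum]
  exact Finset.sum_congr rfl fun i _ => Finset.sum_congr rfl fun j _ => by ring

theorem bl_eq_sum (x y : κ → R) : bl M x y = ∑ i, ∑ j, (M i j + M j i) * x i * y j := by
  simp only [bl, dotProduct, mulVec, Finset.mul_sum, Matrix.add_apply, Matrix.transpose_apply]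
  exact Finset.sum_congr rfl fun i _ => Finset.sum_congr rfl fun j _ => by ring

theorem qf_sub_mem (I : Ideal R) {x y : κ → R} (h : ∀ i, x i - y i ∈ I) :
    qf M x - qf M y ∈ I := by
  rw [← Ideal.Quotient.eq, ← qf_map, ← qf_map]
  congr 1
  funext i
  exact Ideal.Quotient.eq.2 (h i)

theorem bl_sub_mem (I : Ideal R) {x y u v : κ → R} (h : ∀ i, x i - y i ∈ I)
    (h' : ∀ i, u i - v i ∈ I) : bl M x u - bl M y v ∈ I := by
  rw [← Ideal.Quotient.eq, ← bl_map, ← bl_map]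
  congr 1 <;> funext i
  · exact Ideal.Quotient.eq.2 (h i)
  · exact Ideal.Quotient.eq.2 (h' i)

end Forms

/-- `N` is represented by `qf M` modulo every positive integer. -/
def CongRep {R κ : Type*} [CommRing R] [Fintype κ] (M : Matrix κ κ R) (N : R) : Prop :=
  ∀ D : ℕ, 0 < D → ∃ ξ : κ → R, (D : R) ∣ qf M ξ - N

theorem CongRep.map {R S κ : Type*} [CommRing R] [CommRing S] [Fintype κ] {M : Matrix κ κ R}
    {N : R} (h : CongRep M N) (φ : R →+* S) : CongRep (M.map φ) (φ N) := by
  intro D hD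
  obtain ⟨ξ, hξ⟩ := h D hD
  refine ⟨φ ∘ ξ, ?_⟩
  rw [qf_map, ← map_sub]
  simpa using map_dvd φ hξ

theorem CongRep.mul_sq {R κ : Type*} [CommRing R] [Fintype κ] {M : Matrix κ κ R}
    {N : R} (h : CongRep M N) (u : R) : CongRep M (N * u ^ 2) := by
  intro D hD
  obtain ⟨ξ, hξ⟩ := h D hD
  refine ⟨u • ξ, ?_⟩
  rw [qf_smul, mul_comm N, ← mul_sub]
  exact hξ.mul_left _

open MvPolynomial in
theorem exists_matrix_of_isHomogeneous {R κ : Type*} [CommRing R] [Fintype κ] [DecidableEq κ]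
    (Q : MvPolynomial κ R) (hQ : Q.IsHomogeneous 2) :
    ∃ M : Matrix κ κ R, Q = ∑ i, ∑ j, C (M i j) * X i * X j := by
  have key : ∀ (d : κ →₀ ℕ) (c : R), d.degree = 2 →
      ∃ M : Matrix κ κ R, monomial d c = ∑ i, ∑ j, C (M i j) * X i * X j := by
    intro d c hd
    have h0 : d ≠ 0 := by rintro rfl; simp at hd
    obtain ⟨i, hi⟩ := Finsupp.ne_iff.1 h0
    have hi' : Finsupp.single i 1 ≤ d := by
      rw [Finsupp.single_le_iff]; exact Nat.one_le_iff_ne_zero.2 hi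
    obtain ⟨e, he⟩ := exists_add_of_le hi'
    have hdeg : e.degree = 1 := by
      rw [he, map_add, Finsupp.degree_single] at hd; omega
    have h1 : e ≠ 0 := by rintro rfl; simp at hdeg
    obtain ⟨j, hj⟩ := Finsupp.ne_iff.1 h1
    have hj' : Finsupp.single j 1 ≤ e := by
      rw [Finsupp.single_le_iff]; exact Nat.one_le_iff_ne_zero.2 hj
    obtain ⟨f, hf⟩ := exists_add_of_le hj'
    have hf0 : f = 0 := by
      rw [hf, map_add, Finsupp.degree_single] at hdeg
      exact (Finsupp.degree_eq_zero_iff f).1 (by omega)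
    refine ⟨Matrix.of fun a b => if a = i ∧ b = j then c else 0, ?_⟩
    rw [Finset.sum_eq_single i, Finset.sum_eq_single j]
    · simp [he, hf, hf0, X, C_mul_monomial, monomial_mul]
    · intro b _ hb; simp [hb]
    · simp
    · intro b _ hb; simp [hb]
    · simp
  choose! F hF using key
  refine ⟨∑ d ∈ Q.support, F d (coeff d Q), ?_⟩
  conv_lhs => rw [Q.as_sum]
  have : ∀ d ∈ Q.support, monomial d (coeff d Q) =
      ∑ i, ∑ j, C (F d (coeff d Q) i j) * X i * X j := fun d hd => by
    refine hF d _ ?_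
    have := hQ (mem_support_iff.1 hd)
    exact (DFunLike.congr_fun (Finsupp.degree_eq_weight_one (R := ℕ)) d).trans this
  rw [Finset.sum_congr rfl this, Finset.sum_comm]
  refine Finset.sum_congr rfl fun i _ => ?_
  rw [Finset.sum_comm]
  refine Finset.sum_congr rfl fun j _ => ?_
  simp [Matrix.sum_apply, Finset.sum_mul]

open Polynomial

section Hensel

variable {a k : Type*} [CommRing a] [Field k] {φ : a →+* k} {π : a}

theorem exists_eq_C_mul_of_map_eq_zero (hker : ∀ x, φ x = 0 → π ∣ x) (p : a[X])
    (hp : p.map φ = 0) : ∃ q : a[X], p = C π * q ∧ q.natDegree ≤ p.natDegree := by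
  have h : ∀ i, π ∣ p.coeff i := fun i => hker _ (by
    have := congrArg (fun r => r.coeff i) hp
    simpa using this)
  choose c hc using h
  refine ⟨∑ i ∈ Finset.range (p.natDegree + 1), C (c i) * X ^ i, ?_, ?_⟩
  · conv_lhs => rw [p.as_sum_range_C_mul_X_pow]
    rw [Finset.mul_sum]
    refine Finset.sum_congr rfl fun i _ => ?_
    rw [hc i, C_mul]; ring
  · refine natDegree_sum_le_of_forall_le _ _ fun i hi => ?_
    exact (natDegree_C_mul_X_pow_le _ _).trans (by simp at hi; omega)

theorem isCoprime_of_map (hker : ∀ x, φ x = 0 → π ∣ x) (hnil : IsNilpotent π)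
    (hsurj : Function.Surjective φ) {p q : a[X]} (h : IsCoprime (p.map φ) (q.map φ)) :
    IsCoprime p q := by
  obtain ⟨u, v, huv⟩ := h
  obtain ⟨u, rfl⟩ := map_surjective φ hsurj u
  obtain ⟨v, rfl⟩ := map_surjective φ hsurj v
  obtain ⟨r, hr, -⟩ := exists_eq_C_mul_of_map_eq_zero hker (u * p + v * q - 1) (by
    simp [huv])
  have hu : IsUnit (u * p + v * q) := by
    have : u * p + v * q = 1 + C π * r := by rw [← hr]; ring
    rw [this]
    refine IsNilpotent.isUnit_one_add ?_
    exact Commute.isNilpotent_mul_right (Commute.all _ _) (hnil.map C)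
  obtain ⟨w, hw⟩ := hu
  refine ⟨↑w⁻¹ * u, ↑w⁻¹ * v, ?_⟩
  rw [mul_assoc, mul_assoc, ← mul_add, ← hw, Units.inv_mul]

theorem hensel_factor (hker : ∀ x, φ x = 0 → π ∣ x) (hφπ : φ π = 0) (hnil : IsNilpotent π)
    (hsurj : Function.Surjective φ) {h g₀ w₀ : a[X]} (hg₀ : g₀.Monic)
    (hgw : h.map φ = g₀.map φ * w₀.map φ) (hcop : IsCoprime (g₀.map φ) (w₀.map φ)) :
    ∃ g : a[X], g.Monic ∧ g ∣ h ∧ g.natDegree = g₀.natDegree ∧ g.map φ = g₀.map φ := by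
  have : Nontrivial a := φ.domain_nontrivial
  have key : ∀ j : ℕ, ∃ g w : a[X], g.Monic ∧ g.natDegree = g₀.natDegree ∧
      g.map φ = g₀.map φ ∧ w.map φ = w₀.map φ ∧ C π ^ (j + 1) ∣ h - g * w := by
    intro j
    induction j with
    | zero =>
      refine ⟨g₀, w₀, hg₀, rfl, rfl, rfl, ?_⟩
      obtain ⟨q, hq, -⟩ := exists_eq_C_mul_of_map_eq_zero hker (h - g₀ * w₀) (by simp [hgw])
      exact ⟨q, by rw [hq]; ring⟩
    | succ j ih =>
      obtain ⟨g, w, hg, hdeg, hgm, hwm, E, hE⟩ := ih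
      obtain ⟨u, v, huv⟩ := isCoprime_of_map hker hnil hsurj (p := g) (q := w)
        (by rwa [hgm, hwm])
      have hdiv := modByMonic_add_div (v * E) g
      have hr : ((C π ^ (j + 1)) * ((v * E) %ₘ g)).degree < g.degree := by
        rw [← C_pow]
        rw [← smul_eq_C_mul]
        exact (degree_smul_le _ _).trans_lt (degree_modByMonic_lt _ hg)
      set r := (v * E) %ₘ g
      set c := (v * E) /ₘ g
      refine ⟨g + C π ^ (j + 1) * r, w + C π ^ (j + 1) * (u * E + c * w),
        hg.add_of_left hr, ?_, ?_, ?_, ?_⟩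
      · rw [← hdeg]; exact natDegree_eq_of_degree_eq (degree_add_eq_left_of_degree_lt hr)
      · simp [hφπ, hgm]
      · simp [hφπ, hwm]
      · refine ⟨- (C π ^ j * (r * (u * E + c * w))), ?_⟩
        have : h = g * w + C π ^ (j + 1) * E := by rw [← hE]; ring
        rw [this]
        have e1 : E = g * (u * E + c * w) + r * w := by
          have : E = (u * g + v * w) * E := by rw [huv, one_mul]
          linear_combination this - w * hdiv
        linear_combination (C π ^ (j + 1)) * e1
  obtain ⟨e, he⟩ := hnil
  obtain ⟨g, w, hg, hdeg, hgm, -, hd⟩ := key e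
  refine ⟨g, hg, ⟨w, ?_⟩, hdeg, hgm⟩
  rw [← C_pow, pow_succ, he, zero_mul, C_0, zero_dvd_iff, sub_eq_zero] at hd
  exact hd

theorem exists_eq_C_pow_mul (hker : ∀ x, φ x = 0 → π ∣ x) (hnil : IsNilpotent π)
    (B : ℕ) (h : a[X]) (hB : h.natDegree ≤ B) :
    ∃ (j : ℕ) (h' : a[X]), h = C π ^ j * h' ∧ h'.natDegree ≤ B ∧ h'.map φ ≠ 0 := by
  have : Nontrivial a := φ.domain_nontrivial
  by_contra! hcon
  have key : ∀ j : ℕ, ∃ h' : a[X], h = C π ^ j * h' ∧ h'.natDegree ≤ B := by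
    intro j
    induction j with
    | zero => exact ⟨h, by simp, hB⟩
    | succ j ih =>
      obtain ⟨h', hh, hd⟩ := ih
      obtain ⟨q, hq, hqd⟩ := exists_eq_C_mul_of_map_eq_zero hker h' (hcon j h' hh hd)
      exact ⟨q, by rw [hh, pow_succ, mul_assoc, ← hq], hqd.trans hd⟩
  obtain ⟨e, he⟩ := hnil
  obtain ⟨h', hh, -⟩ := key e
  rw [← C_pow, he, C_0, zero_mul] at hh
  have := hcon e (X ^ B) (by rw [← C_pow, he, C_0, zero_mul, hh]) (by simp)
  simp at this

theorem exists_monic_lift (hsurj : Function.Surjective φ) {p : k[X]} (hp : p.Monic) :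
    ∃ q : a[X], q.map φ = p ∧ q.natDegree = p.natDegree ∧ q.Monic := by
  have : Nontrivial a := φ.domain_nontrivial
  obtain ⟨q, hq⟩ := map_surjective φ hsurj p
  exact lifts_and_natDegree_eq_and_monic ((mem_lifts p).2 ⟨q, hq⟩) hp

end Hensel

section Reflect

variable {a : Type*} [CommRing a]

theorem reflect_sum {ι : Type*} (s : Finset ι) (N : ℕ) (f : ι → a[X]) :
    reflect N (∑ i ∈ s, f i) = ∑ i ∈ s, reflect N (f i) := by
  classical
  induction s using Finset.induction_on with
  | empty => simp
  | insert i s hi ih => rw [Finset.sum_insert hi, Finset.sum_insert hi, reflect_add, ih]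

theorem qf_reflect {κ : Type*} [Fintype κ] (M : Matrix κ κ a) (m : ℕ) (y : κ → a[X])
    (hy : ∀ i, (y i).natDegree ≤ m) :
    reflect (m + m) (qf (M.map C) y) = qf (M.map C) fun i => reflect m (y i) := by
  simp only [qf_eq_sum, reflect_sum, Matrix.map_apply, mul_assoc, reflect_C_mul]
  refine Finset.sum_congr rfl fun i _ => Finset.sum_congr rfl fun j _ => ?_
  rw [reflect_mul _ _ (hy i) (hy j)]

theorem natDegree_qf_le {κ : Type*} [Fintype κ] (M : Matrix κ κ a) (m : ℕ) (y : κ → a[X])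
    (hy : ∀ i, (y i).natDegree ≤ m) : (qf (M.map C) y).natDegree ≤ m + m := by
  rw [qf_eq_sum]
  refine natDegree_sum_le_of_forall_le _ _ fun i _ => natDegree_sum_le_of_forall_le _ _ fun j _ => ?_
  rw [Matrix.map_apply, mul_assoc]
  exact (natDegree_C_mul_le _ _).trans (natDegree_mul_le_of_le (hy i) (hy j))

end Reflect

open Polynomial

theorem exists_sq_add_self_ne (k : Type*) [Field k] [Finite k] : ∃ c : k, ∀ x : k, x ^ 2 + x ≠ c := by
  by_contra! h
  have hinj : Function.Injective fun x : k => x ^ 2 + x := Finite.injective_iff_surjective.2 h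
  have : (0 : k) = -1 := hinj (by simp)
  simp at this

theorem exists_monic_quadratic_irreducible (k : Type*) [Field k] [Finite k] :
    ∃ p : k[X], p.Monic ∧ p.natDegree = 2 ∧ Irreducible p := by
  obtain ⟨c, hc⟩ := exists_sq_add_self_ne k
  have hd : (X ^ 2 + X - C c : k[X]).natDegree = 2 := by
    compute_degree!
  have hm : (X ^ 2 + X - C c : k[X]).Monic := by
    monicity!
  refine ⟨_, hm, hd, ?_⟩
  rw [hm.irreducible_iff_roots_eq_zero_of_degree_le_three (by omega) (by omega)]
  rw [Multiset.eq_zero_iff_forall_notMem]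
  intro x hx
  have := (mem_roots'.1 hx).2
  apply hc x
  simpa [sub_eq_zero] using this

variable {a k : Type*} [CommRing a] [Field k] [Finite k] {φ : a →+* k} {π : a}

/-- Local form of Springer's theorem: a value of a quadratic form over a finite local extension
of odd degree is already a value over the base. -/
theorem exists_qf_eq_of_dvd (hker : ∀ x, φ x = 0 → π ∣ x) (hφπ : φ π = 0) (hnil : IsNilpotent π)
    (hsurj : Function.Surjective φ) {κ : Type*} [Fintype κ] (M : Matrix κ κ a) (N : a)
    (m : ℕ) (hm : Odd m) (f : a[X]) (hf : f.Monic) (hfm : f.natDegree = m) (y : κ → a[X])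
    (hy : f ∣ qf (M.map C) y - C N) : ∃ ξ : κ → a, qf M ξ = N := by
  have : Nontrivial a := φ.domain_nontrivial
  induction m using Nat.strong_induction_on generalizing f y with
  | _ m ih =>
  have fin : ∀ (g l : a[X]) (z : κ → a[X]), g.Monic → Odd g.natDegree → g.natDegree < m →
      IsCoprime g l → g ∣ qf (M.map C) z - C N * l ^ 2 → ∃ ξ : κ → a, qf M ξ = N := by
    intro g l z hg hodd hlt ⟨u, w, huw⟩ hdvd
    refine ih _ hlt hodd g hg rfl (w • z) ?_
    rw [qf_smul]
    have e : w ^ 2 * qf (M.map C) z - C N =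
        w ^ 2 * (qf (M.map C) z - C N * l ^ 2) - g * (C N * u * (1 + w * l)) := by
      linear_combination (C N * (1 + w * l)) * huw
    rw [e]
    exact dvd_sub (hdvd.mul_left _) (dvd_mul_right _ _)
  obtain ⟨r, hr⟩ := hm
  rcases Nat.eq_zero_or_pos r with rfl | hrpos
  · refine ⟨fun i => (y i).eval (-f.coeff 0), ?_⟩
    have h1 := map_dvd (evalRingHom (-f.coeff 0)) hy
    have h0 : f.eval (-f.coeff 0) = 0 := by
      have : f = X + C (f.coeff 0) := by
        rw [hf.eq_X_add_C (by omega)]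
        simp
      rw [this]; simp
    rw [coe_evalRingHom, h0, zero_dvd_iff, eval_sub, eval_C, sub_eq_zero] at h1
    rw [← h1, ← coe_evalRingHom, ← qf_map]
    congr 1
    ext i j; simp
  obtain ⟨q₀, hq₀, hq₀d, hirr⟩ := exists_monic_quadratic_irreducible k
  obtain ⟨q, hqmap, hqd, hqm⟩ := exists_monic_lift hsurj hq₀
  set l := q ^ r with hl
  have hlm : l.Monic := hqm.pow r
  have hld : l.natDegree = m - 1 := by
    rw [hl, hqm.natDegree_pow, hqd, hq₀d]; omega
  set z : κ → a[X] := fun i => (l * y i) %ₘ f with hz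
  have hzd : ∀ i, (z i).natDegree ≤ m - 1 := fun i => by
    have := natDegree_modByMonic_lt (l * y i) hf (by rintro rfl; simp at hfm; omega)
    simp only [hz]; omega
  have hdvd : f ∣ qf (M.map C) z - C N * l ^ 2 := by
    have h1 : qf (M.map C) z - qf (M.map C) (l • y) ∈ Ideal.span {f} := by
      refine qf_sub_mem _ _ fun i => ?_
      rw [Ideal.mem_span_singleton]
      refine ⟨-((l * y i) /ₘ f), ?_⟩
      have := modByMonic_add_div (l * y i) f
      simp only [hz, Pi.smul_apply, smul_eq_mul]
      linear_combination this
    rw [Ideal.mem_span_singleton, qf_smul] at h1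
    have h2 := dvd_add h1 (hy.mul_left (l ^ 2))
    convert h2 using 1
    ring
  have hdeg : (qf (M.map C) z - C N * l ^ 2).natDegree ≤ (m - 1) + (m - 1) := by
    refine (natDegree_sub_le _ _).trans (max_le (natDegree_qf_le M _ z hzd) ?_)
    refine (natDegree_C_mul_le _ _).trans ?_
    rw [hlm.natDegree_pow, hld]; omega
  obtain ⟨h, hh⟩ := hdvd
  have hhd : h.natDegree ≤ m - 2 := by
    rcases eq_or_ne h 0 with rfl | h0
    · simp
    · rw [hh, hf.natDegree_mul' h0, hfm] at hdeg; omega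
  obtain ⟨j, h', hh', hh'd, hne⟩ := exists_eq_C_pow_mul hker hnil (m - 2) h hhd
  set D := (h'.map φ).natDegree with hD
  have hDle : D ≤ m - 2 := natDegree_map_le.trans hh'd
  rcases Nat.even_or_odd D with hDe | hDo
  · have e0 : reflect ((m - 1) + (m - 1)) (qf (M.map C) z - C N * l ^ 2) =
        qf (M.map C) (fun i => reflect (m - 1) (z i)) - C N * (reflect (m - 1) l) ^ 2 := by
      rw [reflect_sub, qf_reflect M _ z hzd, reflect_C_mul, sq, sq,
        reflect_mul _ _ hld.le hld.le]
    have e1 : reflect ((m - 1) + (m - 1)) (qf (M.map C) z - C N * l ^ 2) =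
        reflect m f * (C (π ^ j) * reflect (m - 2) h') := by
      rw [hh, hh', show (m - 1) + (m - 1) = m + (m - 2) by omega,
        reflect_mul _ _ hfm.le (by
          rw [← C_pow]; exact (natDegree_C_mul_le _ _).trans hh'd), ← C_pow, reflect_C_mul]
    have hrefl : reflect (m - 2) (h'.map φ) = X ^ (m - 2 - D) * reverse (h'.map φ) := by
      have h2 := reflect_mul (1 : k[X]) (h'.map φ) (F := m - 2 - D) (G := D) (by simp) le_rfl
      rw [one_mul, Nat.sub_add_cancel hDle, reflect_one] at h2
      rw [h2]; rfl
    have hcop : IsCoprime ((X ^ (m - 2 - D) : a[X]).map φ) (reverse (h'.map φ)) := by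
      rw [Polynomial.map_pow, map_X]
      refine IsCoprime.pow_left ?_
      rw [(irreducible_X).coprime_iff_not_dvd, X_dvd_iff, coeff_zero_reverse]
      exact leadingCoeff_ne_zero.2 hne
    obtain ⟨w₀, hw₀⟩ := map_surjective φ hsurj (reverse (h'.map φ))
    rw [← hw₀] at hcop hrefl
    obtain ⟨g, hg, hgdvd, hgdeg, hgmap⟩ := hensel_factor hker hφπ hnil hsurj
      (h := reflect (m - 2) h') (g₀ := X ^ (m - 2 - D)) (w₀ := w₀) (monic_X_pow _)
      (by rw [← reflect_map, hrefl, Polynomial.map_pow, map_X]) hcop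
    rw [natDegree_X_pow] at hgdeg
    refine fin g (reflect (m - 1) l) (fun i => reflect (m - 1) (z i)) hg ?_ ?_ ?_ ?_
    · rw [hgdeg]
      obtain ⟨s, hs⟩ := hDe
      exact ⟨r - s - 1, by omega⟩
    · omega
    · refine isCoprime_of_map hker hnil hsurj ?_
      rw [hgmap, Polynomial.map_pow, map_X]
      refine IsCoprime.pow_left ?_
      rw [(irreducible_X).coprime_iff_not_dvd, X_dvd_iff, coeff_map, coeff_reflect, revAt_zero,
        ← hld, hlm.coeff_natDegree]
      simp
    · rw [← e0, e1]
      exact (hgdvd.mul_left _).mul_left _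
  · obtain ⟨c, p, hp, hpe⟩ : ∃ (c : ℕ) (p : k[X]), ¬ q₀ ∣ p ∧ h'.map φ = q₀ ^ c * p := by
      obtain ⟨p, hp1, hp2⟩ := (FiniteMultiplicity.of_prime_left hirr.prime hne).exists_eq_pow_mul_and_not_dvd
      exact ⟨_, p, hp2, hp1⟩
    have hp0 : p ≠ 0 := by rintro rfl; simp at hp
    have hlc : p.leadingCoeff ≠ 0 := leadingCoeff_ne_zero.2 hp0
    obtain ⟨g₀, hg₀map, hg₀d, hg₀⟩ := exists_monic_lift hsurj (monic_mul_leadingCoeff_inv hp0)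
    have hg₀d' : g₀.natDegree = p.natDegree := by
      rw [hg₀d, natDegree_mul_C (inv_ne_zero hlc)]
    obtain ⟨w₀, hw₀⟩ := map_surjective φ hsurj (C p.leadingCoeff * q₀ ^ c)
    have hcop : IsCoprime (p * C p.leadingCoeff⁻¹) q₀ := by
      refine (IsCoprime.symm ?_)
      rw [hirr.coprime_iff_not_dvd]
      intro hd
      apply hp
      have := hd.mul_right (C p.leadingCoeff)
      rwa [mul_assoc, ← C_mul, inv_mul_cancel₀ hlc, C_1, mul_one] at this
    have hunit : IsUnit (C p.leadingCoeff) := isUnit_C.2 hlc.isUnit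
    obtain ⟨g, hg, hgdvd, hgdeg, hgmap⟩ := hensel_factor hker hφπ hnil hsurj
      (h := h') (g₀ := g₀) (w₀ := w₀) hg₀ (by
        rw [hg₀map, hw₀, hpe, mul_assoc, ← mul_assoc (C _) (C _), ← C_mul, inv_mul_cancel₀ hlc, C_1]
        ring) (by
        rw [hg₀map, hw₀]
        exact (isCoprime_mul_unit_left_right hunit _ _).2 hcop.pow_right)
    have hDc : D = 2 * c + p.natDegree := by
      rw [hD, hpe, natDegree_mul (pow_ne_zero _ hirr.ne_zero) hp0, natDegree_pow, hq₀d]; ring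
    refine fin g l z hg ?_ ?_ ?_ ?_
    · rw [hgdeg, hg₀d']
      obtain ⟨s, hs⟩ := hDo
      exact ⟨s - c, by omega⟩
    · omega
    · refine isCoprime_of_map hker hnil hsurj ?_
      rw [hgmap, hg₀map, hl, Polynomial.map_pow, hqmap]
      exact hcop.pow_right
    · rw [hh, hh']
      exact (hgdvd.mul_left _).mul_left _

open Polynomial

section Dedekind

variable {R : Type*} [CommRing R] [IsDedekindDomain R]

theorem emultiplicity_span_eq_coe_iff {P : Ideal R} {x : R} {n : ℕ} :
    emultiplicity P (Ideal.span {x}) = n ↔ x ∈ P ^ n ∧ x ∉ P ^ (n + 1) := by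
  rw [emultiplicity_eq_coe, Ideal.dvd_span_singleton, Ideal.dvd_span_singleton]

theorem mul_mem_pow_and_notMem {P : Ideal R} (hP : Prime P) {x y : R} {m n : ℕ}
    (hx : x ∈ P ^ m ∧ x ∉ P ^ (m + 1)) (hy : y ∈ P ^ n ∧ y ∉ P ^ (n + 1)) :
    x * y ∈ P ^ (m + n) ∧ x * y ∉ P ^ (m + n + 1) := by
  rw [← emultiplicity_span_eq_coe_iff] at *
  rw [← Ideal.span_singleton_mul_span_singleton, emultiplicity_mul hP, hx, hy]
  push_cast; rfl

theorem pow_mem_pow_and_notMem {P : Ideal R} (hP : Prime P) {x : R} {m : ℕ}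
    (hx : x ∈ P ^ m ∧ x ∉ P ^ (m + 1)) (n : ℕ) :
    x ^ n ∈ P ^ (m * n) ∧ x ^ n ∉ P ^ (m * n + 1) := by
  rw [← emultiplicity_span_eq_coe_iff] at *
  rw [← Ideal.span_singleton_pow, emultiplicity_pow hP, hx]
  push_cast; rw [mul_comm]

theorem exists_mem_notMem_sq {P : Ideal R} (hP : Prime P) : ∃ x ∈ P, x ∉ P ^ 2 := by
  have := Ideal.isPrime_of_prime hP
  have : P ^ 2 < P ^ 1 := Ideal.pow_succ_lt_pow hP.ne_zero 1
  rw [pow_one] at this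
  exact SetLike.exists_of_lt this

theorem exists_sub_mul_mem_pow {P : Ideal R} (hP : Prime P) {π : R} (hπ : π ∈ P)
    (hπ2 : π ∉ P ^ 2) {x : R} (hx : x ∈ P) (k : ℕ) : ∃ d, x - π * d ∈ P ^ (k + 1) := by
  have := Ideal.isPrime_of_prime hP
  induction k with
  | zero => exact ⟨0, by simpa using hx⟩
  | succ k ih =>
    obtain ⟨d, hd⟩ := ih
    have h1 := pow_mem_pow_and_notMem hP (x := π) (m := 1) (by simpa using ⟨hπ, hπ2⟩) (k + 1)
    rw [one_mul] at h1
    obtain ⟨d', e, he, h2⟩ := Ideal.exists_mul_add_mem_pow_succ hP.ne_zero _ _ h1.1 h1.2 hd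
    refine ⟨d + π ^ k * d', ?_⟩
    convert he using 1
    linear_combination -h2

theorem mem_iff_forall_mem_pow {I : Ideal R} (hI : I ≠ ⊥) (x : R) :
    x ∈ I ↔ ∀ p ∈ (UniqueFactorizationMonoid.normalizedFactors I).toFinset,
      x ∈ p ^ ((UniqueFactorizationMonoid.normalizedFactors I).count p) := by
  classical
  conv_lhs => rw [← Ideal.prod_normalizedFactors_eq_self hI, Finset.prod_multiset_count,
    ← IsDedekindDomain.inf_pow_eq_prod_of_prime _ _ _ (fun i hi =>
      UniqueFactorizationMonoid.prime_of_normalized_factor i (Multiset.mem_toFinset.1 hi))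
      (fun _ _ _ _ h => h)]
  rw [Submodule.mem_finsetInf]

theorem congRep_of_forall_prime [CharZero R] {κ : Type*} [Fintype κ] (M : Matrix κ κ R) (N : R)
    (h : ∀ p : Ideal R, Prime p → ∀ k : ℕ, ∃ ξ : κ → R, qf M ξ - N ∈ p ^ k) : CongRep M N := by
  classical
  intro D hD
  have hI : Ideal.span {(D : R)} ≠ ⊥ := by
    rw [Ne, Ideal.span_singleton_eq_bot, Nat.cast_eq_zero]; omega
  have hpr : ∀ i ∈ (UniqueFactorizationMonoid.normalizedFactors (Ideal.span {(D : R)})).toFinset,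
    Prime i := fun i hi =>
      UniqueFactorizationMonoid.prime_of_normalized_factor i (Multiset.mem_toFinset.1 hi)
  choose! ξ hξ using h
  have key : ∀ t : κ, ∃ y : R, ∀ p,
      p ∈ (UniqueFactorizationMonoid.normalizedFactors (Ideal.span {(D : R)})).toFinset →
      y - ξ p ((UniqueFactorizationMonoid.normalizedFactors (Ideal.span {(D : R)})).count p) t ∈
      p ^ ((UniqueFactorizationMonoid.normalizedFactors (Ideal.span {(D : R)})).count p) := by
    intro t
    exact IsDedekindDomain.exists_forall_sub_mem_ideal (fun p => p) _ hpr (fun _ _ _ _ h => h)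
      (fun p => ξ p.1 ((UniqueFactorizationMonoid.normalizedFactors
        (Ideal.span {(D : R)})).count p.1) t)
  choose y hy using key
  refine ⟨y, ?_⟩
  rw [← Ideal.mem_span_singleton, mem_iff_forall_mem_pow hI]
  intro p hp
  have h1 := qf_sub_mem M _ (fun t => hy t p hp)
  have h2 := hξ p (hpr p hp)
    ((UniqueFactorizationMonoid.normalizedFactors (Ideal.span {(D : R)})).count p)
  convert Ideal.add_mem _ h1 h2 using 1
  ring

end Dedekind

section Link

variable {R S : Type*} [CommRing R] [IsDedekindDomain R] [CommRing S] [IsDedekindDomain S]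
  [Algebra R S]

theorem exists_generator {p : Ideal R} [p.IsMaximal] {P : Ideal S} [P.IsMaximal] [P.LiesOver p]
    (hP : P ≠ ⊥) [Finite (S ⧸ P)] :
    ∃ (θ : S) (g : R[X]), g.Monic ∧ g.natDegree = Module.finrank (R ⧸ p) (S ⧸ P) ∧
      aeval θ g ∈ P ∧ aeval θ g ∉ P ^ 2 ∧
      ∀ s : S, ∃ h : R[X], h.natDegree < g.natDegree ∧ s - aeval θ h ∈ P := by
  have hPp : Prime P := Ideal.prime_of_isPrime hP inferInstance
  let : Field (R ⧸ p) := Ideal.Quotient.field p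
  let : Field (S ⧸ P) := Ideal.Quotient.field P
  have hfin : Finite (R ⧸ p) := Finite.of_injective _ (algebraMap (R ⧸ p) (S ⧸ P)).injective
  have : FiniteDimensional (R ⧸ p) (S ⧸ P) := Module.Finite.of_finite
  obtain ⟨α, hα⟩ := Field.exists_primitive_element (R ⧸ p) (S ⧸ P)
  have hint : IsIntegral (R ⧸ p) α := IsIntegral.of_finite _ _
  set gb := minpoly (R ⧸ p) α with hgb
  have hgbm : gb.Monic := minpoly.monic hint
  obtain ⟨g, hgmap, hgd, hg⟩ := exists_monic_lift (φ := Ideal.Quotient.mk p)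
    Ideal.Quotient.mk_surjective hgbm
  have hmk : ∀ (θ : S) (h : R[X]), Ideal.Quotient.mk P (aeval θ h) =
      aeval (Ideal.Quotient.mk P θ) (h.map (Ideal.Quotient.mk p)) := by
    intro θ h
    rw [← Ideal.Quotient.algebraMap_eq p, aeval_map_algebraMap, ← Ideal.Quotient.algebraMap_eq P,
      aeval_algebraMap_apply]
  have hdeg : g.natDegree = Module.finrank (R ⧸ p) (S ⧸ P) := by
    rw [hgd, hgb, Field.primitive_element_iff_minpoly_natDegree_eq] at *
    exact hα
  have hadj : Algebra.adjoin (R ⧸ p) {α} = ⊤ :=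
    (IntermediateField.adjoin_simple_eq_top_iff_of_isAlgebraic hint.isAlgebraic).1 hα
  have hrep : ∀ θ : S, Ideal.Quotient.mk P θ = α → ∀ s : S, ∃ h : R[X],
      h.natDegree < g.natDegree ∧ s - aeval θ h ∈ P := by
    intro θ hθ s
    have h1 : Ideal.Quotient.mk P s ∈ Algebra.adjoin (R ⧸ p) {α} := hadj ▸ Algebra.mem_top
    rw [Algebra.adjoin_singleton_eq_range_aeval] at h1
    obtain ⟨q, hq⟩ := h1
    obtain ⟨q', rfl⟩ := map_surjective (Ideal.Quotient.mk p) Ideal.Quotient.mk_surjective q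
    refine ⟨q' %ₘ g, ?_, ?_⟩
    · refine natDegree_modByMonic_lt _ hg ?_
      intro h
      have := minpoly.natDegree_pos hint
      rw [← hgb, ← hgd, h] at this
      simp at this
    · rw [← Ideal.Quotient.eq_zero_iff_mem, map_sub, sub_eq_zero, hmk, hθ, map_modByMonic _ hg,
        hgmap, aeval_modByMonic_eq_self_of_root (by rw [hgb, minpoly.aeval])]
      exact hq.symm
  obtain ⟨θ, hθ⟩ := Ideal.Quotient.mk_surjective α
  have hmem : ∀ θ : S, Ideal.Quotient.mk P θ = α → aeval θ g ∈ P := by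
    intro θ hθ
    rw [← Ideal.Quotient.eq_zero_iff_mem, hmk, hθ, hgmap, hgb, minpoly.aeval]
  by_cases h2 : aeval θ g ∈ P ^ 2
  · obtain ⟨ϖ, hϖ, hϖ2⟩ := exists_mem_notMem_sq hPp
    have hθ' : Ideal.Quotient.mk P (θ + ϖ) = α := by
      rw [map_add, hθ, Ideal.Quotient.eq_zero_iff_mem.2 hϖ, add_zero]
    refine ⟨θ + ϖ, g, hg, hdeg, hmem _ hθ', ?_, hrep _ hθ'⟩
    intro h3
    obtain ⟨c, hc⟩ := binomExpansion (g.map (algebraMap R S)) θ ϖ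
    rw [eval_map_algebraMap, eval_map_algebraMap, derivative_map, eval_map_algebraMap] at hc
    have h4 : aeval θ (derivative g) * ϖ ∈ P ^ 2 := by
      have : aeval θ (derivative g) * ϖ = aeval (θ + ϖ) g - aeval θ g - c * ϖ ^ 2 := by
        linear_combination -hc
      rw [this]
      exact Ideal.sub_mem _ (Ideal.sub_mem _ h3 h2) (Ideal.mul_mem_left _ _ (Ideal.pow_mem_pow hϖ 2))
    have h5 : aeval θ (derivative g) ∈ P := by
      rw [mul_comm] at h4
      exact Ideal.mem_prime_of_mul_mem_pow hP (i := 1) hϖ2 h4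
    rw [← Ideal.Quotient.eq_zero_iff_mem, hmk, hθ, ← derivative_map, hgmap] at h5
    have hsep : gb.Separable := Algebra.IsSeparable.isSeparable (R ⧸ p) α
    exact hsep.aeval_derivative_ne_zero (minpoly.aeval _ _) h5
  · exact ⟨θ, g, hg, hdeg, hmem _ hθ, h2, hrep _ hθ⟩

theorem exists_poly_approx {p : Ideal R} [p.IsMaximal] {P : Ideal S} [P.IsMaximal] [P.LiesOver p]
    (hP : P ≠ ⊥) [Finite (S ⧸ P)] {e : ℕ}
    (he : p.map (algebraMap R S) ≤ P ^ e) (he' : ¬ p.map (algebraMap R S) ≤ P ^ (e + 1)) :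
    ∃ θ : S, ∀ k : ℕ, ∀ s : S, ∃ h : R[X],
      h.natDegree < e * Module.finrank (R ⧸ p) (S ⧸ P) ∧ s - aeval θ h ∈ P ^ (e * k) := by
  have hPp : Prime P := Ideal.prime_of_isPrime hP inferInstance
  obtain ⟨θ, g, hg, hgd, hg1, hg2, hrep⟩ := exists_generator (p := p) hP
  have hf : 0 < g.natDegree := by
    obtain ⟨h, hh, -⟩ := hrep 0
    omega
  have he0 : 0 < e := by
    rcases Nat.eq_zero_or_pos e with rfl | h
    · exfalso; apply he'
      rw [zero_add, pow_one, Ideal.map_le_iff_le_comap]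
      exact (Ideal.over_def P p).le
    · exact h
  obtain ⟨π, hπ, hπ'⟩ : ∃ π ∈ p, algebraMap R S π ∉ P ^ (e + 1) := by
    by_contra! h
    exact he' (Ideal.map_le_iff_le_comap.2 fun x hx => h x hx)
  have hπe : algebraMap R S π ∈ P ^ e := he (Ideal.mem_map_of_mem _ hπ)
  refine ⟨θ, fun k s => ?_⟩
  rw [← hgd]
  have key : ∀ i ≤ e * k, ∃ h : R[X], h.natDegree < e * g.natDegree ∧ s - aeval θ h ∈ P ^ i := by
    intro i
    induction i with
    | zero => exact fun _ => ⟨0, by simpa using ⟨he0, hf⟩, by simp⟩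
    | succ i ih =>
      intro hi
      obtain ⟨h, hh, hs⟩ := ih (by omega)
      set j := i % e
      set l := i / e
      have hij : e * l + j = i := Nat.div_add_mod i e
      have hj : j < e := Nat.mod_lt _ he0
      have hb := mul_mem_pow_and_notMem hPp (pow_mem_pow_and_notMem hPp ⟨hπe, hπ'⟩ l)
        (pow_mem_pow_and_notMem hPp (x := aeval θ g) (m := 1) (by simpa using ⟨hg1, hg2⟩) j)
      rw [one_mul, hij] at hb
      obtain ⟨d, c, hc, hdc⟩ := Ideal.exists_mul_add_mem_pow_succ hP _ _ hb.1 hb.2 hs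
      obtain ⟨h', hh', hd⟩ := hrep d
      refine ⟨h + C (π ^ l) * (g ^ j * h'), ?_, ?_⟩
      · refine lt_of_le_of_lt (natDegree_add_le _ _) (max_lt hh ?_)
        refine lt_of_le_of_lt (natDegree_C_mul_le _ _) ?_
        refine lt_of_le_of_lt natDegree_mul_le ?_
        rw [hg.natDegree_pow]
        calc j * g.natDegree + h'.natDegree < j * g.natDegree + g.natDegree := by omega
          _ = (j + 1) * g.natDegree := by ring
          _ ≤ e * g.natDegree := Nat.mul_le_mul_right _ hj
      · have : s - aeval θ (h + C (π ^ l) * (g ^ j * h')) =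
            algebraMap R S π ^ l * aeval θ g ^ j * (d - aeval θ h') + c := by
          simp only [map_add, map_mul, map_pow, aeval_C]
          linear_combination -hdc
        rw [this]
        refine Ideal.add_mem _ ?_ hc
        rw [pow_succ]
        exact Ideal.mul_mem_mul hb.1 hd
  exact key _ le_rfl

end Link

open Polynomial

theorem exists_qf_sub_mem_pow {R S κ : Type*} [CommRing R] [IsDedekindDomain R] [CommRing S]
    [IsDedekindDomain S] [Algebra R S] [Module.Finite R S] [Module.Free ℤ R] [Module.Finite ℤ R]
    [Module.Free ℤ S] [Module.Finite ℤ S] [CharZero R] [CharZero S] [Fintype κ]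
    {p : Ideal R} [p.IsMaximal] (hp : p ≠ ⊥)
    {P : Ideal S} [P.IsMaximal] [P.LiesOver p] (hP : P ≠ ⊥) {e : ℕ}
    (he : p.map (algebraMap R S) ≤ P ^ e) (he' : ¬ p.map (algebraMap R S) ≤ P ^ (e + 1))
    (hodd : Odd (e * P.inertiaDeg R)) (M : Matrix κ κ R) (N : R) (x : κ → S)
    (hx : qf (M.map (algebraMap R S)) x = algebraMap R S N) (k : ℕ) :
    ∃ ξ : κ → R, qf M ξ - N ∈ p ^ (k + 1) := by
  have hpp : Prime p := Ideal.prime_of_isPrime hp inferInstance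
  have : Finite (S ⧸ P) := Ideal.finiteQuotientOfFreeOfNeBot P hP
  have : Finite (R ⧸ p) := Ideal.finiteQuotientOfFreeOfNeBot p hp
  have : Finite (R ⧸ p ^ (k + 1)) := Ideal.finiteQuotientOfFreeOfNeBot _ (pow_ne_zero _ hp)
  have : Finite (S ⧸ P ^ (e * (k + 1))) :=
    Ideal.finiteQuotientOfFreeOfNeBot _ (pow_ne_zero _ hP)
  let : Field (R ⧸ p) := Ideal.Quotient.field p
  obtain ⟨θ, hθ⟩ := exists_poly_approx (p := p) hP he he'
  set m := e * Module.finrank (R ⧸ p) (S ⧸ P) with hm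
  rw [Ideal.inertiaDeg_eq_of_isMaximal p P, ← hm] at hodd
  have hle : p ^ (k + 1) ≤ (P ^ (e * (k + 1))).comap (algebraMap R S) := by
    rw [← Ideal.map_le_iff_le_comap, Ideal.map_pow, pow_mul]
    exact Ideal.pow_right_mono he _
  let ρ : R ⧸ p ^ (k + 1) →+* S ⧸ P ^ (e * (k + 1)) := Ideal.quotientMap _ (algebraMap R S) hle
  let t : S ⧸ P ^ (e * (k + 1)) := Ideal.Quotient.mk _ θ
  have hρ : ∀ h : R[X], (h.map (Ideal.Quotient.mk (p ^ (k + 1)))).eval₂ ρ t =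
      Ideal.Quotient.mk (P ^ (e * (k + 1))) (aeval θ h) := by
    intro h
    rw [eval₂_map, aeval_def, hom_eval₂]
    congr 1
  have hsurj : ∀ s : S, ∃ h : (R ⧸ p ^ (k + 1))[X], h.natDegree < m ∧
      h.eval₂ ρ t = Ideal.Quotient.mk _ s := by
    intro s
    obtain ⟨h, h1, h2⟩ := hθ (k + 1) s
    refine ⟨h.map (Ideal.Quotient.mk _), natDegree_map_le.trans_lt h1, ?_⟩
    rw [hρ, eq_comm, Ideal.Quotient.eq]
    exact h2
  let F : (Fin m → R ⧸ p ^ (k + 1)) → S ⧸ P ^ (e * (k + 1)) := fun c => ∑ i, ρ (c i) * t ^ (i : ℕ)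
  have hF : ∀ h : (R ⧸ p ^ (k + 1))[X], h.natDegree < m →
      h.eval₂ ρ t = F fun i => h.coeff i := by
    intro h hh
    rw [eval₂_eq_sum_range' ρ hh, ← Fin.sum_univ_eq_sum_range (fun i => ρ (h.coeff i) * t ^ i)]
  have hFsurj : Function.Surjective F := by
    intro s
    obtain ⟨s, rfl⟩ := Ideal.Quotient.mk_surjective s
    obtain ⟨h, h1, h2⟩ := hsurj s
    exact ⟨_, (hF h h1).symm.trans h2⟩
  have hcard : Nat.card (Fin m → R ⧸ p ^ (k + 1)) = Nat.card (S ⧸ P ^ (e * (k + 1))) := by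
    have h1 : Nat.card (R ⧸ p ^ (k + 1)) = p.absNorm ^ (k + 1) := by
      rw [← map_pow, Ideal.absNorm_apply, Submodule.cardQuot_apply]
    have h2 : Nat.card (S ⧸ P ^ (e * (k + 1))) = P.absNorm ^ (e * (k + 1)) := by
      rw [← map_pow, Ideal.absNorm_apply, Submodule.cardQuot_apply]
    rw [Nat.card_fun, Nat.card_fin, h1, h2, ← Ideal.absNorm_pow_inertiaDeg p P,
      Ideal.inertiaDeg_eq_of_isMaximal p P, ← pow_mul, ← pow_mul, hm]
    congr 1; ring
  have hFinj : Function.Injective F := (hFsurj.bijective_of_nat_card_le hcard.le).1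
  obtain ⟨p₀, hp₀, hp₀t⟩ := hsurj (θ ^ m)
  have hnt : Nontrivial (R ⧸ p ^ (k + 1)) := by
    rw [Ideal.Quotient.nontrivial_iff]
    intro h
    have : p = ⊤ := top_le_iff.1 (h ▸ Ideal.pow_le_self (by omega))
    exact Ideal.IsPrime.ne_top inferInstance this
  have hdeg : (-p₀).degree < (m : WithBot ℕ) := by
    rw [degree_neg]
    exact degree_le_natDegree.trans_lt (by exact_mod_cast hp₀)
  have hf : (X ^ m + -p₀).Monic := monic_X_pow_add hdeg
  have hfd : (X ^ m + -p₀).natDegree = m := by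
    rw [natDegree_add_eq_left_of_degree_lt (by rwa [degree_X_pow]), natDegree_X_pow]
  have hf0 : (X ^ m + -p₀).eval₂ ρ t = 0 := by
    rw [eval₂_add, eval₂_neg, hp₀t]
    simp [t]
  choose y hy1 hy2 using fun i => hsurj (x i)
  have hdvd : (X ^ m + -p₀) ∣ qf ((M.map (Ideal.Quotient.mk (p ^ (k + 1)))).map C) y -
      C (Ideal.Quotient.mk (p ^ (k + 1)) N) := by
    set Y := qf ((M.map (Ideal.Quotient.mk (p ^ (k + 1)))).map C) y -
      C (Ideal.Quotient.mk (p ^ (k + 1)) N) with hY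
    have hY0 : Y.eval₂ ρ t = 0 := by
      rw [hY, ← coe_eval₂RingHom, map_sub, ← qf_map, sub_eq_zero]
      have e1 : ((M.map (Ideal.Quotient.mk (p ^ (k + 1)))).map C).map (eval₂RingHom ρ t) =
          (M.map (algebraMap R S)).map (Ideal.Quotient.mk (P ^ (e * (k + 1)))) := by
        ext i j; simp [ρ]
      have e2 : (eval₂RingHom ρ t) ∘ y = (Ideal.Quotient.mk (P ^ (e * (k + 1)))) ∘ x := by
        funext i; exact hy2 i
      rw [e1, e2, qf_map, hx]
      simp [ρ]
    rw [← modByMonic_eq_zero_iff_dvd hf]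
    have hrd : (Y %ₘ (X ^ m + -p₀)).natDegree < m := by
      have := natDegree_modByMonic_lt Y hf (by
        intro h
        rw [h, natDegree_one] at hfd
        rw [← hfd] at hodd
        simp at hodd)
      omega
    have hr0 : (Y %ₘ (X ^ m + -p₀)).eval₂ ρ t = 0 := by
      rw [← coe_eval₂RingHom] at hY0 hf0 ⊢
      have := congrArg (eval₂RingHom ρ t) (modByMonic_add_div Y (X ^ m + -p₀))
      rw [map_add, map_mul, hf0, zero_mul, add_zero, hY0] at this
      exact this
    rw [hF _ hrd] at hr0
    have h0 : F 0 = 0 := by simp [F]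
    have h1 := hFinj (hr0.trans h0.symm)
    ext i
    by_cases hi : i < m
    · simpa using congrFun h1 ⟨i, hi⟩
    · rw [coeff_eq_zero_of_natDegree_lt (by omega), coeff_zero]
  obtain ⟨π, hπ, hπ2⟩ := exists_mem_notMem_sq hpp
  obtain ⟨ξ, hξ⟩ := exists_qf_eq_of_dvd
    (φ := Ideal.Quotient.factor (Ideal.pow_le_self (I := p) (n := k + 1) (by omega)))
    (π := Ideal.Quotient.mk _ π) (by
      intro z hz
      obtain ⟨z, rfl⟩ := Ideal.Quotient.mk_surjective z
      rw [Ideal.Quotient.factor_mk, Ideal.Quotient.eq_zero_iff_mem] at hz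
      obtain ⟨d, hd⟩ := exists_sub_mul_mem_pow hpp hπ hπ2 hz k
      refine ⟨Ideal.Quotient.mk _ d, ?_⟩
      rw [← map_mul]
      exact Ideal.Quotient.eq.2 hd) (by
      rw [Ideal.Quotient.factor_mk]; exact Ideal.Quotient.eq_zero_iff_mem.2 hπ) (by
      refine ⟨k + 1, ?_⟩
      rw [← map_pow]; exact Ideal.Quotient.eq_zero_iff_mem.2 (Ideal.pow_mem_pow hπ _))
    (Ideal.Quotient.factor_surjective _) _ _ m hodd _ hf hfd y hdvd
  choose ξ' hξ' using fun i => Ideal.Quotient.mk_surjective (ξ i)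
  refine ⟨ξ', ?_⟩
  rw [← Ideal.Quotient.eq, ← hξ, ← qf_map]
  congr 1
  funext i; exact hξ' i

open NumberField in
/-- Springer's theorem at all finite places at once. -/
theorem congRep_of_odd_finrank {K L κ : Type*} [Field K] [NumberField K] [Field L] [NumberField L]
    [Algebra K L] [Fintype κ] (hodd : Odd (Module.finrank K L)) (M : Matrix κ κ (𝓞 K)) (N : 𝓞 K)
    (x : κ → 𝓞 L) (hx : qf (M.map (algebraMap (𝓞 K) (𝓞 L))) x = algebraMap (𝓞 K) (𝓞 L) N) :
    CongRep M N := by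
  refine congRep_of_forall_prime M N fun p hp k => ?_
  have hp0 : p ≠ ⊥ := hp.ne_zero
  have hpp : p.IsPrime := Ideal.isPrime_of_prime hp
  have hpm : p.IsMaximal := hpp.isMaximal hp0
  have hinj : Function.Injective (algebraMap (𝓞 K) (𝓞 L)) :=
    FaithfulSMul.algebraMap_injective _ _
  have hmap : p.map (algebraMap (𝓞 K) (𝓞 L)) ≠ ⊥ := by
    rwa [Ne, Ideal.map_eq_bot_iff_of_injective hinj]
  let := Fintype.ofFinite (p.primesOver (𝓞 L))
  have hsum := Ideal.sum_ramification_inertia_eq_finrank p (𝓞 L)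
  rw [← IsFractionRing.finrank_eq (𝓞 K) K (𝓞 L) L] at hsum
  obtain ⟨⟨P, hPp, hPo⟩, hP⟩ : ∃ P : p.primesOver (𝓞 L),
      Odd (P.1.ramificationIdx (𝓞 K) * P.1.inertiaDeg (𝓞 K)) := by
    by_contra! h
    rw [← hsum] at hodd
    exact (Nat.not_even_iff_odd.2 hodd) (Finset.even_sum _ fun P _ => Nat.not_odd_iff_even.1 (h P))
  have hPp : P.IsPrime := hPp
  have hPo : P.LiesOver p := hPo
  have hP0 : P ≠ ⊥ := Ideal.ne_bot_of_liesOver_of_ne_bot hp0 P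
  have hPm : P.IsMaximal := hPp.isMaximal hP0
  have he := Ideal.IsDedekindDomain.ramificationIdx_eq_multiplicity p P hmap
  have hfin : FiniteMultiplicity P (p.map (algebraMap (𝓞 K) (𝓞 L))) :=
    FiniteMultiplicity.of_prime_left (Ideal.prime_of_isPrime hP0 hPp) hmap
  obtain ⟨ξ, hξ⟩ := exists_qf_sub_mem_pow hp0 hP0 (e := P.ramificationIdx (𝓞 K))
    (by rw [← Ideal.dvd_iff_le, he]; exact pow_multiplicity_dvd _ _)
    (by rw [← Ideal.dvd_iff_le, he]; exact hfin.not_pow_dvd_of_multiplicity_lt (Nat.lt_succ_self _))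
    hP M N x hx k
  exact ⟨ξ, Ideal.pow_le_pow_right (Nat.le_succ k) hξ⟩

open Matrix

theorem qf_sum_smul {R κ ι : Type*} [CommRing R] [Fintype κ] [Fintype ι] (M : Matrix κ κ R)
    (w : ι → κ → R) (c : ι → R) :
    qf M (∑ i, c i • w i) = qf (Matrix.of fun i j => w i ⬝ᵥ M *ᵥ w j) c := by
  rw [qf_eq_sum (Matrix.of _), qf, mulVec_sum, sum_dotProduct]
  refine Finset.sum_congr rfl fun i _ => ?_
  rw [dotProduct_sum]
  refine Finset.sum_congr rfl fun j _ => ?_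
  rw [mulVec_smul, smul_dotProduct, dotProduct_smul, of_apply, smul_eq_mul, smul_eq_mul]
  ring

theorem exists_qf_eq_zero_of_finite {k : Type*} [Field k] [Finite k] {r : ℕ} (hr : 3 ≤ r)
    (M : Matrix (Fin r) (Fin r) k) : ∃ c, c ≠ 0 ∧ qf M c = 0 := by
  classical
  have := Fintype.ofFinite k
  let f : MvPolynomial (Fin r) k :=
    ∑ i, ∑ j, MvPolynomial.C (M i j) * MvPolynomial.X i * MvPolynomial.X j
  have hf : ∀ x, MvPolynomial.eval x f = qf M x := fun x => by
    simp [f, qf_eq_sum]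
  have hdeg : f.totalDegree ≤ 2 := by
    refine MvPolynomial.totalDegree_finsetSum_le fun i _ =>
      MvPolynomial.totalDegree_finsetSum_le fun j _ => ?_
    refine (MvPolynomial.totalDegree_mul _ _).trans ?_
    have h1 := MvPolynomial.totalDegree_mul (MvPolynomial.C (M i j) : MvPolynomial (Fin r) k)
      (MvPolynomial.X i)
    rw [MvPolynomial.totalDegree_C, MvPolynomial.totalDegree_X] at h1
    rw [MvPolynomial.totalDegree_X]
    omega
  obtain ⟨p, hp⟩ := CharP.exists k
  have hdvd := char_dvd_card_solutions p (f := f) (by rw [Fintype.card_fin]; omega)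
  have hprime : p.Prime := (CharP.char_is_prime_or_zero k p).resolve_right (CharP.char_ne_zero_of_finite k p)
  have hcard : 1 < Fintype.card {x : Fin r → k // MvPolynomial.eval x f = 0} := by
    refine lt_of_lt_of_le hprime.one_lt (Nat.le_of_dvd ?_ hdvd)
    exact Fintype.card_pos_iff.2 ⟨⟨0, by rw [hf, qf_zero]⟩⟩
  obtain ⟨⟨x, hx⟩, hne⟩ := Fintype.exists_ne_of_one_lt_card hcard ⟨0, by rw [hf, qf_zero]⟩
  exact ⟨x, fun h => hne (Subtype.ext h), by rw [← hf, hx]⟩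

theorem three_le_finrank_of_radical {k κ : Type*} [Field k] [Finite k] [Fintype κ]
    (hκ : 5 ≤ Fintype.card κ) (M : Matrix κ κ k) (Z : Submodule k (κ → k))
    (hZ : ∀ v, v ∈ Z ↔ qf M v = 0) : 3 ≤ Module.finrank k Z := by
  obtain ⟨W, hW⟩ := Submodule.exists_isCompl Z
  by_contra! hlt
  have hsum := Submodule.finrank_add_eq_of_isCompl hW
  rw [Module.finrank_fintype_fun_eq_card] at hsum
  let b := Module.finBasis k W
  obtain ⟨c, hc, hqc⟩ := exists_qf_eq_zero_of_finite (by omega : 3 ≤ Module.finrank k W)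
    (Matrix.of fun i j => (b i : κ → k) ⬝ᵥ M *ᵥ (b j : κ → k))
  rw [← qf_sum_smul, ← hZ] at hqc
  have hmem : (∑ i, c i • (b i : κ → k)) ∈ W :=
    Submodule.sum_mem _ fun i _ => Submodule.smul_mem _ _ (b i).2
  have h0 := (Submodule.disjoint_def.1 hW.disjoint) _ hqc hmem
  apply hc
  have h1 : ∑ i, c i • b i = 0 := Subtype.ext (by simpa using h0)
  funext i
  exact Fintype.linearIndependent_iff.1 b.linearIndependent c h1 i

theorem exists_matrix_div {A κ : Type*} [CommRing A] [IsDomain A] [CharZero A] [Fintype κ]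
    [LinearOrder κ] (M : Matrix κ κ A) (d : A) (h : ∀ c, d ∣ qf M c) :
    ∃ M' : Matrix κ κ A, M + Mᵀ = d • (M' + M'ᵀ) ∧ ∀ c, qf M c = d * qf M' c := by
  have hqe : ∀ i, qf M (Pi.single i 1) = M i i := fun i => by
    simp [qf]
  have hble : ∀ i j, bl M (Pi.single i 1) (Pi.single j 1) = M i j + M j i := fun i j => by
    simp [bl]
  have h1 : ∀ i, d ∣ M i i := fun i => hqe i ▸ h _
  have h2 : ∀ i j, d ∣ M i j + M j i := fun i j => by
    rw [← hble]
    have := qf_add M (Pi.single i 1) (Pi.single j 1)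
    rw [show bl M (Pi.single i 1) (Pi.single j 1) = qf M (Pi.single i 1 + Pi.single j 1) -
      qf M (Pi.single i 1) - qf M (Pi.single j 1) by rw [this]; ring]
    exact dvd_sub (dvd_sub (h _) (h _)) (h _)
  choose a ha using h1
  choose b hb using h2
  let M' : Matrix κ κ A := Matrix.of fun i j => if i = j then a i else if i < j then b i j else 0
  have hM' : M + Mᵀ = d • (M' + M'ᵀ) := by
    ext i j
    simp only [Matrix.add_apply, Matrix.transpose_apply, Matrix.smul_apply, smul_eq_mul, M', of_apply]
    rcases lt_trichotomy i j with hij | rfl | hij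
    · simp [hij.ne, hij.ne', hij, hij.not_gt, hb]
    · simp [ha]; ring
    · simp only [hij.ne, hij.ne', hij, hij.not_gt, if_false, if_true, zero_add]
      rw [add_comm, hb]
  refine ⟨M', hM', fun c => ?_⟩
  have e1 := bl_self M c
  have e2 := bl_self M' c
  have e3 : bl M c c = d * bl M' c c := by
    rw [bl, hM', smul_mulVec, dotProduct_smul, smul_eq_mul, bl]
  have : (2 : A) * (qf M c - d * qf M' c) = 0 := by
    linear_combination -e1 + e3 + d * e2
  exact sub_eq_zero.1 ((mul_eq_zero.1 this).resolve_left two_ne_zero)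

/-- `qf M` has approximate zeros of every precision whose gradient stays bounded below. -/
def ApproxIsotropic {A κ : Type*} [CommRing A] [Fintype κ] (π : A) (M : Matrix κ κ A) : Prop :=
  ∃ g : ℕ, ∀ k : ℕ, ∃ z u : κ → A, π ^ k ∣ qf M z ∧ ¬ π ^ (g + 1) ∣ bl M z u

section DVR

variable {A k κ : Type*} [CommRing A] [IsDomain A] [CharZero A] [Field k] [Finite k]
  {φ : A →+* k} {π : A} [Fintype κ] [LinearOrder κ]

theorem approxIsotropic_of_smooth (hloc : ∀ x, IsUnit x ∨ π ∣ x) (M : Matrix κ κ A)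
    {z u : κ → A} (hz : π ∣ qf M z) (hu : ¬ π ∣ bl M z u) : ApproxIsotropic π M := by
  have key : ∀ k : ℕ, ∃ z, π ^ (k + 1) ∣ qf M z ∧ ¬ π ∣ bl M z u := by
    intro k
    induction k with
    | zero => exact ⟨z, by simpa using hz, hu⟩
    | succ k ih =>
      obtain ⟨z, ⟨c, hc⟩, hzu⟩ := ih
      obtain ⟨β, hβ⟩ := (hloc (bl M z u)).resolve_right hzu
      refine ⟨z + (-(π ^ (k + 1) * c * ↑β⁻¹)) • u, ?_, ?_⟩
      · rw [qf_add_smul, hc, ← hβ]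
        refine ⟨π ^ k * (c * ↑β⁻¹) ^ 2 * qf M u, ?_⟩
        linear_combination (-π ^ (k + 1) * c) * β.inv_mul
      · rw [bl_add_left, bl_smul_left]
        intro h
        apply hzu
        refine (dvd_add_left ?_).1 h
        refine Dvd.dvd.mul_right ?_ _
        rw [dvd_neg, pow_succ]
        exact ((dvd_mul_left _ _).mul_right _).mul_right _
  refine ⟨0, fun k => ?_⟩
  obtain ⟨z, h1, h2⟩ := key k
  exact ⟨z, u, (pow_dvd_pow π (Nat.le_succ k)).trans h1, by simpa using h2⟩

theorem approxIsotropic_of_det (hκ : 5 ≤ Fintype.card κ) (hloc : ∀ x, IsUnit x ∨ π ∣ x)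
    (hπ : π ≠ 0) (hker : ∀ x, φ x = 0 ↔ π ∣ x) (hsurj : Function.Surjective φ)
    (v : ℕ) (M : Matrix κ κ A) (hM : ¬ π ^ (v + 1) ∣ (M + Mᵀ).det) : ApproxIsotropic π M := by
  induction v using Nat.strong_induction_on generalizing M with
  | _ v ih =>
  by_cases hsm : ∃ z u, π ∣ qf M z ∧ ¬ π ∣ bl M z u
  · obtain ⟨z, u, hz, hu⟩ := hsm
    exact approxIsotropic_of_smooth hloc M hz hu
  push Not at hsm
  have hlift : ∀ v : κ → k, ∃ w : κ → A, φ ∘ w = v := fun v => by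
    choose w hw using fun i => hsurj (v i)
    exact ⟨w, funext hw⟩
  have hrad : ∀ v w : κ → k, qf (M.map φ) v = 0 → bl (M.map φ) v w = 0 := by
    intro v w hv
    obtain ⟨v, rfl⟩ := hlift v
    obtain ⟨w, rfl⟩ := hlift w
    rw [qf_map, hker] at hv
    rw [bl_map, hker]
    exact hsm v w hv
  let Z : Submodule k (κ → k) :=
    { carrier := {v | qf (M.map φ) v = 0}
      add_mem' := fun {a b} ha hb => by
        rw [Set.mem_ofPred_eq] at *
        rw [qf_add, ha, hb, hrad _ _ ha]; simp
      zero_mem' := qf_zero _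
      smul_mem' := fun c x hx => by
        rw [Set.mem_ofPred_eq] at *
        rw [qf_smul, hx, mul_zero] }
  have hZ3 := three_le_finrank_of_radical hκ (M.map φ) Z fun v => Iff.rfl
  let b := Module.finBasis k Z
  choose z hz using fun i => hlift (b i : κ → k)
  have hφsum : ∀ c : Fin (Module.finrank k Z) → A,
      φ ∘ (∑ i, c i • z i) = ∑ i, φ (c i) • (b i : κ → k) := fun c => by
    funext t
    simp only [Function.comp, Finset.sum_apply, Pi.smul_apply, smul_eq_mul, map_sum, map_mul]
    refine Finset.sum_congr rfl fun i _ => ?_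
    rw [← hz i]; rfl
  obtain ⟨N', -, hN'⟩ := exists_matrix_div (Matrix.of fun i j => z i ⬝ᵥ M *ᵥ z j) π (by
    intro c
    rw [← qf_sum_smul, ← hker, ← qf_map, hφsum]
    exact Submodule.sum_mem Z fun i _ => Submodule.smul_mem _ _ (b i).2)
  obtain ⟨cb, hcb, hcb0⟩ := exists_qf_eq_zero_of_finite hZ3 (N'.map φ)
  obtain ⟨c, rfl⟩ : ∃ c, φ ∘ c = cb := by
    choose w hw using fun i => hsurj (cb i)
    exact ⟨w, funext hw⟩
  rw [qf_map, hker] at hcb0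
  set x := ∑ i, c i • z i with hx
  have hqx : π ^ 2 ∣ qf M x := by
    rw [hx, qf_sum_smul, hN', sq]
    exact mul_dvd_mul_left _ hcb0
  have hxne : φ ∘ x ≠ 0 := by
    rw [hx, hφsum]
    intro h0
    apply hcb
    have h1 : ∑ i, (φ ∘ c) i • b i = 0 := Subtype.ext (by simpa using h0)
    funext i
    exact Fintype.linearIndependent_iff.1 b.linearIndependent _ h1 i
  obtain ⟨i₀, hi₀⟩ := Function.ne_iff.1 hxne
  have hxu : ¬ π ∣ x i₀ := fun h => hi₀ ((hker _).2 h)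
  have hblx : ∀ w, π ∣ bl M x w := fun w => hsm x w ((dvd_pow_self π two_ne_zero).trans hqx)
  let T : Matrix κ κ A := (π • (1 : Matrix κ κ A)).updateCol i₀ x
  have hT : ∀ c, T *ᵥ c = c i₀ • x + π • (c - Pi.single i₀ (c i₀)) := by
    intro c
    funext i
    simp only [T, mulVec, dotProduct, updateCol_apply]
    rw [← Finset.add_sum_erase _ _ (Finset.mem_univ i₀)]
    simp only [if_true, Pi.add_apply, Pi.smul_apply, Pi.sub_apply, smul_eq_mul]
    rw [mul_comm]
    congr 1
    rw [Finset.sum_congr rfl (g := fun j => if i = j then π * c j else 0)]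
    · rw [Finset.sum_ite_eq]
      by_cases hi : i = i₀
      · subst hi; simp
      · simp [hi]
    · intro j hj
      rw [if_neg (Finset.ne_of_mem_erase hj)]
      simp [Matrix.one_apply]
  have hqT : ∀ c, qf M (T *ᵥ c) = qf (Tᵀ * M * T) c := by
    intro c
    rw [qf, qf, ← mulVec_mulVec, ← mulVec_mulVec, dotProduct_mulVec c, vecMul_transpose]
  obtain ⟨M', hM', hqM'⟩ := exists_matrix_div (Tᵀ * M * T) (π ^ 2) (by
    intro c
    rw [← hqT, hT, qf_add, qf_smul, qf_smul, bl_smul_left, bl_smul_right]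
    obtain ⟨e, he⟩ := hblx (c - Pi.single i₀ (c i₀))
    obtain ⟨f, hf⟩ := hqx
    rw [he, hf]
    exact ⟨c i₀ ^ 2 * f + qf M (c - Pi.single i₀ (c i₀)) + c i₀ * e, by ring⟩)
  have hB : Tᵀ * (M + Mᵀ) * T = π ^ 2 • (M' + M'ᵀ) := by
    rw [← hM', Matrix.mul_add, Matrix.add_mul]
    congr 1
    rw [transpose_mul, transpose_mul, transpose_transpose, Matrix.mul_assoc]
  have hdetT : T.det = π ^ (Fintype.card κ - 1) * x i₀ := by
    have h1 := cramer_apply (π • (1 : Matrix κ κ A)) x i₀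
    rw [cramer_eq_adjugate_mulVec, adjugate_smul, adjugate_one, smul_mulVec, one_mulVec] at h1
    exact h1.symm
  have hdet : (M + Mᵀ).det * x i₀ ^ 2 = π ^ 2 * (M' + M'ᵀ).det := by
    have h1 := congrArg Matrix.det hB
    rw [det_mul, det_mul, det_transpose, det_smul, hdetT] at h1
    obtain ⟨n, hn⟩ : ∃ n, Fintype.card κ = n + 1 := ⟨Fintype.card κ - 1, by omega⟩
    rw [hn, Nat.add_sub_cancel] at h1
    refine mul_left_cancel₀ (pow_ne_zero (2 * n) hπ) ?_
    linear_combination h1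
  obtain ⟨β, hβ⟩ := (hloc (x i₀)).resolve_right hxu
  have hdet' : (M + Mᵀ).det = π ^ 2 * (M' + M'ᵀ).det * (↑β⁻¹) ^ 2 := by
    rw [← hdet, ← hβ, mul_assoc, ← mul_pow, Units.mul_inv, one_pow, mul_one]
  rcases Nat.eq_zero_or_pos v with rfl | hv
  · exact absurd (by rw [hdet', zero_add, pow_one, sq, mul_assoc, mul_assoc]; exact dvd_mul_right _ _) hM
  obtain ⟨g, hg⟩ := ih (v - 1) (by omega) M' (by
    intro h
    apply hM
    rw [hdet']
    refine Dvd.dvd.mul_right ?_ _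
    refine (pow_dvd_pow π (by omega : v + 1 ≤ 2 + (v - 1 + 1))).trans ?_
    rw [pow_add]
    exact mul_dvd_mul_left _ h)
  refine ⟨g + 2, fun k => ?_⟩
  obtain ⟨z', u', hz', hu'⟩ := hg k
  refine ⟨T *ᵥ z', T *ᵥ u', ?_, ?_⟩
  · rw [hqT, hqM']
    exact hz'.mul_left _
  · have : bl M (T *ᵥ z') (T *ᵥ u') = π ^ 2 * bl M' z' u' := by
      have h2 : bl M (T *ᵥ z') (T *ᵥ u') = z' ⬝ᵥ (Tᵀ * (M + Mᵀ) * T) *ᵥ u' := by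
        rw [bl, ← mulVec_mulVec, ← mulVec_mulVec, dotProduct_mulVec z', vecMul_transpose]
      rw [h2, hB, smul_mulVec, dotProduct_smul, smul_eq_mul, bl]
    rw [this, show g + 2 + 1 = 2 + (g + 1) by omega, pow_add,
      mul_dvd_mul_iff_left (pow_ne_zero 2 hπ)]
    exact hu'

end DVR

open Matrix

theorem exists_clear_denominators {R : Type*} [CommRing R] (S : Submonoid R) {A κ : Type*}
    [CommRing A] [Algebra R A] [IsLocalization S A] [Fintype κ] (z : κ → A) :
    ∃ (s : S) (w : κ → R), ∀ i, algebraMap R A (w i) = algebraMap R A s * z i := by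
  obtain ⟨s, hs⟩ := IsLocalization.exist_integer_multiples_of_finite S z
  choose w hw using hs
  exact ⟨s, w, fun i => by rw [hw, Algebra.smul_def]⟩

theorem exists_isotropic_prime {R κ : Type*} [CommRing R] [IsDedekindDomain R] [CharZero R]
    (𝔭 : Ideal R) [hp : 𝔭.IsPrime] (h𝔭 : 𝔭 ≠ ⊥) [Finite (R ⧸ 𝔭)] [Fintype κ] [LinearOrder κ]
    (hκ : 5 ≤ Fintype.card κ) (M : Matrix κ κ R) (hM : (M + Mᵀ).det ≠ 0) :
    ∃ g : ℕ, ∀ k : ℕ, ∃ z u : κ → R, qf M z ∈ 𝔭 ^ k ∧ bl M z u ∉ 𝔭 ^ (g + 1) := by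
  have hmax : 𝔭.IsMaximal := hp.isMaximal h𝔭
  let A := Localization.AtPrime 𝔭
  have hinj : Function.Injective (algebraMap R A) :=
    IsLocalization.injective A 𝔭.primeCompl_le_nonZeroDivisors
  have : CharZero A := charZero_of_injective_algebraMap hinj
  have : IsDiscreteValuationRing A :=
    IsLocalization.AtPrime.isDiscreteValuationRing_of_dedekind_domain R h𝔭 A
  obtain ⟨π, hπ⟩ := IsDiscreteValuationRing.exists_irreducible A
  have hmp : IsLocalRing.maximalIdeal A = Ideal.span {π} := hπ.maximalIdeal_eq
  have hmap : 𝔭.map (algebraMap R A) = Ideal.span {π} := by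
    rw [← hmp]; exact Localization.AtPrime.map_eq_maximalIdeal
  have hpow : ∀ (k : ℕ) (r : R), π ^ k ∣ algebraMap R A r ↔ r ∈ 𝔭 ^ k := by
    intro k r
    rw [← Ideal.mem_span_singleton, ← Ideal.span_singleton_pow, ← hmap, ← Ideal.map_pow]
    refine ⟨fun h => ?_, Ideal.mem_map_of_mem _⟩
    obtain ⟨⟨i, s⟩, his⟩ := (IsLocalization.mem_map_algebraMap_iff 𝔭.primeCompl A).1 h
    rw [← map_mul] at his
    have h2 := hinj his
    have h3 : r * s ∈ 𝔭 ^ k := by rw [h2]; exact i.2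
    rw [mul_comm] at h3
    exact (Ideal.IsPrime.mul_mem_pow 𝔭 h3).resolve_left s.2
  have hfin : Finite (IsLocalRing.ResidueField A) :=
    Finite.of_equiv _ (IsLocalization.AtPrime.equivQuotMaximalIdeal 𝔭 A).toEquiv
  have hloc : ∀ x : A, IsUnit x ∨ π ∣ x := fun x => by
    by_cases h : IsUnit x
    · exact Or.inl h
    · right
      rw [← Ideal.mem_span_singleton, ← hmp]
      exact (IsLocalRing.mem_maximalIdeal x).2 h
  have hker : ∀ x : A, IsLocalRing.residue A x = 0 ↔ π ∣ x := fun x => by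
    rw [IsLocalRing.residue_eq_zero_iff, hmp, Ideal.mem_span_singleton]
  have hdet : (M.map (algebraMap R A) + (M.map (algebraMap R A))ᵀ).det =
      algebraMap R A (M + Mᵀ).det := by
    rw [RingHom.map_det]
    congr 1
    ext i j
    simp
  obtain ⟨v, hv⟩ : ∃ v, ¬ π ^ (v + 1) ∣ (M.map (algebraMap R A) + (M.map (algebraMap R A))ᵀ).det := by
    have hfm : FiniteMultiplicity π (algebraMap R A (M + Mᵀ).det) :=
      FiniteMultiplicity.of_prime_left hπ.prime (by
        rwa [Ne, map_eq_zero_iff _ hinj])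
    obtain ⟨v, hv⟩ := hfm
    exact ⟨v, hdet ▸ hv⟩
  obtain ⟨g, hg⟩ := approxIsotropic_of_det hκ hloc hπ.ne_zero hker
    IsLocalRing.residue_surjective v _ hv
  refine ⟨g, fun k => ?_⟩
  obtain ⟨z, u, hz, hu⟩ := hg k
  obtain ⟨s, z', hz'⟩ := exists_clear_denominators 𝔭.primeCompl z
  obtain ⟨t, u', hu'⟩ := exists_clear_denominators 𝔭.primeCompl u
  have ez : algebraMap R A ∘ z' = algebraMap R A s • z := funext hz'
  have eu : algebraMap R A ∘ u' = algebraMap R A t • u := funext hu'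
  refine ⟨z', u', ?_, fun h => hu ?_⟩
  · rw [← hpow, ← qf_map, ez, qf_smul]
    exact hz.mul_left _
  · rw [← hpow, ← bl_map, ez, eu, bl_smul_left, bl_smul_right] at h
    have us : IsUnit (algebraMap R A s) := IsLocalization.map_units A s
    have ut : IsUnit (algebraMap R A t) := IsLocalization.map_units A t
    rwa [us.dvd_mul_left, ut.dvd_mul_left] at h

open Matrix

/-- The number of solutions of `qf M x = N` over `R ⧸ I`. -/
noncomputable def solCount {R κ : Type*} [CommRing R] [Fintype κ] (M : Matrix κ κ R) (N : R)
    (I : Ideal R) : ℕ :=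
  Nat.card {x : κ → R ⧸ I // qf (M.map (Ideal.Quotient.mk I)) x = Ideal.Quotient.mk I N}

section

variable {R κ : Type*} [CommRing R] [Fintype κ]

theorem card_pow_le_solCount (M : Matrix κ κ R) (N : R) (I J : Ideal R) [Finite (R ⧸ I)]
    [Finite (R ⧸ J)] (ξ u : κ → R)
    (h : ∀ x : κ → R, (∀ i, x i - ξ i ∈ J) → ∃ j : R, qf M (x + j • u) - N ∈ I) :
    Nat.card (R ⧸ I) ^ Fintype.card κ ≤
      solCount M N I * (Nat.card (R ⧸ I) * Nat.card (R ⧸ J) ^ Fintype.card κ) := by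
  let σ : (κ → R ⧸ I) → κ → R := fun y i => (y i).out
  let τ : (κ → R ⧸ I) → κ → R ⧸ J := fun y i => Ideal.Quotient.mk J (σ y i)
  let b : (κ → R ⧸ I) → κ → R := fun y i => σ y i - (τ y i).out + ξ i
  have hb : ∀ y i, b y i - ξ i ∈ J := fun y i => by
    simp only [b, add_sub_cancel_right]
    rw [← Ideal.Quotient.eq, Ideal.Quotient.mk_out]
  choose! j hj using fun y => h (b y) (hb y)
  let f : (κ → R ⧸ I) → {x : κ → R ⧸ I // qf (M.map (Ideal.Quotient.mk I)) x =
      Ideal.Quotient.mk I N} × (R ⧸ I) × (κ → R ⧸ J) := fun y =>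
    ⟨⟨Ideal.Quotient.mk I ∘ (b y + j y • u), by
      rw [qf_map, Ideal.Quotient.eq]; exact hj y⟩, Ideal.Quotient.mk I (j y), τ y⟩
  have hf : Function.Injective f := by
    intro y y' hyy
    simp only [f, Prod.mk.injEq, Subtype.mk.injEq] at hyy
    obtain ⟨h1, h2, h3⟩ := hyy
    funext i
    have h1i := congrFun h1 i
    simp only [Function.comp, Pi.add_apply, Pi.smul_apply, smul_eq_mul, map_add, map_mul, h2,
      b, map_sub, h3] at h1i
    have h4 : Ideal.Quotient.mk I (σ y i) = Ideal.Quotient.mk I (σ y' i) := by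
      linear_combination h1i
    simpa only [σ, Ideal.Quotient.mk_out] using h4
  have := Nat.card_le_card_of_injective f hf
  rwa [Nat.card_prod, Nat.card_prod, Nat.card_pi, Nat.card_pi, Finset.prod_const,
    Finset.prod_const, Finset.card_univ] at this

theorem solCount_inf (M : Matrix κ κ R) (N : R) (I J : Ideal R) (hIJ : IsCoprime I J)
    [Finite (R ⧸ (I ⊓ J))] :
    solCount M N I * solCount M N J ≤ solCount M N (I ⊓ J) := by
  rw [solCount, solCount, ← Nat.card_prod]
  let e := Ideal.quotientInfEquivQuotientProd I J hIJ
  have he : ∀ r, e (Ideal.Quotient.mk (I ⊓ J) r) =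
      (Ideal.Quotient.mk I r, Ideal.Quotient.mk J r) := fun r => rfl
  have h1 : (RingHom.fst _ _).comp (e.toRingHom.comp (Ideal.Quotient.mk (I ⊓ J))) =
    Ideal.Quotient.mk I := rfl
  have h2 : (RingHom.snd _ _).comp (e.toRingHom.comp (Ideal.Quotient.mk (I ⊓ J))) =
    Ideal.Quotient.mk J := rfl
  refine Nat.card_le_card_of_injective (fun p => ⟨fun i => e.symm (p.1.1 i, p.2.1 i), ?_⟩) ?_
  · apply e.injective
    rw [he]
    have key : ∀ x : κ → R ⧸ (I ⊓ J), e (qf (M.map (Ideal.Quotient.mk (I ⊓ J))) x) =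
        (qf (M.map (Ideal.Quotient.mk I)) fun i => (e (x i)).1,
          qf (M.map (Ideal.Quotient.mk J)) fun i => (e (x i)).2) := by
      intro x
      refine Prod.ext ?_ ?_
      · have := qf_map (M.map (Ideal.Quotient.mk (I ⊓ J))) ((RingHom.fst _ _).comp e.toRingHom) x
        exact this.symm
      · have := qf_map (M.map (Ideal.Quotient.mk (I ⊓ J))) ((RingHom.snd _ _).comp e.toRingHom) x
        exact this.symm
    rw [key]
    simp only [RingEquiv.apply_symm_apply]
    rw [p.1.2, p.2.2]
  · rintro ⟨⟨x, hx⟩, ⟨y, hy⟩⟩ ⟨⟨x', hx'⟩, ⟨y', hy'⟩⟩ h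
    simp only [Subtype.mk.injEq] at h
    have h3 : ∀ i, (x i, y i) = (x' i, y' i) := fun i => e.symm.injective (congrFun h i)
    simp only [Prod.mk.injEq, Subtype.mk.injEq]
    exact ⟨funext fun i => (Prod.mk.inj (h3 i)).1, funext fun i => (Prod.mk.inj (h3 i)).2⟩

end

section Dedekind

variable {R κ : Type*} [CommRing R] [IsDedekindDomain R] [Fintype κ]

theorem exists_newton {P : Ideal R} (hP : Prime P) (M : Matrix κ κ R) (N : R) (g : ℕ)
    (x u : κ → R) (hx : qf M x - N ∈ P ^ (2 * g + 1))
    (hu : bl M x u ∈ P ^ g ∧ bl M x u ∉ P ^ (g + 1)) (k : ℕ) :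
    ∃ j ∈ P ^ (g + 1), qf M (x + j • u) - N ∈ P ^ (2 * g + 1 + k) := by
  have hPp := Ideal.isPrime_of_prime hP
  induction k with
  | zero => exact ⟨0, zero_mem _, by simpa using hx⟩
  | succ k ih =>
    obtain ⟨j, hj, hjq⟩ := ih
    obtain ⟨τ, hτ, hτ'⟩ : ∃ τ ∈ P ^ (g + 1 + k), τ ∉ P ^ (g + 1 + k + 1) :=
      SetLike.exists_of_lt (Ideal.pow_succ_lt_pow hP.ne_zero _)
    have hb : bl M (x + j • u) u ∈ P ^ g ∧ bl M (x + j • u) u ∉ P ^ (g + 1) := by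
      rw [bl_add_left, bl_smul_left]
      have h1 : j * bl M u u ∈ P ^ (g + 1) := Ideal.mul_mem_right _ _ hj
      exact ⟨add_mem hu.1 (Ideal.pow_le_pow_right (Nat.le_succ _) h1),
        fun h => hu.2 ((Submodule.add_mem_iff_left _ h1).1 h)⟩
    have hτb := mul_mem_pow_and_notMem hP ⟨hτ, hτ'⟩ hb
    rw [show g + 1 + k + g = 2 * g + 1 + k by ring] at hτb
    obtain ⟨d, e, he, hde⟩ := Ideal.exists_mul_add_mem_pow_succ hP.ne_zero _ _ hτb.1 hτb.2 hjq
    refine ⟨j - τ * d, sub_mem hj (Ideal.mul_mem_right _ _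
      (Ideal.pow_le_pow_right (by omega) hτ)), ?_⟩
    have h2 : x + (j - τ * d) • u = (x + j • u) + (-(τ * d)) • u := by
      rw [sub_smul, neg_smul]; abel
    rw [h2, qf_add_smul]
    have h3 : qf M (x + j • u) + -(τ * d) * bl M (x + j • u) u + (-(τ * d)) ^ 2 * qf M u - N =
        e + τ ^ 2 * (d ^ 2 * qf M u) := by
      linear_combination -hde
    rw [h3]
    refine add_mem he (Ideal.mul_mem_right _ _ ?_)
    have h4 := Ideal.pow_mem_pow hτ 2
    rw [← pow_mul] at h4
    exact Ideal.pow_le_pow_right (by omega) h4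

theorem card_pow_le_solCount_prime_pow {P : Ideal R} (hP : Prime P) (M : Matrix κ κ R) (N : R)
    (g : ℕ) (ξ u : κ → R) (hx : qf M ξ - N ∈ P ^ (2 * g + 1))
    (hu : bl M ξ u ∈ P ^ g ∧ bl M ξ u ∉ P ^ (g + 1)) (k : ℕ) [Finite (R ⧸ P ^ k)]
    [Finite (R ⧸ P ^ (2 * g + 1))] :
    Nat.card (R ⧸ P ^ k) ^ Fintype.card κ ≤
      solCount M N (P ^ k) * (Nat.card (R ⧸ P ^ k) *
        Nat.card (R ⧸ P ^ (2 * g + 1)) ^ Fintype.card κ) := by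
  refine card_pow_le_solCount M N _ (P ^ (2 * g + 1)) ξ u fun x hxξ => ?_
  have h1 : qf M x - N ∈ P ^ (2 * g + 1) := by
    have := add_mem (qf_sub_mem M _ hxξ) hx
    simpa using this
  have h2 : bl M x u - bl M ξ u ∈ P ^ (2 * g + 1) := bl_sub_mem M _ hxξ (by simp)
  have h3 : bl M x u ∈ P ^ g ∧ bl M x u ∉ P ^ (g + 1) := by
    constructor
    · have := add_mem (Ideal.pow_le_pow_right (by omega) h2) hu.1
      simpa using this
    · intro h
      apply hu.2
      have := sub_mem h (Ideal.pow_le_pow_right (by omega) h2)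
      simpa using this
  obtain ⟨j, -, hj⟩ := exists_newton hP M N g x u h1 h3 k
  exact ⟨j, Ideal.pow_le_pow_right (by omega) hj⟩

end Dedekind

open Matrix

section

variable {A κ : Type*} [CommRing A] [Fintype A] [Fintype κ] [DecidableEq κ]

/-- The largest ideal on which an additive character of a ring is trivial. -/
def charIdeal (ψ : AddChar A ℂ) : Ideal A where
  carrier := {r | ∀ s, ψ (s * r) = 1}
  add_mem' := fun {a b} ha hb s => by rw [mul_add, ψ.map_add_eq_mul, ha, hb, one_mul]
  zero_mem' := fun s => by simp
  smul_mem' := fun c x hx s => by rw [smul_eq_mul, ← mul_assoc]; exact hx _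

theorem mem_charIdeal {ψ : AddChar A ℂ} {r : A} : r ∈ charIdeal ψ ↔ ∀ s, ψ (s * r) = 1 := Iff.rfl

theorem charIdeal_eq_top_iff {ψ : AddChar A ℂ} : charIdeal ψ = ⊤ ↔ ψ = 0 := by
  rw [Ideal.eq_top_iff_one, mem_charIdeal]
  simp only [mul_one]
  exact ⟨fun h => DFunLike.ext _ _ h, fun h s => by rw [h]; rfl⟩

/-- The character `x ↦ ψ (bl M x h)`. -/
def blChar (M : Matrix κ κ A) (ψ : AddChar A ℂ) (h : κ → A) : AddChar (κ → A) ℂ where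
  toFun x := ψ (bl M x h)
  map_zero_eq_one' := by simp
  map_add_eq_mul' x y := by rw [bl_add_left, ψ.map_add_eq_mul]

theorem norm_sq_sum_qf_le (M : Matrix κ κ A) (hM : IsUnit (M + Mᵀ).det) (ψ : AddChar A ℂ) :
    ‖∑ x : κ → A, ψ (qf M x)‖ ^ 2 ≤
      (Nat.card A : ℝ) ^ Fintype.card κ * (Nat.card (charIdeal ψ) : ℝ) ^ Fintype.card κ := by
  classical
  set S := ∑ x : κ → A, ψ (qf M x) with hS
  have hexp : (starRingEnd ℂ) S * S = ∑ h : κ → A, ψ (qf M h) * ∑ x, blChar M ψ h x := by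
    rw [hS, map_sum, Finset.sum_mul_sum]
    have : ∀ x : κ → A, ∑ y, (starRingEnd ℂ) (ψ (qf M x)) * ψ (qf M y) =
        ∑ h, ψ (qf M h) * blChar M ψ h x := by
      intro x
      rw [← Equiv.sum_comp (Equiv.addLeft x)]
      refine Finset.sum_congr rfl fun h _ => ?_
      rw [← AddChar.map_neg_eq_conj, ← ψ.map_add_eq_mul, Equiv.coe_addLeft, qf_add]
      change _ = ψ (qf M h) * ψ (bl M x h)
      rw [← ψ.map_add_eq_mul]
      congr 1
      ring
    rw [Finset.sum_congr rfl fun x _ => this x, Finset.sum_comm]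
    simp_rw [Finset.mul_sum]
  have h1 : ‖S‖ ^ 2 = ‖∑ h : κ → A, ψ (qf M h) * ∑ x, blChar M ψ h x‖ := by
    rw [← hexp, norm_mul, RCLike.norm_conj, sq]
  rw [h1]
  have hBinj : Function.Injective fun h : κ → A => (M + Mᵀ) *ᵥ h :=
    Matrix.mulVec_injective_of_isUnit ((Matrix.isUnit_iff_isUnit_det (M + Mᵀ)).2 hM)
  have hcard : ((Finset.univ.filter fun h : κ → A => blChar M ψ h = 0).card : ℝ) ≤
      (Nat.card (charIdeal ψ) : ℝ) ^ Fintype.card κ := by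
    rw [← Fintype.card_subtype, ← Nat.card_eq_fintype_card]
    have hmem : ∀ h : {h : κ → A // blChar M ψ h = 0}, ∀ i, ((M + Mᵀ) *ᵥ h.1) i ∈ charIdeal ψ := by
      intro h i s
      have h2 := DFunLike.congr_fun h.2 (Pi.single i s)
      change ψ (bl M (Pi.single i s) h.1) = 1 at h2
      rwa [bl, single_dotProduct] at h2
    let F : {h : κ → A // blChar M ψ h = 0} → κ → charIdeal ψ :=
      fun h i => ⟨((M + Mᵀ) *ᵥ h.1) i, hmem h i⟩
    have hF : Function.Injective F := by
      intro h h' hh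
      apply Subtype.ext
      apply hBinj
      funext i
      have := congrFun hh i
      simp only [F, Subtype.mk.injEq] at this
      exact this
    have := Nat.card_le_card_of_injective F hF
    rw [Nat.card_fun, Nat.card_eq_fintype_card (α := κ)] at this
    exact_mod_cast this
  calc ‖∑ h : κ → A, ψ (qf M h) * ∑ x, blChar M ψ h x‖
      ≤ ∑ h : κ → A, ‖ψ (qf M h) * ∑ x, blChar M ψ h x‖ := norm_sum_le _ _
    _ = ∑ h : κ → A, if blChar M ψ h = 0 then (Nat.card A : ℝ) ^ Fintype.card κ else 0 := by
        refine Finset.sum_congr rfl fun h _ => ?_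
        rw [norm_mul, AddChar.norm_apply, one_mul, AddChar.sum_eq_ite]
        split_ifs
        · rw [Fintype.card_pi, Finset.prod_const, Finset.card_univ, Nat.card_eq_fintype_card]
          simp
        · simp
    _ = (Finset.univ.filter fun h : κ → A => blChar M ψ h = 0).card *
          (Nat.card A : ℝ) ^ Fintype.card κ := by
        rw [← Finset.sum_filter, Finset.sum_const, nsmul_eq_mul]
    _ ≤ _ := by
        rw [mul_comm]
        gcongr

theorem card_charIdeal_eq_le [Fintype (Ideal A)] [DecidableEq (Ideal A)] (J : Ideal A) :
    (Finset.univ.filter fun ψ : AddChar A ℂ => charIdeal ψ = J).card ≤ Nat.card (A ⧸ J) := by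
  classical
  have : Fintype (A ⧸ J) := Fintype.ofFinite _
  rw [← Fintype.card_subtype, Nat.card_eq_fintype_card, ← AddChar.card_eq (α := A ⧸ J)]
  have hJ : ∀ ψ : {ψ : AddChar A ℂ // charIdeal ψ = J}, ∀ a b : A,
      Ideal.Quotient.mk J a = Ideal.Quotient.mk J b → ψ.1 a = ψ.1 b := by
    intro ψ a b hab
    rw [Ideal.Quotient.eq, ← ψ.2, mem_charIdeal] at hab
    have h1 := hab 1
    rw [one_mul] at h1
    have h2 := ψ.1.map_add_eq_mul (a - b) b
    rwa [sub_add_cancel, h1, one_mul] at h2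
  let f : {ψ : AddChar A ℂ // charIdeal ψ = J} → AddChar (A ⧸ J) ℂ := fun ψ =>
    { toFun := fun y => ψ.1 y.out
      map_zero_eq_one' := by
        rw [hJ ψ _ 0 (by rw [Ideal.Quotient.mk_out, map_zero]), AddChar.map_zero_eq_one]
      map_add_eq_mul' := fun x y => by
        rw [← ψ.1.map_add_eq_mul]
        exact hJ ψ _ _ (by rw [map_add]; simp only [Ideal.Quotient.mk_out]) }
  refine Fintype.card_le_of_injective f fun ψ ψ' h => Subtype.ext (DFunLike.ext _ _ fun a => ?_)
  have h1 := DFunLike.congr_fun h (Ideal.Quotient.mk J a)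
  change ψ.1 (Ideal.Quotient.mk J a).out = ψ'.1 (Ideal.Quotient.mk J a).out at h1
  rwa [hJ ψ _ a (Ideal.Quotient.mk_out _), hJ ψ' _ a (Ideal.Quotient.mk_out _)] at h1

theorem norm_sum_qf_le (hκ : 5 ≤ Fintype.card κ) (M : Matrix κ κ A)
    (hM : IsUnit (M + Mᵀ).det) (ψ : AddChar A ℂ) :
    ‖∑ x : κ → A, ψ (qf M x)‖ ≤
      (Nat.card A : ℝ) ^ Fintype.card κ * (Nat.card (A ⧸ charIdeal ψ) : ℝ) ^ (-(5 / 2) : ℝ) := by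
  have h1 := norm_sq_sum_qf_le M hM ψ
  have hq : Nat.card A = Nat.card (A ⧸ charIdeal ψ) * Nat.card (charIdeal ψ) := by
    rw [mul_comm]; exact Submodule.card_eq_card_quotient_mul_card _
  set q := Nat.card (A ⧸ charIdeal ψ) with hqdef
  have hq1 : (1 : ℝ) ≤ q := by
    have : 0 < q := Nat.card_pos
    exact_mod_cast this
  refine le_of_sq_le_sq (h1.trans ?_) (by positivity)
  have h2 : ((q : ℝ) ^ (-(5 / 2) : ℝ)) ^ 2 = ((q : ℝ) ^ 5)⁻¹ := by
    rw [← Real.rpow_natCast, ← Real.rpow_mul (by positivity), ← Real.rpow_natCast,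
      ← Real.rpow_neg (by positivity)]
    norm_num
  rw [mul_pow, h2, ← div_eq_mul_inv, le_div_iff₀ (by positivity)]
  have h3 : (q : ℝ) ^ 5 ≤ (q : ℝ) ^ Fintype.card κ := pow_le_pow_right₀ hq1 hκ
  have h4 : (Nat.card A : ℝ) = q * Nat.card (charIdeal ψ) := by exact_mod_cast hq
  calc _ ≤ (Nat.card A : ℝ) ^ Fintype.card κ * (Nat.card (charIdeal ψ) : ℝ) ^ Fintype.card κ *
      (q : ℝ) ^ Fintype.card κ := by gcongr
    _ = ((Nat.card A : ℝ) ^ Fintype.card κ) ^ 2 := by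
      rw [mul_assoc, ← mul_pow, mul_comm (Nat.card (charIdeal ψ) : ℝ), ← h4, sq]

theorem le_card_solutions [Fintype (Ideal A)] [DecidableEq (Ideal A)]
    (hκ : 5 ≤ Fintype.card κ) (M : Matrix κ κ A) (hM : IsUnit (M + Mᵀ).det) (N : A) :
    (Nat.card A : ℝ) ^ Fintype.card κ *
        (1 - ∑ J : Ideal A with J ≠ ⊤, (Nat.card (A ⧸ J) : ℝ) ^ (-(3 / 2) : ℝ)) ≤
      Nat.card {x : κ → A // qf M x = N} * Nat.card A := by
  classical
  set X := (Nat.card A : ℝ) ^ Fintype.card κ with hX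
  have h1 : ((Nat.card {x : κ → A // qf M x = N} * Nat.card A : ℕ) : ℂ) =
      ∑ ψ : AddChar A ℂ, ψ (-N) * ∑ x : κ → A, ψ (qf M x) := by
    simp_rw [Finset.mul_sum, ← AddChar.map_add_eq_mul]
    rw [Finset.sum_comm]
    simp_rw [AddChar.sum_apply_eq_ite]
    rw [← Finset.sum_filter, Finset.sum_const, nsmul_eq_mul, Nat.cast_mul,
      Nat.card_eq_fintype_card, Fintype.card_subtype, Nat.card_eq_fintype_card]
    congr 3
    refine Finset.filter_congr fun x _ => ?_
    rw [neg_add_eq_zero, eq_comm]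
  have hsplit := Finset.add_sum_erase Finset.univ
    (fun ψ : AddChar A ℂ => ψ (-N) * ∑ x : κ → A, ψ (qf M x)) (Finset.mem_univ 0)
  rw [← h1] at hsplit
  have h0 : (0 : AddChar A ℂ) (-N) * ∑ x : κ → A, (0 : AddChar A ℂ) (qf M x) = (X : ℂ) := by
    simp [hX]
  simp only [h0] at hsplit
  have hbound : ‖∑ ψ ∈ Finset.univ.erase (0 : AddChar A ℂ), ψ (-N) * ∑ x : κ → A, ψ (qf M x)‖ ≤
      X * ∑ J : Ideal A with J ≠ ⊤, (Nat.card (A ⧸ J) : ℝ) ^ (-(3 / 2) : ℝ) := by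
    calc _ ≤ ∑ ψ ∈ Finset.univ.erase (0 : AddChar A ℂ), ‖ψ (-N) * ∑ x : κ → A, ψ (qf M x)‖ :=
          norm_sum_le _ _
      _ ≤ ∑ ψ ∈ Finset.univ.erase (0 : AddChar A ℂ),
            X * (Nat.card (A ⧸ charIdeal ψ) : ℝ) ^ (-(5 / 2) : ℝ) := by
          refine Finset.sum_le_sum fun ψ _ => ?_
          rw [norm_mul, AddChar.norm_apply, one_mul]
          exact norm_sum_qf_le hκ M hM ψ
      _ = X * ∑ J : Ideal A with J ≠ ⊤, ∑ ψ ∈ Finset.univ.erase (0 : AddChar A ℂ) with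
            charIdeal ψ = J, (Nat.card (A ⧸ charIdeal ψ) : ℝ) ^ (-(5 / 2) : ℝ) := by
          rw [← Finset.mul_sum, Finset.sum_fiberwise_of_maps_to]
          intro ψ hψ
          rw [Finset.mem_filter]
          exact ⟨Finset.mem_univ _, fun h => Finset.ne_of_mem_erase hψ (charIdeal_eq_top_iff.1 h)⟩
      _ ≤ X * ∑ J : Ideal A with J ≠ ⊤, (Nat.card (A ⧸ J) : ℝ) ^ (-(3 / 2) : ℝ) := by
          gcongr with J hJ
          have hpos : (0 : ℝ) < Nat.card (A ⧸ J) := by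
            have : 0 < Nat.card (A ⧸ J) := Nat.card_pos
            exact_mod_cast this
          rw [Finset.sum_congr rfl (g := fun _ => (Nat.card (A ⧸ J) : ℝ) ^ (-(5 / 2) : ℝ))
            fun ψ hψ => by rw [(Finset.mem_filter.1 hψ).2], Finset.sum_const, nsmul_eq_mul]
          calc _ ≤ (Nat.card (A ⧸ J) : ℝ) * (Nat.card (A ⧸ J) : ℝ) ^ (-(5 / 2) : ℝ) := by
                gcongr
                refine le_trans (Finset.card_le_card ?_) (card_charIdeal_eq_le J)
                exact Finset.filter_subset_filter _ (Finset.erase_subset _ _)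
            _ = _ := by
                rw [← Real.rpow_one_add' hpos.le (by norm_num)]
                norm_num
  have h2 : (X : ℂ) = (Nat.card {x : κ → A // qf M x = N} * Nat.card A : ℕ) -
      ∑ ψ ∈ Finset.univ.erase (0 : AddChar A ℂ), ψ (-N) * ∑ x : κ → A, ψ (qf M x) := by
    rw [← hsplit]; ring
  have h3 : X ≤ (Nat.card {x : κ → A // qf M x = N} * Nat.card A : ℕ) +
      X * ∑ J : Ideal A with J ≠ ⊤, (Nat.card (A ⧸ J) : ℝ) ^ (-(3 / 2) : ℝ) := by
    have h4 := congrArg norm h2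
    rw [Complex.norm_real, Real.norm_of_nonneg (by positivity)] at h4
    rw [h4]
    refine (norm_sub_le _ _).trans (add_le_add ?_ ?_)
    · rw [Complex.norm_natCast]
    · rw [← h4]; exact hbound
  push_cast at h3
  linarith

end

open Matrix NumberField

section

variable {L κ : Type*} [Field L] [NumberField L] [Fintype κ]

theorem summable_absNorm_rpow (L : Type*) [Field L] [NumberField L] :
    Summable fun J : Ideal (𝓞 L) => (Ideal.absNorm J : ℝ) ^ (-(3 / 2) : ℝ) := by
  classical
  let a : ℕ → ℝ := fun n => Nat.card {J : Ideal (𝓞 L) // Ideal.absNorm J = n}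
  have hO : (fun n : ℕ => ∑ k ∈ Finset.Icc 1 n, a k) =O[Filter.atTop] fun n : ℕ => (n : ℝ) ^ (1 : ℝ) := by
    have h1 := ((Ideal.tendsto_norm_le_div_atTop L).comp tendsto_natCast_atTop_atTop).isBigO_one ℝ
    have h2 : (fun n : ℕ => ∑ k ∈ Finset.Icc 1 n, a k) =O[Filter.atTop]
        (fun n : ℕ => (Nat.card {I : Ideal (𝓞 L) // (Ideal.absNorm I : ℝ) ≤ n} : ℝ)) := by
      refine Asymptotics.IsBigO.of_bound 1 (Filter.Eventually.of_forall fun n => ?_)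
      have h3 : Nat.card {I : Ideal (𝓞 L) // (Ideal.absNorm I : ℝ) ≤ n} =
          ∑ k ∈ Finset.Icc 0 n, Nat.card {J : Ideal (𝓞 L) // Ideal.absNorm J = k} := by
        rw [← Finset.card_preimage_eq_sum_card_image_eq (fun k _ => Ideal.finite_setOfPred_absNorm_eq k)]
        simp [Set.coe_eq_subtype]
      rw [h3, one_mul, Real.norm_of_nonneg (by positivity), Real.norm_of_nonneg (by positivity)]
      push_cast
      exact Finset.sum_le_sum_of_subset_of_nonneg (Finset.Icc_subset_Icc_left zero_le_one)
        fun _ _ _ => by positivity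
    refine h2.trans ?_
    have h4 := h1.mul (Asymptotics.isBigO_refl (fun n : ℕ => (n : ℝ) ^ (1 : ℝ)) Filter.atTop)
    simp only [one_mul] at h4
    refine h4.congr' ?_ Filter.EventuallyEq.rfl
    filter_upwards [Filter.eventually_gt_atTop 0] with n hn
    simp only [Function.comp_apply, Real.rpow_one]
    field_simp
  have hS := LSeriesSummable_of_sum_norm_bigO_and_nonneg hO (fun n => Nat.cast_nonneg _) zero_le_one
    (s := (3 / 2 : ℝ)) (by norm_num)
  have hS' := hS.norm
  refine summable_of_sum_le (c := ∑' n, ‖LSeries.term (fun n => (a n : ℂ)) ((3 / 2 : ℝ) : ℂ) n‖)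
    (fun J => by positivity) fun u => ?_
  rw [← Finset.sum_fiberwise_of_maps_to (g := Ideal.absNorm) (t := u.image Ideal.absNorm)
    fun J hJ => Finset.mem_image_of_mem _ hJ]
  refine le_trans (Finset.sum_le_sum fun n _ => ?_) (hS'.sum_le_tsum (u.image Ideal.absNorm)
    fun _ _ => norm_nonneg _)
  rw [Finset.sum_congr rfl (g := fun _ => (n : ℝ) ^ (-(3 / 2) : ℝ)) fun J hJ => by
    rw [(Finset.mem_filter.1 hJ).2], Finset.sum_const, nsmul_eq_mul]
  rcases Nat.eq_zero_or_pos n with rfl | hn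
  · rw [Nat.cast_zero, Real.zero_rpow (by norm_num), mul_zero]
    exact norm_nonneg _
  rw [LSeries.term_of_ne_zero hn.ne', norm_div, Complex.norm_natCast_cpow_of_pos hn,
    Complex.norm_real, Real.norm_of_nonneg (by positivity), Complex.ofReal_re, Real.rpow_neg (by positivity),
    ← div_eq_mul_inv]
  gcongr
  have hfin : Finite {J : Ideal (𝓞 L) // Ideal.absNorm J = n} :=
    Ideal.finite_setOfPred_absNorm_eq (S := 𝓞 L) n
  simp only [a, Nat.cast_le]
  rw [← Nat.card_eq_finsetCard]
  exact Nat.card_le_card_of_injective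
    (fun J => (⟨J.1, (Finset.mem_filter.1 J.2).2⟩ : {J : Ideal (𝓞 L) // Ideal.absNorm J = n}))
    fun J J' h => Subtype.ext (by simpa using h)

theorem exists_absNorm_sum_le (L : Type*) [Field L] [NumberField L] :
    ∃ Y : ℕ, ∀ s : Finset (Ideal (𝓞 L)), (∀ J ∈ s, Y < Ideal.absNorm J) →
      ∑ J ∈ s, (Ideal.absNorm J : ℝ) ^ (-(3 / 2) : ℝ) ≤ 1 / 2 := by
  classical
  obtain ⟨t, ht⟩ := summable_iff_vanishing_norm.1 (summable_absNorm_rpow L) (1 / 2) (by norm_num)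
  refine ⟨t.sup Ideal.absNorm, fun s hs => ?_⟩
  have := ht s (Finset.disjoint_left.2 fun J hJ hJt =>
    (hs J hJ).not_ge (Finset.le_sup (f := Ideal.absNorm) hJt))
  exact (le_abs_self _).trans this.le

theorem exists_val {R : Type*} [CommRing R] (P : Ideal R) {x : R} {G : ℕ} (hx : x ∉ P ^ (G + 1)) :
    ∃ g ≤ G, x ∈ P ^ g ∧ x ∉ P ^ (g + 1) := by
  classical
  have hex : ∃ g, x ∉ P ^ (g + 1) := ⟨G, hx⟩
  refine ⟨Nat.find hex, Nat.find_min' hex hx, ?_, Nat.find_spec hex⟩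
  rcases h : Nat.find hex with _ | g
  · simp
  · by_contra h'
    have := Nat.find_min' hex h'
    omega

instance finite_quotient_pow (P : Ideal (𝓞 L)) [hP : Fact (P ≠ ⊥)] (k : ℕ) : Finite (𝓞 L ⧸ P ^ k) :=
  Ideal.finiteQuotientOfFreeOfNeBot _ (pow_ne_zero k hP.out)

theorem exists_local_density [LinearOrder κ] (hκ : 5 ≤ Fintype.card κ) (M : Matrix κ κ (𝓞 L))
    (hM : (M + Mᵀ).det ≠ 0) {P : Ideal (𝓞 L)} (hP : Prime P) :
    ∃ C : ℕ, 0 < C ∧ ∀ k N, CongRep M N → Nat.card (𝓞 L ⧸ P ^ k) ^ Fintype.card κ ≤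
      solCount M N (P ^ k) * (Nat.card (𝓞 L ⧸ P ^ k) * C) := by
  have hPp := Ideal.isPrime_of_prime hP
  have : Fact (P ≠ ⊥) := ⟨hP.ne_zero⟩
  have : Finite (𝓞 L ⧸ P) := Ideal.finiteQuotientOfFreeOfNeBot _ hP.ne_zero
  obtain ⟨g, hg⟩ := exists_isotropic_prime P hP.ne_zero hκ M hM
  have h2 : Ideal.span {(2 : 𝓞 L)} ≠ 0 := by
    rw [Ne, Ideal.zero_eq_bot, Ideal.span_singleton_eq_bot]; exact two_ne_zero
  obtain ⟨e, he⟩ := FiniteMultiplicity.of_prime_left hP h2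
  rw [Ideal.dvd_span_singleton] at he
  set G := 2 * g + 1 + e with hG
  have key : ∀ N, CongRep M N → ∃ h ≤ G, ∃ ξ u : κ → 𝓞 L, qf M ξ - N ∈ P ^ (2 * h + 1) ∧
      bl M ξ u ∈ P ^ h ∧ bl M ξ u ∉ P ^ (h + 1) := by
    intro N hN
    by_cases hNm : N ∈ P ^ (2 * g + 1)
    · obtain ⟨z, u, hz, hu⟩ := hg (2 * g + 1)
      obtain ⟨h, hh, h1, h2⟩ := exists_val P hu
      exact ⟨h, by omega, z, u, Ideal.pow_le_pow_right (by omega) (sub_mem hz hNm), h1, h2⟩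
    · have hpos : 0 < Ideal.absNorm P := Nat.pos_of_ne_zero fun h =>
        hP.ne_zero (Ideal.absNorm_eq_zero_iff.1 h)
      obtain ⟨ξ, hξ⟩ := hN (Ideal.absNorm P ^ (2 * G + 1)) (pow_pos hpos _)
      have hξ' : qf M ξ - N ∈ P ^ (2 * G + 1) := by
        refine Ideal.mem_of_dvd _ hξ ?_
        rw [Nat.cast_pow]
        exact Ideal.pow_mem_pow (Ideal.absNorm_mem P) _
      have hq : qf M ξ ∉ P ^ (2 * g + 1) := fun h => hNm (by
        have := sub_mem h (Ideal.pow_le_pow_right (by omega) hξ')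
        simpa using this)
      obtain ⟨a, ha, haq⟩ := exists_val P (G := 2 * g) hq
      obtain ⟨b, hb, hb2⟩ := exists_val P he
      have hbl := mul_mem_pow_and_notMem hP hb2 haq
      rw [← bl_self] at hbl
      exact ⟨b + a, by omega, ξ, ξ, Ideal.pow_le_pow_right (by omega) hξ', hbl⟩
  refine ⟨Nat.card (𝓞 L ⧸ P ^ (2 * G + 1)) ^ Fintype.card κ, pow_pos Nat.card_pos _,
    fun k N hN => ?_⟩
  obtain ⟨h, hh, ξ, u, h1, h3⟩ := key N hN
  refine (card_pow_le_solCount_prime_pow hP M N h ξ u h1 h3 k).trans ?_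
  gcongr
  exact Nat.card_le_card_of_surjective _ (Ideal.Quotient.factor_surjective
    (Ideal.pow_le_pow_right (by omega : 2 * h + 1 ≤ 2 * G + 1)))

theorem half_le_solCount [LinearOrder κ] (hκ : 5 ≤ Fintype.card κ) (M : Matrix κ κ (𝓞 L))
    {Y : ℕ} (hY : ∀ s : Finset (Ideal (𝓞 L)), (∀ J ∈ s, Y < Ideal.absNorm J) →
      ∑ J ∈ s, (Ideal.absNorm J : ℝ) ^ (-(3 / 2) : ℝ) ≤ 1 / 2)
    {I : Ideal (𝓞 L)} (hI : I ≠ ⊥)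
    (hIp : ∀ P : Ideal (𝓞 L), P.IsPrime → I ≤ P → Y < Ideal.absNorm P ∧ (M + Mᵀ).det ∉ P)
    (N : 𝓞 L) :
    1 / 2 * (Nat.card (𝓞 L ⧸ I) : ℝ) ^ Fintype.card κ ≤
      solCount M N I * Nat.card (𝓞 L ⧸ I) := by
  classical
  have : Finite (𝓞 L ⧸ I) := Ideal.finiteQuotientOfFreeOfNeBot _ hI
  have := Fintype.ofFinite (𝓞 L ⧸ I)
  have := Fintype.ofFinite (Ideal (𝓞 L ⧸ I))
  let f := Ideal.Quotient.mk I
  have hdet : IsUnit (M.map f + (M.map f)ᵀ).det := by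
    have h1 : (M.map f + (M.map f)ᵀ).det = f (M + Mᵀ).det := by
      rw [RingHom.map_det]
      congr 1
    rw [h1]
    by_contra h
    obtain ⟨m, hm, hm'⟩ := exists_max_ideal_of_mem_nonunits h
    refine (hIp (m.comap f) (Ideal.IsPrime.comap f) ?_).2 hm'
    intro x hx
    rw [Ideal.mem_comap, Ideal.Quotient.eq_zero_iff_mem.2 hx]
    exact zero_mem _
  have hcard : ∀ J : Ideal (𝓞 L ⧸ I), Nat.card ((𝓞 L ⧸ I) ⧸ J) = Ideal.absNorm (J.comap f) := by
    intro J
    have hker : RingHom.ker ((Ideal.Quotient.mk J).comp f) = J.comap f := by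
      rw [← RingHom.comap_ker, Ideal.mk_ker]
    rw [← hker, Ideal.absNorm_apply, Submodule.cardQuot_apply]
    exact (Nat.card_congr (RingHom.quotientKerEquivOfSurjective
      (f := (Ideal.Quotient.mk J).comp f)
      (Ideal.Quotient.mk_surjective.comp Ideal.Quotient.mk_surjective)).toEquiv).symm
  have hle := le_card_solutions hκ (M.map f) hdet (f N)
  have hsum : ∑ J : Ideal (𝓞 L ⧸ I) with J ≠ ⊤,
      (Nat.card ((𝓞 L ⧸ I) ⧸ J) : ℝ) ^ (-(3 / 2) : ℝ) ≤ 1 / 2 := by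
    have hinj : Function.Injective (Ideal.comap f) :=
      Ideal.comap_injective_of_surjective f Ideal.Quotient.mk_surjective
    have := hY ((Finset.univ.filter fun J : Ideal (𝓞 L ⧸ I) => J ≠ ⊤).image (Ideal.comap f)) (by
      intro J' hJ'
      obtain ⟨J, hJ, rfl⟩ := Finset.mem_image.1 hJ'
      obtain ⟨m, hm, hm'⟩ := Ideal.exists_le_maximal J (Finset.mem_filter.1 hJ).2
      have hlt := (hIp (m.comap f) (Ideal.IsPrime.comap f) (by
        intro x hx
        rw [Ideal.mem_comap, Ideal.Quotient.eq_zero_iff_mem.2 hx]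
        exact zero_mem _)).1
      refine lt_of_lt_of_le hlt (Nat.le_of_dvd ?_ (Ideal.absNorm_dvd_absNorm_of_le
        (Ideal.comap_mono hm')))
      rw [← hcard]
      exact Nat.card_pos)
    rw [Finset.sum_image fun _ _ _ _ h => hinj h] at this
    refine le_trans (le_of_eq (Finset.sum_congr rfl fun J _ => ?_)) this
    rw [hcard]
  refine le_trans ?_ hle
  rw [mul_comm]
  gcongr
  linarith

theorem card_quotient_mul (I J : Ideal (𝓞 L)) :
    Nat.card (𝓞 L ⧸ (I * J)) = Nat.card (𝓞 L ⧸ I) * Nat.card (𝓞 L ⧸ J) := by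
  have := map_mul Ideal.absNorm I J
  simpa only [Ideal.absNorm_apply, Submodule.cardQuot_apply] using this

theorem solCount_mul_ge (M : Matrix κ κ (𝓞 L)) (N : 𝓞 L) {I J : Ideal (𝓞 L)} (hI : I ≠ ⊥)
    (hJ : J ≠ ⊥) (hIJ : IsCoprime I J) {a b : ℝ} (hb : 0 ≤ b)
    (hIa : a * (Nat.card (𝓞 L ⧸ I) : ℝ) ^ Fintype.card κ ≤ solCount M N I * Nat.card (𝓞 L ⧸ I))
    (hJb : b * (Nat.card (𝓞 L ⧸ J) : ℝ) ^ Fintype.card κ ≤ solCount M N J * Nat.card (𝓞 L ⧸ J)) :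
    a * b * (Nat.card (𝓞 L ⧸ (I * J)) : ℝ) ^ Fintype.card κ ≤
      solCount M N (I * J) * Nat.card (𝓞 L ⧸ (I * J)) := by
  have hinf := (Ideal.mul_eq_inf_of_isCoprime hIJ).symm
  have : Finite (𝓞 L ⧸ (I ⊓ J)) := Ideal.finiteQuotientOfFreeOfNeBot _ (by
    rw [hinf]; exact mul_ne_zero hI hJ)
  have h1 : ((solCount M N I * solCount M N J : ℕ) : ℝ) ≤ solCount M N (I * J) := by
    rw [← hinf]; exact_mod_cast solCount_inf M N I J hIJ
  rw [card_quotient_mul]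
  push_cast at h1 ⊢
  calc _ = (a * (Nat.card (𝓞 L ⧸ I) : ℝ) ^ Fintype.card κ) *
        (b * (Nat.card (𝓞 L ⧸ J) : ℝ) ^ Fintype.card κ) := by ring
    _ ≤ (solCount M N I * Nat.card (𝓞 L ⧸ I)) * (solCount M N J * Nat.card (𝓞 L ⧸ J)) := by gcongr
    _ = (solCount M N I * solCount M N J : ℝ) * (Nat.card (𝓞 L ⧸ I) * Nat.card (𝓞 L ⧸ J)) := by ring
    _ ≤ _ := by gcongr

theorem isCoprime_prod_pow (s t : Finset (Ideal (𝓞 L))) (hs : ∀ P ∈ s, Prime P)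
    (ht : ∀ P ∈ t, Prime P) (hst : Disjoint s t) (e : Ideal (𝓞 L) → ℕ) :
    IsCoprime (∏ P ∈ s, P ^ e P) (∏ P ∈ t, P ^ e P) := by
  refine IsCoprime.prod_left fun P hP => IsCoprime.prod_right fun Q hQ => IsCoprime.pow ?_
  have h1 : P.IsMaximal := (Ideal.isPrime_of_prime (hs P hP)).isMaximal (hs P hP).ne_zero
  have h2 : Q.IsMaximal := (Ideal.isPrime_of_prime (ht Q hQ)).isMaximal (ht Q hQ).ne_zero
  exact Ideal.isCoprime_of_isMaximal fun h => Finset.disjoint_left.1 hst hP (h ▸ hQ)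

theorem solCount_prod_pow (M : Matrix κ κ (𝓞 L)) (N : 𝓞 L) (s : Finset (Ideal (𝓞 L)))
    (hs : ∀ P ∈ s, Prime P) (e : Ideal (𝓞 L) → ℕ) (c : Ideal (𝓞 L) → ℝ) (hc0 : ∀ P, 0 ≤ c P)
    (hc : ∀ P ∈ s, c P * (Nat.card (𝓞 L ⧸ P ^ e P) : ℝ) ^ Fintype.card κ ≤
      solCount M N (P ^ e P) * Nat.card (𝓞 L ⧸ P ^ e P)) :
    (∏ P ∈ s, c P) * (Nat.card (𝓞 L ⧸ ∏ P ∈ s, P ^ e P) : ℝ) ^ Fintype.card κ ≤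
      solCount M N (∏ P ∈ s, P ^ e P) * Nat.card (𝓞 L ⧸ ∏ P ∈ s, P ^ e P) := by
  classical
  induction s using Finset.induction_on with
  | empty =>
    have : Subsingleton (𝓞 L ⧸ (1 : Ideal (𝓞 L))) := by
      rw [Ideal.one_eq_top]; infer_instance
    have h1 : Nat.card (𝓞 L ⧸ (1 : Ideal (𝓞 L))) = 1 := Nat.card_unique
    have h2 : 1 ≤ solCount M N (1 : Ideal (𝓞 L)) := by
      have : Nonempty {x : κ → 𝓞 L ⧸ (1 : Ideal (𝓞 L)) //
          qf (M.map (Ideal.Quotient.mk 1)) x = Ideal.Quotient.mk 1 N} :=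
        ⟨⟨0, Subsingleton.elim _ _⟩⟩
      exact Nat.card_pos
    simp only [Finset.prod_empty, h1, Nat.cast_one, one_pow, mul_one]
    exact_mod_cast h2
  | insert P s hPs ih =>
    have ih' := ih (fun Q hQ => hs Q (Finset.mem_insert_of_mem hQ))
      fun Q hQ => hc Q (Finset.mem_insert_of_mem hQ)
    have hcop := isCoprime_prod_pow {P} s (by simpa using hs P (Finset.mem_insert_self _ _))
      (fun Q hQ => hs Q (Finset.mem_insert_of_mem hQ)) (by simpa using hPs) e
    rw [Finset.prod_singleton] at hcop
    rw [Finset.prod_insert hPs, Finset.prod_insert hPs]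
    refine solCount_mul_ge M N (pow_ne_zero _ (hs P (Finset.mem_insert_self _ _)).ne_zero) ?_ hcop
      (Finset.prod_nonneg fun Q _ => hc0 Q) (hc P (Finset.mem_insert_self _ _)) ih'
    exact Finset.prod_ne_zero_iff.2 fun Q hQ =>
      pow_ne_zero _ (hs Q (Finset.mem_insert_of_mem hQ)).ne_zero

open UniqueFactorizationMonoid in
theorem exists_solCount_ge [LinearOrder κ] (hκ : 5 ≤ Fintype.card κ) (M : Matrix κ κ (𝓞 L))
    (hM : (M + Mᵀ).det ≠ 0) :
    ∃ c : ℝ, 0 < c ∧ ∀ I : Ideal (𝓞 L), I ≠ ⊥ → ∀ N, CongRep M N →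
      c * (Nat.card (𝓞 L ⧸ I) : ℝ) ^ Fintype.card κ ≤ solCount M N I * Nat.card (𝓞 L ⧸ I) := by
  classical
  obtain ⟨Y, hY⟩ := exists_absNorm_sum_le L
  have hbad : {P : Ideal (𝓞 L) | Prime P ∧ (Ideal.absNorm P ≤ Y ∨ (M + Mᵀ).det ∈ P)}.Finite := by
    refine (Ideal.finite_setOfPred_absNorm_le
      (max Y (Ideal.absNorm (Ideal.span {(M + Mᵀ).det})))).subset ?_
    rintro P ⟨hP, h | h⟩
    · exact h.trans (le_max_left _ _)
    · refine le_trans (Nat.le_of_dvd ?_ (Ideal.absNorm_dvd_absNorm_of_le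
        ((Ideal.span_singleton_le_iff_mem _).2 h))) (le_max_right _ _)
      refine Nat.pos_of_ne_zero fun h0 => hM ?_
      rwa [Ideal.absNorm_eq_zero_iff, Ideal.span_singleton_eq_bot] at h0
  set b := hbad.toFinset with hb
  have hbP : ∀ P ∈ b, Prime P := fun P hP => (hbad.mem_toFinset.1 hP).1
  have hC : ∀ P : Ideal (𝓞 L), ∃ c : ℝ, 0 < c ∧ (Prime P → ∀ k N, CongRep M N →
      c * (Nat.card (𝓞 L ⧸ P ^ k) : ℝ) ^ Fintype.card κ ≤
        solCount M N (P ^ k) * Nat.card (𝓞 L ⧸ P ^ k)) := by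
    intro P
    by_cases hP : Prime P
    · obtain ⟨C, hC, h⟩ := exists_local_density hκ M hM hP
      refine ⟨(C : ℝ)⁻¹, by positivity, fun _ k N hN => ?_⟩
      have h1 : ((Nat.card (𝓞 L ⧸ P ^ k) ^ Fintype.card κ : ℕ) : ℝ) ≤
        (solCount M N (P ^ k) * (Nat.card (𝓞 L ⧸ P ^ k) * C) : ℕ) := by exact_mod_cast h k N hN
      push_cast at h1
      rw [inv_mul_le_iff₀ (by positivity)]
      linarith
    · exact ⟨1, one_pos, fun h => absurd h hP⟩
  choose c hc0 hc using hC
  refine ⟨(∏ P ∈ b, c P) * (1 / 2), mul_pos (Finset.prod_pos fun P _ => hc0 P) (by norm_num),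
    fun I hI N hN => ?_⟩
  set F := (normalizedFactors I).toFinset with hF
  set e : Ideal (𝓞 L) → ℕ := fun P => (normalizedFactors I).count P with he
  have hFP : ∀ P ∈ F, Prime P := fun P hP =>
    prime_of_normalized_factor P (Multiset.mem_toFinset.1 hP)
  have hFb : ∀ P ∈ F \ b, Prime P := fun P hP => hFP P (Finset.mem_sdiff.1 hP).1
  have hIprod : I = (∏ P ∈ b, P ^ e P) * ∏ P ∈ F \ b, P ^ e P := by
    conv_lhs => rw [← Ideal.prod_normalizedFactors_eq_self hI, Finset.prod_multiset_count]
    rw [← Finset.prod_union Finset.disjoint_sdiff, Finset.union_sdiff_self_eq_union]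
    refine Finset.prod_subset Finset.subset_union_right fun P _ hP => ?_
    rw [Multiset.count_eq_zero_of_notMem (fun h => hP (Multiset.mem_toFinset.2 h)), pow_zero]
  rw [hIprod]
  refine solCount_mul_ge M N ?_ ?_ (isCoprime_prod_pow _ _ hbP hFb Finset.disjoint_sdiff e)
    (by norm_num) (solCount_prod_pow M N b hbP e c (fun P => (hc0 P).le)
      fun P hP => hc P (hbP P hP) _ N hN) ?_
  · exact Finset.prod_ne_zero_iff.2 fun Q hQ => pow_ne_zero _ (hbP Q hQ).ne_zero
  · exact Finset.prod_ne_zero_iff.2 fun Q hQ => pow_ne_zero _ (hFb Q hQ).ne_zero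
  · refine half_le_solCount hκ M hY (Finset.prod_ne_zero_iff.2 fun Q hQ =>
      pow_ne_zero _ (hFb Q hQ).ne_zero) (fun P hP hle => ?_) N
    obtain ⟨Q, hQ, hQP⟩ := (Ideal.IsPrime.prod_le hP).1 hle
    have hQP' : Q ≤ P := hP.le_of_pow_le hQP
    have hQmax : Q.IsMaximal := (Ideal.isPrime_of_prime (hFb Q hQ)).isMaximal (hFb Q hQ).ne_zero
    obtain rfl := hQmax.eq_of_le hP.ne_top hQP'
    have hnb : Q ∉ b := (Finset.mem_sdiff.1 hQ).2
    rw [hb, hbad.mem_toFinset, Set.mem_ofPred_eq] at hnb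
    push Not at hnb
    exact hnb (hFb Q hQ)

end

open Module

theorem abs_valMinAbs_le_of_cast_eq {q : ℕ} [NeZero q] {x : ℤ} {z : ZMod q} (h : (x : ZMod q) = z) :
    |z.valMinAbs| ≤ |x| := by
  rw [Int.abs_eq_natAbs, Int.abs_eq_natAbs]
  exact_mod_cast ZMod.natAbs_min_of_le_div_two q z.valMinAbs x
    (by rw [ZMod.coe_valMinAbs, h]) (ZMod.natAbs_valMinAbs_le z)

theorem abs_sub_lt_of_ediv_eq {x y z : ℤ} (hy : 0 < y) (h : x / y = z / y) : |x - z| < y := by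
  have h1 := Int.mul_ediv_add_emod x y
  have h2 := Int.mul_ediv_add_emod z y
  have h3 := Int.emod_nonneg x hy.ne'
  have h4 := Int.emod_nonneg z hy.ne'
  have h5 := Int.emod_lt_of_pos x hy
  have h6 := Int.emod_lt_of_pos z hy
  rw [h] at h1
  rw [abs_lt]
  constructor <;> linarith

section

variable {R ι : Type*} [CommRing R] [Fintype ι] [DecidableEq ι] (ω : Basis ι ℤ R)

/-- The finite set of elements all of whose coordinates are at most `X` in absolute value. -/
noncomputable def box (X : ℕ) : Finset R :=
  (Fintype.piFinset fun _ : ι => Finset.Icc (-(X : ℤ)) X).map ω.equivFun.symm.toEquiv.toEmbedding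

theorem mem_box {X : ℕ} {x : R} : x ∈ box ω X ↔ ∀ i, |ω.repr x i| ≤ X := by
  simp only [box, Finset.mem_map, Fintype.mem_piFinset, Finset.mem_Icc, Equiv.coe_toEmbedding,
    LinearEquiv.coe_toEquiv, ← abs_le]
  constructor
  · rintro ⟨a, ha, rfl⟩ i
    have : ω.repr (ω.equivFun.symm a) i = a i :=
      congrFun (LinearEquiv.apply_symm_apply ω.equivFun a) i
    exact this ▸ ha i
  · intro h
    exact ⟨ω.equivFun x, h, LinearEquiv.symm_apply_apply _ _⟩

theorem card_box (X : ℕ) : (box ω X).card = (2 * X + 1) ^ Fintype.card ι := by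
  rw [box, Finset.card_map, Fintype.card_piFinset, Finset.prod_const, Int.card_Icc,
    Finset.card_univ]
  congr 1
  omega

theorem zero_mem_box (X : ℕ) : (0 : R) ∈ box ω X := by
  simp [mem_box]

theorem add_mem_box {X Y : ℕ} {x y : R} (hx : x ∈ box ω X) (hy : y ∈ box ω Y) :
    x + y ∈ box ω (X + Y) := by
  rw [mem_box] at *
  intro i
  rw [map_add, Finsupp.add_apply]
  push_cast
  exact (abs_add_le _ _).trans (add_le_add (hx i) (hy i))

theorem neg_mem_box {X : ℕ} {x : R} (hx : x ∈ box ω X) : -x ∈ box ω X := by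
  rw [mem_box] at *
  intro i
  simpa using hx i

theorem sub_mem_box {X Y : ℕ} {x y : R} (hx : x ∈ box ω X) (hy : y ∈ box ω Y) :
    x - y ∈ box ω (X + Y) := by
  rw [sub_eq_add_neg]
  exact add_mem_box ω hx (neg_mem_box ω hy)

/-- A bound for the coordinates of a product in terms of those of its factors. -/
theorem exists_mul_bound : ∃ C : ℕ, 0 < C ∧ ∀ (x y : R) (A B : ℝ), 0 ≤ A →
    (∀ i, |(ω.repr x i : ℝ)| ≤ A) → (∀ i, |(ω.repr y i : ℝ)| ≤ B) →
    ∀ l, |(ω.repr (x * y) l : ℝ)| ≤ C * A * B := by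
  refine ⟨1 + ∑ l, ∑ i, ∑ j, (ω.repr (ω i * ω j) l).natAbs, by omega, fun x y A B hA hx hy l => ?_⟩
  have hB : 0 ≤ B := (abs_nonneg _).trans (hy l)
  have hxy : ω.repr (x * y) l = ∑ i, ∑ j, ω.repr x i * ω.repr y j * ω.repr (ω i * ω j) l := by
    conv_lhs => rw [← ω.sum_repr x, ← ω.sum_repr y, Finset.sum_mul_sum]
    simp only [map_sum, Finsupp.finsetSum_apply, smul_mul_smul_comm, map_smul, Finsupp.smul_apply,
      smul_eq_mul]
  have h1 : (∑ i, ∑ j, |(ω.repr (ω i * ω j) l : ℝ)|) ≤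
      (1 + ∑ l, ∑ i, ∑ j, (ω.repr (ω i * ω j) l).natAbs : ℕ) := by
    simp only [Nat.cast_add, Nat.cast_sum, Nat.cast_natAbs, Int.cast_abs, Nat.cast_one]
    have := Finset.single_le_sum (f := fun l => ∑ i, ∑ j, |(ω.repr (ω i * ω j) l : ℝ)|)
      (fun l _ => Finset.sum_nonneg fun i _ => Finset.sum_nonneg fun j _ => abs_nonneg _)
      (Finset.mem_univ l)
    linarith
  rw [hxy]
  simp only [Int.cast_sum, Int.cast_mul]
  calc |∑ i, ∑ j, (ω.repr x i : ℝ) * ω.repr y j * ω.repr (ω i * ω j) l|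
      ≤ ∑ i, ∑ j, |(ω.repr x i : ℝ) * ω.repr y j * ω.repr (ω i * ω j) l| :=
        (Finset.abs_sum_le_sum_abs _ _).trans
          (Finset.sum_le_sum fun i _ => Finset.abs_sum_le_sum_abs _ _)
    _ ≤ ∑ i, ∑ j, A * B * |(ω.repr (ω i * ω j) l : ℝ)| := by
        refine Finset.sum_le_sum fun i _ => Finset.sum_le_sum fun j _ => ?_
        rw [abs_mul, abs_mul]
        have := hx i
        have := hy j
        gcongr
    _ = (∑ i, ∑ j, |(ω.repr (ω i * ω j) l : ℝ)|) * (A * B) := by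
        simp only [Finset.sum_mul]
        exact Finset.sum_congr rfl fun i _ => Finset.sum_congr rfl fun j _ => by ring
    _ ≤ _ := by
        rw [mul_assoc]
        exact mul_le_mul_of_nonneg_right h1 (mul_nonneg hA hB)

theorem exists_int_dvd (ω : Basis ι ℤ R) [IsDomain R] {h : R} (hh : h ≠ 0) : ∃ m : ℤ, m ≠ 0 ∧ h ∣ (m : R) := by
  have : Module.Finite ℤ R := Module.Finite.of_basis ω
  have : Module.Free ℤ R := Module.Free.of_basis ω
  have : Finite (R ⧸ Ideal.span {h}) :=
    Ideal.finiteQuotientOfFreeOfNeBot _ (by simpa using hh)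
  refine ⟨(Nat.card (R ⧸ Ideal.span {h}) : ℤ), by exact_mod_cast Nat.card_pos.ne', ?_⟩
  rw [← Ideal.mem_span_singleton, ← Ideal.Quotient.eq_zero_iff_mem]
  have := card_nsmul_eq_zero' (G := R ⧸ Ideal.span {h}) (x := 1)
  simpa using this

theorem exists_sub_eq_smul (ω : Basis ι ℤ R) (I : Submodule ℤ R) (H : Finset R) (hH : ∀ h ∈ H, h ∈ I) (k : ℕ)
    (hk : 0 < k) (hcard : k ^ Fintype.card ι < H.card) :
    ∃ h₁ ∈ H, ∃ h₂ ∈ H, h₁ ≠ h₂ ∧ ∃ h ∈ I, h₁ - h₂ = (k : ℤ) • h := by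
  classical
  have : NeZero k := ⟨hk.ne'⟩
  obtain ⟨r, b⟩ := Submodule.basisOfPid ω I
  have hr : r ≤ Fintype.card ι := by
    have : Module.Finite ℤ R := Module.Finite.of_basis ω
    have h1 := Submodule.finrank_le I
    rwa [finrank_eq_card_basis b, Fintype.card_fin, finrank_eq_card_basis ω] at h1
  let f : R → Fin r → ZMod k := fun h i => if hh : h ∈ I then (b.repr ⟨h, hh⟩ i : ZMod k) else 0
  obtain ⟨h₁, h1, h₂, h2, hne, heq⟩ := Finset.exists_ne_map_eq_of_card_lt_of_maps_to
    (s := H) (t := Finset.univ) (f := f) (by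
      rw [Finset.card_univ, Fintype.card_fun, ZMod.card, Fintype.card_fin]
      exact lt_of_le_of_lt (Nat.pow_le_pow_right hk hr) hcard) (fun _ _ => Finset.mem_coe.2 (Finset.mem_univ _))
  refine ⟨h₁, h1, h₂, h2, hne, ?_⟩
  have hdiv : ∀ i, ∃ c : ℤ, b.repr ⟨h₁, hH _ h1⟩ i - b.repr ⟨h₂, hH _ h2⟩ i = k * c := by
    intro i
    have := congrFun heq i
    simp only [f, dif_pos (hH _ h1), dif_pos (hH _ h2)] at this
    exact ((ZMod.intCast_eq_intCast_iff_dvd_sub _ _ _).1 this.symm)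
  choose c hc using hdiv
  refine ⟨((∑ i, c i • b i : I) : R), Submodule.coe_mem _, ?_⟩
  have : (⟨h₁, hH _ h1⟩ : I) - ⟨h₂, hH _ h2⟩ = (k : ℤ) • ∑ i, c i • b i := by
    rw [← b.sum_repr ⟨h₁, hH _ h1⟩, ← b.sum_repr ⟨h₂, hH _ h2⟩, ← Finset.sum_sub_distrib,
      Finset.smul_sum]
    refine Finset.sum_congr rfl fun i _ => ?_
    rw [← sub_smul, smul_smul, hc]
  exact congrArg (Subtype.val) this

/-- The elements `h` of a box for which every `A (h * ω i)` is close to zero. -/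
noncomputable def nearSet {q : ℕ} (P : ℕ) (A : R →ₗ[ℤ] ZMod q) : Finset R :=
  (box ω P).filter fun h => ∀ i, P * |(A (h * ω i)).valMinAbs| ≤ q

/-- The integral lift of `m ↦ A (h * m)` with smallest values on the basis. -/
noncomputable def lift {q : ℕ} (A : R →ₗ[ℤ] ZMod q) (h : R) : R →ₗ[ℤ] ℤ :=
  ω.constr ℤ fun i => (A (h * ω i)).valMinAbs

theorem lift_cast {q : ℕ} (A : R →ₗ[ℤ] ZMod q) (h m : R) :
    ((lift ω A h m : ℤ) : ZMod q) = A (h * m) := by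
  have : (Int.castAddHom (ZMod q)).toIntLinearMap.comp (lift ω A h) =
      A.comp (LinearMap.mulLeft ℤ h) := ω.ext fun i => by
    simp [lift]
  exact LinearMap.congr_fun this m

theorem lift_eq_sum {q : ℕ} (A : R →ₗ[ℤ] ZMod q) (h m : R) :
    lift ω A h m = ∑ i, ω.repr m i * (A (h * ω i)).valMinAbs := by
  rw [lift, ω.constr_apply_fintype ℤ]
  simp

theorem lift_mul_comm [IsDomain R] : ∃ C : ℕ, 0 < C ∧
    ∀ (q P b : ℕ) [NeZero q] (A : R →ₗ[ℤ] ZMod q) (h h' : R), 0 < P → 2 * C < b ^ 2 →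
      (∀ i, b * |ω.repr h i| ≤ P) → (∀ i, b * |ω.repr h' i| ≤ P) →
      (∀ i, b * P * |(A (h * ω i)).valMinAbs| ≤ q) →
      (∀ i, b * P * |(A (h' * ω i)).valMinAbs| ≤ q) →
      ∀ m, lift ω A h (h' * m) = lift ω A h' (h * m) := by
  obtain ⟨C, hC, hmul⟩ := exists_mul_bound ω
  obtain ⟨B, hB⟩ : ∃ B : ℕ, ∀ i l, |ω.repr (ω i) l| ≤ B := by
    refine ⟨1, fun i l => ?_⟩
    rw [ω.repr_self, Finsupp.single_apply]
    split_ifs <;> simp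
  refine ⟨Fintype.card ι * (C * (B + 1)) + 1, by omega,
    fun q P b _ A h h' hP hb hh hh' hA hA' => ?_⟩
  have hq : 0 < q := Nat.pos_of_ne_zero (NeZero.ne q)
  have hb0 : 0 < b := by
    rcases Nat.eq_zero_or_pos b with rfl | h
    · simp at hb
    · exact h
  have key : ∀ (h h' : R), (∀ i, b * |ω.repr h' i| ≤ P) →
      (∀ i, b * P * |(A (h * ω i)).valMinAbs| ≤ q) → ∀ i,
      2 * |(lift ω A h (h' * ω i) : ℝ)| < q := by
    intro h h' hh' hA i
    have hbr : (0 : ℝ) < b := by exact_mod_cast hb0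
    have hPr : (0 : ℝ) < P := by exact_mod_cast hP
    have hqr : (0 : ℝ) < q := by exact_mod_cast hq
    have h1 : ∀ l, |(ω.repr (h' * ω i) l : ℝ)| ≤ C * (P / b) * B := by
      refine hmul h' (ω i) (P / b) B (by positivity) (fun l => ?_) fun l => by exact_mod_cast hB i l
      rw [le_div_iff₀ hbr, mul_comm]
      exact_mod_cast hh' l
    have h2 : ∀ l, |((A (h * ω l)).valMinAbs : ℝ)| ≤ q / (b * P) := by
      intro l
      rw [le_div_iff₀ (by positivity), mul_comm]
      exact_mod_cast hA l
    have h3 : |(lift ω A h (h' * ω i) : ℝ)| ≤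
        Fintype.card ι * ((C * (P / b) * B) * (q / (b * P))) := by
      rw [lift_eq_sum]
      push_cast
      refine (Finset.abs_sum_le_sum_abs _ _).trans ?_
      refine (Finset.sum_le_card_nsmul _ _ _ fun l _ => ?_).trans_eq
        (by rw [Finset.card_univ, nsmul_eq_mul])
      rw [abs_mul]
      exact mul_le_mul (h1 l) (h2 l) (abs_nonneg _) (by positivity)
    have h4 : (2 : ℝ) * (Fintype.card ι * (C * B)) < b ^ 2 := by
      have : (2 : ℝ) * ((Fintype.card ι * (C * (B + 1)) + 1 : ℕ) : ℝ) < b ^ 2 := by exact_mod_cast hb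
      push_cast at this
      have : (0 : ℝ) ≤ Fintype.card ι * C := by positivity
      nlinarith
    have h5 : (Fintype.card ι : ℝ) * ((C * (P / b) * B) * (q / (b * P))) =
        (Fintype.card ι * (C * B)) * q / b ^ 2 := by
      field_simp
    rw [h5] at h3
    have h6 : 2 * (Fintype.card ι * (C * B)) * q / (b : ℝ) ^ 2 < q := by
      rw [div_lt_iff₀ (by positivity)]
      nlinarith
    calc _ ≤ 2 * ((Fintype.card ι * (C * B)) * q / (b : ℝ) ^ 2) := by linarith
      _ = 2 * (Fintype.card ι * (C * B)) * q / (b : ℝ) ^ 2 := by ring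
      _ < q := h6
  have heq : (lift ω A h).comp (LinearMap.mulLeft ℤ h') =
      (lift ω A h').comp (LinearMap.mulLeft ℤ h) := ω.ext fun i => by
    simp only [LinearMap.comp_apply, LinearMap.mulLeft_apply]
    rw [← sub_eq_zero]
    apply Int.eq_zero_of_abs_lt_dvd (m := q)
    · rw [← ZMod.intCast_zmod_eq_zero_iff_dvd] 
      push_cast
      rw [lift_cast, lift_cast, sub_eq_zero]
      congr 1
      ring
    · have h1 := key h h' hh' hA i
      have h2 := key h' h hh hA' i
      have h3 : |(lift ω A h (h' * ω i) : ℝ) - lift ω A h' (h * ω i)| < q :=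
        lt_of_le_of_lt (abs_sub _ _) (by linarith)
      exact_mod_cast h3
  intro m
  exact LinearMap.congr_fun heq m

theorem lift_eq_of_mul (ω : Basis ι ℤ R) [IsDomain R] {h : R} (hh : h ≠ 0) {f g : R →ₗ[ℤ] ℤ}
    (hfg : ∀ m, f (h * m) = g (h * m)) : f = g := by
  obtain ⟨n, hn, t, ht⟩ := exists_int_dvd ω hh
  ext m
  have := hfg (t * m)
  rw [← mul_assoc, ← ht, ← zsmul_eq_mul, map_zsmul, map_zsmul, zsmul_eq_mul, zsmul_eq_mul] at this
  simpa [hn] using this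

/-- If many elements of a box are near for `A`, one of them is very near. -/
theorem exists_near [IsDomain R] : ∃ C : ℕ, 3 ^ Fintype.card ι ≤ C ∧
    ∀ (q P k : ℕ) [NeZero q] (A : R →ₗ[ℤ] ZMod q), 0 < P → 0 < k →
      C * k ^ Fintype.card ι ≤ (nearSet ω P A).card →
      ∃ h : R, h ≠ 0 ∧ (∀ i, k * |ω.repr h i| ≤ P) ∧
        ∀ i, k * P * |(A (h * ω i)).valMinAbs| ≤ q := by
  classical
  obtain ⟨C, hC, hcomm⟩ := lift_mul_comm ω
  set b := 2 * C + 1 with hb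
  have hb0 : (0 : ℤ) < b := by positivity
  set d := Fintype.card ι with hd
  refine ⟨(2 * b + 1) ^ d * (2 * b + 1) ^ d + 1, ?_, fun q P k _ A hP hk hcard => ?_⟩
  · have : 3 ^ d ≤ (2 * b + 1) ^ d := Nat.pow_le_pow_left (by omega) d
    nlinarith [Nat.one_le_pow d (2 * b + 1) (by omega)]
  have hq : 0 < q := Nat.pos_of_ne_zero (NeZero.ne q)
  have hqz : (0 : ℤ) < q := by exact_mod_cast hq
  have hPz : (0 : ℤ) < P := by exact_mod_cast hP
  let cell : R → (ι → ℤ) × (ι → ℤ) := fun h =>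
    (fun i => b * ω.repr h i / P, fun i => b * P * (A (h * ω i)).valMinAbs / q)
  let T : Finset ((ι → ℤ) × (ι → ℤ)) :=
    (Fintype.piFinset fun _ => Finset.Icc (-(b : ℤ)) b) ×ˢ
      (Fintype.piFinset fun _ => Finset.Icc (-(b : ℤ)) b)
  have hT : T.card = (2 * b + 1) ^ d * (2 * b + 1) ^ d := by
    have : (Finset.Icc (-(b : ℤ)) b).card = 2 * b + 1 := by rw [Int.card_Icc]; omega
    rw [Finset.card_product, Fintype.card_piFinset, Finset.prod_const, this, Finset.card_univ]
  have hdiv : ∀ (x y : ℤ), 0 < y → |x| ≤ y → b * x / y ∈ Finset.Icc (-(b : ℤ)) b := by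
    intro x y hy hx
    rw [abs_le] at hx
    rw [Finset.mem_Icc, Int.le_ediv_iff_mul_le hy]
    refine ⟨by nlinarith, ?_⟩
    apply Int.ediv_le_of_le_mul hy
    nlinarith
  obtain ⟨c, -, hc⟩ := Finset.exists_lt_card_fiber_of_mul_lt_card_of_maps_to
    (s := nearSet ω P A) (t := T) (f := cell) (n := k ^ d) (by
      intro h hh
      rw [nearSet, Finset.mem_filter, mem_box] at hh
      refine Finset.mem_product.2 ⟨Fintype.mem_piFinset.2 fun i => hdiv _ _ hPz (hh.1 i),
        Fintype.mem_piFinset.2 fun i => ?_⟩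
      have := hdiv (P * (A (h * ω i)).valMinAbs) q hqz (by
        rw [abs_mul, Nat.abs_cast]; exact hh.2 i)
      rwa [← mul_assoc] at this) (by
      rw [hT]
      have : 0 < k ^ d := by positivity
      nlinarith)
  set F := (nearSet ω P A).filter fun h => cell h = c with hF
  have hk1 : 1 ≤ k ^ d := Nat.one_le_pow _ _ hk
  obtain ⟨g, hg, g', hg', hgg⟩ := Finset.one_lt_card.1 (lt_of_le_of_lt hk1 hc)
  have hFdiff : ∀ h₁ ∈ F, ∀ h₂ ∈ F, (∀ i, b * |ω.repr (h₁ - h₂) i| ≤ P) ∧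
      ∀ i, b * P * |(A ((h₁ - h₂) * ω i)).valMinAbs| ≤ q := by
    intro h₁ h1 h₂ h2
    have e : cell h₁ = cell h₂ := (Finset.mem_filter.1 h1).2.trans (Finset.mem_filter.1 h2).2.symm
    constructor <;> intro i
    · have := abs_sub_lt_of_ediv_eq hPz (congrFun (congrArg Prod.fst e) i)
      rw [← mul_sub, abs_mul, Nat.abs_cast] at this
      simpa using this.le
    · have := abs_sub_lt_of_ediv_eq hqz (congrFun (congrArg Prod.snd e) i)
      rw [← mul_sub, abs_mul, abs_mul, Nat.abs_cast, Nat.abs_cast] at this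
      refine le_trans (mul_le_mul_of_nonneg_left (abs_valMinAbs_le_of_cast_eq ?_)
        (by positivity)) this.le
      push_cast
      rw [sub_mul, map_sub]
  have hcomm' := fun h₁ h1 h₂ h2 h₃ h3 => hcomm q P b A (h₁ - g) (h₂ - h₃) hP (by
    rw [hb]; nlinarith) (hFdiff h₁ h1 g hg).1 (hFdiff h₂ h2 h₃ h3).1 (hFdiff h₁ h1 g hg).2
    (hFdiff h₂ h2 h₃ h3).2
  set h₀ := g' - g with hh₀
  have h₀0 : h₀ ≠ 0 := sub_ne_zero.2 hgg.symm
  let I : Submodule ℤ R :=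
    { carrier := {h | ∃ l : R →ₗ[ℤ] ℤ, (∀ m, ((l m : ℤ) : ZMod q) = A (h * m)) ∧
        ∀ m, l (h₀ * m) = lift ω A h₀ (h * m)}
      add_mem' := by
        rintro x y ⟨l, hl, hl'⟩ ⟨l', hm, hm'⟩
        refine ⟨l + l', fun m => ?_, fun m => ?_⟩
        · rw [LinearMap.add_apply, add_mul, map_add, ← hl, ← hm]; push_cast; rfl
        · rw [LinearMap.add_apply, add_mul, map_add, hl', hm']
      zero_mem' := ⟨0, fun m => by simp, fun m => by simp⟩
      smul_mem' := by
        rintro c x ⟨l, hl, hl'⟩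
        refine ⟨c • l, fun m => ?_, fun m => ?_⟩
        · rw [LinearMap.smul_apply, smul_mul_assoc, map_smul, ← hl]; simp
        · rw [LinearMap.smul_apply, smul_mul_assoc, map_smul, hl'] }
  obtain ⟨h₁, h1, h₂, h2, hne, h, ⟨l, hl, hl'⟩, heq⟩ := exists_sub_eq_smul ω I
    (F.image fun h => h - g) (by
      intro x hx
      obtain ⟨y, hy, rfl⟩ := Finset.mem_image.1 hx
      exact ⟨lift ω A (y - g), fun m => lift_cast ω A _ _, hcomm' y hy g' hg' g hg⟩) k hk (by
      rwa [Finset.card_image_of_injective _ sub_left_injective])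
  obtain ⟨y₁, hy1, rfl⟩ := Finset.mem_image.1 h1
  obtain ⟨y₂, hy2, rfl⟩ := Finset.mem_image.1 h2
  simp only [sub_sub_sub_cancel_right] at heq
  have hkz : (0 : ℤ) < k := by exact_mod_cast hk
  have hbk : (2 : ℤ) ≤ b := by omega
  have hlift : (k : ℤ) • l = lift ω A (y₁ - g) - lift ω A (y₂ - g) := by
    refine lift_eq_of_mul ω h₀0 fun m => ?_
    rw [LinearMap.smul_apply, hl', LinearMap.sub_apply, hcomm' y₁ hy1 g' hg' g hg,
      hcomm' y₂ hy2 g' hg' g hg, ← map_sub, ← sub_mul, sub_sub_sub_cancel_right, heq,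
      smul_mul_assoc, map_smul]
  refine ⟨h, ?_, fun i => ?_, fun i => ?_⟩
  · rintro rfl
    rw [smul_zero, sub_eq_zero] at heq
    exact hne (by rw [heq])
  · have := (hFdiff y₁ hy1 y₂ hy2).1 i
    rw [heq, map_smul, Finsupp.smul_apply, smul_eq_mul, abs_mul, Nat.abs_cast] at this
    have h3 := abs_nonneg (ω.repr h i)
    nlinarith [mul_nonneg hkz.le h3]
  · have h3 := (hFdiff y₁ hy1 g hg).2 i
    have h4 := (hFdiff y₂ hy2 g hg).2 i
    have h5 := LinearMap.congr_fun hlift (ω i)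
    simp only [LinearMap.smul_apply, LinearMap.sub_apply, lift, ω.constr_basis, smul_eq_mul] at h5
    have h6 : |(A (h * ω i)).valMinAbs| ≤ |l (ω i)| := abs_valMinAbs_le_of_cast_eq (hl _)
    have h7 : k * |l (ω i)| ≤ |(A ((y₁ - g) * ω i)).valMinAbs| +
        |(A ((y₂ - g) * ω i)).valMinAbs| := by
      have := abs_sub (A ((y₁ - g) * ω i)).valMinAbs (A ((y₂ - g) * ω i)).valMinAbs
      rwa [← h5, abs_mul, Nat.abs_cast] at this
    have h8 : (b : ℤ) * (k * P * |(A (h * ω i)).valMinAbs|) ≤ 2 * q := by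
      calc (b : ℤ) * (k * P * |(A (h * ω i)).valMinAbs|) ≤ b * (k * P * |l (ω i)|) := by gcongr
        _ = b * P * (k * |l (ω i)|) := by ring
        _ ≤ b * P * (|(A ((y₁ - g) * ω i)).valMinAbs| + |(A ((y₂ - g) * ω i)).valMinAbs|) := by
          gcongr
        _ ≤ 2 * q := by linarith
    have h9 : (0 : ℤ) ≤ k * P * |(A (h * ω i)).valMinAbs| := by positivity
    nlinarith

end

open Module

theorem card_valMinAbs_le (q B : ℕ) [NeZero q] :
    (Finset.univ.filter fun t : ZMod q => |t.valMinAbs| ≤ B).card ≤ 2 * B + 1 := by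
  have h : (Finset.Icc (-(B : ℤ)) B).card = 2 * B + 1 := by rw [Int.card_Icc]; omega
  rw [← h]
  refine Finset.card_le_card_of_injOn ZMod.valMinAbs (fun t ht => ?_)
    ZMod.injective_valMinAbs.injOn
  have := (Finset.mem_filter.1 (Finset.mem_coe.1 ht)).2
  exact Finset.mem_coe.2 (Finset.mem_Icc.2 (abs_le.1 this))

section

variable {R ι : Type*} [CommRing R] [Fintype ι] [DecidableEq ι] (ω : Basis ι ℤ R)

theorem card_small_le (q : ℕ) [Fact q.Prime] (X : ℕ) (hX : 0 < X) {h : R} {m : ℤ}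
    (hm : h ∣ (m : R)) (hqm : ¬ (q : ℤ) ∣ m) :
    (Finset.univ.filter fun a : ι → ZMod q =>
      ∀ i, X * |(ω.constr ℤ a (h * ω i)).valMinAbs| ≤ q).card ≤
      (2 * (q / X) + 1) ^ Fintype.card ι := by
  obtain ⟨t, ht⟩ := hm
  have hcard : (Fintype.piFinset fun _ : ι =>
      Finset.univ.filter fun t : ZMod q => |t.valMinAbs| ≤ (q / X : ℕ)).card ≤
      (2 * (q / X) + 1) ^ Fintype.card ι := by
    rw [Fintype.card_piFinset, Finset.prod_const, Finset.card_univ]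
    exact Nat.pow_le_pow_left (card_valMinAbs_le q _) _
  refine le_trans (Finset.card_le_card_of_injOn (fun a i => ω.constr ℤ a (h * ω i))
    (fun a ha => ?_) ?_) hcard
  · refine Finset.mem_coe.2 (Fintype.mem_piFinset.2 fun i => Finset.mem_filter.2
      ⟨Finset.mem_univ _, ?_⟩)
    have := (Finset.mem_filter.1 (Finset.mem_coe.1 ha)).2 i
    push_cast
    rw [Int.le_ediv_iff_mul_le (by exact_mod_cast hX), mul_comm]
    exact this
  · intro a _ a' _ haa
    have h1 : (ω.constr ℤ a : R →ₗ[ℤ] ZMod q).comp (LinearMap.mulLeft ℤ h) =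
        (ω.constr ℤ a').comp (LinearMap.mulLeft ℤ h) := ω.ext fun i => congrFun haa i
    funext i
    have h2 := LinearMap.congr_fun h1 (t * ω i)
    simp only [LinearMap.comp_apply, LinearMap.mulLeft_apply, ← mul_assoc, ← ht, ← zsmul_eq_mul,
      map_zsmul, ω.constr_basis] at h2
    rw [zsmul_eq_mul, zsmul_eq_mul] at h2
    refine mul_left_cancel₀ ?_ h2
    rwa [Ne, ZMod.intCast_zmod_eq_zero_iff_dvd]

theorem card_exists_near_le (q P k : ℕ) [Fact q.Prime] (hq : P ^ 2 ≤ q) (hk : 0 < k) (hkP : k ≤ P)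
    (hdvd : ∀ h ∈ box ω P, h ≠ 0 → ∃ m : ℤ, h ∣ (m : R) ∧ ¬ (q : ℤ) ∣ m)
    (S : Finset (ι → ZMod q))
    (hS : ∀ a ∈ S, ∃ h : R, h ≠ 0 ∧ (∀ i, k * |ω.repr h i| ≤ P) ∧
      ∀ i, k * P * |(ω.constr ℤ a (h * ω i)).valMinAbs| ≤ q) :
    S.card * (k ^ 2) ^ Fintype.card ι ≤ (9 * q) ^ Fintype.card ι := by
  classical
  set d := Fintype.card ι
  have hP : 0 < P := by omega
  have hkz : (0 : ℤ) < k := by exact_mod_cast hk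
  have h1 : S ⊆ ((box ω (P / k)).filter (· ≠ 0)).biUnion fun h =>
      Finset.univ.filter fun a : ι → ZMod q =>
        ∀ i, (k * P : ℕ) * |(ω.constr ℤ a (h * ω i)).valMinAbs| ≤ q := by
    intro a ha
    obtain ⟨h, h0, h2, h3⟩ := hS a ha
    refine Finset.mem_biUnion.2 ⟨h, Finset.mem_filter.2 ⟨(mem_box ω).2 fun i => ?_, h0⟩,
      Finset.mem_filter.2 ⟨Finset.mem_univ _, fun i => by push_cast; exact h3 i⟩⟩
    push_cast
    rw [Int.le_ediv_iff_mul_le hkz, mul_comm]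
    exact h2 i
  have h2 : S.card ≤ (2 * (P / k) + 1) ^ d * (2 * (q / (k * P)) + 1) ^ d := by
    refine (Finset.card_le_card h1).trans (Finset.card_biUnion_le.trans ?_)
    refine (Finset.sum_le_card_nsmul _ _ ((2 * (q / (k * P)) + 1) ^ d) fun h hh => ?_).trans ?_
    · rw [Finset.mem_filter] at hh
      obtain ⟨m, hm, hqm⟩ := hdvd h ((mem_box ω).2 fun i => ((mem_box ω).1 hh.1 i).trans
        (by exact_mod_cast Nat.div_le_self _ _)) hh.2
      exact card_small_le ω q (k * P) (by positivity) hm hqm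
    · rw [smul_eq_mul]
      refine Nat.mul_le_mul_right _ ((Finset.card_filter_le _ _).trans ?_)
      rw [card_box]
  have h3 : (2 * (P / k) + 1) * k ≤ 3 * P := by
    have := Nat.div_mul_le_self P k
    nlinarith
  have h4 : (2 * (q / (k * P)) + 1) * (k * P) ≤ 3 * q := by
    have := Nat.div_mul_le_self q (k * P)
    nlinarith
  have h5 : (2 * (P / k) + 1) * (2 * (q / (k * P)) + 1) * k ^ 2 ≤ 9 * q := by
    refine Nat.le_of_mul_le_mul_right ?_ hP
    calc (2 * (P / k) + 1) * (2 * (q / (k * P)) + 1) * k ^ 2 * P =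
        ((2 * (P / k) + 1) * k) * ((2 * (q / (k * P)) + 1) * (k * P)) := by ring
      _ ≤ (3 * P) * (3 * q) := Nat.mul_le_mul h3 h4
      _ = 9 * q * P := by ring
  calc S.card * (k ^ 2) ^ d ≤ (2 * (P / k) + 1) ^ d * (2 * (q / (k * P)) + 1) ^ d * (k ^ 2) ^ d :=
        Nat.mul_le_mul_right _ h2
    _ = ((2 * (P / k) + 1) * (2 * (q / (k * P)) + 1) * k ^ 2) ^ d := by rw [mul_pow, mul_pow]
    _ ≤ _ := Nat.pow_le_pow_left h5 d

end

open Module Matrix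

theorem norm_stdAddChar_intCast_sub_one (q : ℕ) [NeZero q] (n : ℤ) :
    ‖ZMod.stdAddChar ((n : ZMod q)) - 1‖ = ‖2 * Real.sin (Real.pi * n / q)‖ := by
  rw [ZMod.stdAddChar_coe]
  have := Complex.norm_exp_I_mul_ofReal_sub_one (2 * Real.pi * n / q)
  rw [← show 2 * Real.pi * n / q / 2 = Real.pi * n / q by ring, ← this]
  congr 3
  push_cast
  ring

theorem norm_stdAddChar_sub_one_le (q : ℕ) [NeZero q] (n : ℤ) :
    ‖ZMod.stdAddChar ((n : ZMod q)) - 1‖ ≤ 2 * Real.pi * |(n : ℝ)| / q := by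
  rw [norm_stdAddChar_intCast_sub_one, Real.norm_eq_abs, abs_mul, abs_two]
  have h1 : |Real.sin (Real.pi * n / q)| ≤ |Real.pi * n / q| := Real.abs_sin_le_abs
  rw [abs_div, abs_mul, abs_of_pos Real.pi_pos, Nat.abs_cast] at h1
  calc _ ≤ 2 * (Real.pi * |(n : ℝ)| / q) := by gcongr
    _ = _ := by ring

theorem le_norm_stdAddChar_sub_one (q : ℕ) [NeZero q] (t : ZMod q) :
    4 * |(t.valMinAbs : ℝ)| / q ≤ ‖ZMod.stdAddChar t - 1‖ := by
  have hq : (0 : ℝ) < q := by exact_mod_cast Nat.pos_of_ne_zero (NeZero.ne q)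
  have h := norm_stdAddChar_intCast_sub_one q t.valMinAbs
  rw [ZMod.coe_valMinAbs] at h
  rw [h, Real.norm_eq_abs, abs_mul, abs_two]
  have h2 : 2 * |(t.valMinAbs : ℝ)| ≤ q := by
    have h3 := ZMod.natAbs_valMinAbs_le t
    have h4 : 2 * |t.valMinAbs| ≤ q := by rw [Int.abs_eq_natAbs]; omega
    exact_mod_cast h4
  have h1 := Real.mul_abs_le_abs_sin (x := Real.pi * t.valMinAbs / q) (by
    rw [abs_div, abs_mul, abs_of_pos Real.pi_pos, Nat.abs_cast, div_le_div_iff₀ hq two_pos]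
    nlinarith [Real.pi_pos])
  rw [abs_div, abs_mul, abs_of_pos Real.pi_pos, Nat.abs_cast] at h1
  calc 4 * |(t.valMinAbs : ℝ)| / q =
        2 * (2 / Real.pi * (Real.pi * |(t.valMinAbs : ℝ)| / q)) := by
        have := Real.pi_pos.ne'
        field_simp
        ring
    _ ≤ _ := by gcongr

/-- The geometric sum over a symmetric interval. -/
noncomputable def geomSum {q : ℕ} [NeZero q] (X : ℕ) (t : ZMod q) : ℂ :=
  ∑ s ∈ Finset.Icc (-(X : ℤ)) X, ZMod.stdAddChar ((s : ZMod q) * t)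

theorem norm_geomSum_le {q : ℕ} [NeZero q] (X : ℕ) (t : ZMod q) :
    ‖geomSum X t‖ ≤ 2 * X + 1 := by
  refine (norm_sum_le _ _).trans ?_
  simp only [AddChar.norm_apply, Finset.sum_const, Int.card_Icc, nsmul_eq_mul, mul_one]
  have : ((X : ℤ) + 1 - -(X : ℤ)).toNat = 2 * X + 1 := by omega
  rw [this]
  push_cast
  exact le_rfl

theorem norm_geomSum_mul_le {q : ℕ} [NeZero q] (X : ℕ) (t : ZMod q) :
    ‖geomSum X t‖ * ‖ZMod.stdAddChar t - 1‖ ≤ 2 := by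
  have key : ∀ n : ℕ, ∀ a : ℤ, (∑ s ∈ Finset.Ico a (a + n), ZMod.stdAddChar ((s : ZMod q) * t)) *
      (ZMod.stdAddChar t - 1) = ZMod.stdAddChar (((a + n : ℤ) : ZMod q) * t) -
        ZMod.stdAddChar ((a : ZMod q) * t) := by
    intro n a
    induction n with
    | zero => simp
    | succ n ih =>
      have h1 : Finset.Ico a (a + (n + 1 : ℕ)) = insert (a + n) (Finset.Ico a (a + n)) := by
        ext x
        simp only [Finset.mem_Ico, Finset.mem_insert]
        push_cast
        omega
      rw [h1, Finset.sum_insert (by simp), add_mul, ih]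
      push_cast
      have h2 : ZMod.stdAddChar (((a : ZMod q) + ((n : ZMod q) + 1)) * t) =
          ZMod.stdAddChar (((a : ZMod q) + (n : ZMod q)) * t) * ZMod.stdAddChar t := by
        rw [← AddChar.map_add_eq_mul]
        congr 1
        ring
      rw [h2]
      ring
  have h := key (2 * X + 1) (-(X : ℤ))
  have h1 : Finset.Ico (-(X : ℤ)) (-(X : ℤ) + (2 * X + 1 : ℕ)) = Finset.Icc (-(X : ℤ)) X := by
    ext x
    simp only [Finset.mem_Ico, Finset.mem_Icc]
    push_cast
    omega
  rw [h1] at h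
  rw [← norm_mul, geomSum, h]
  refine (norm_sub_le _ _).trans ?_
  rw [AddChar.norm_apply, AddChar.norm_apply]
  norm_num

theorem norm_geomSum_sq_le {q P : ℕ} [NeZero q] (hP : 0 < P) (t : ZMod q) :
    ‖geomSum (2 * P) t‖ ^ 2 ≤ 50 * P ^ 2 / (1 + ((t.valMinAbs * P / q : ℤ) : ℝ) ^ 2) := by
  have hq : (0 : ℤ) < q := by exact_mod_cast Nat.pos_of_ne_zero (NeZero.ne q)
  have hqr : (0 : ℝ) < q := by exact_mod_cast hq
  have hPr : (1 : ℝ) ≤ P := by exact_mod_cast hP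
  set v := t.valMinAbs * P / q with hv
  have hv1 := Int.mul_ediv_add_emod (t.valMinAbs * P) q
  have hv2 := Int.emod_nonneg (t.valMinAbs * P) hq.ne'
  have hv3 := Int.emod_lt_of_pos (t.valMinAbs * P) hq
  rw [← hv] at hv1
  have h0 := norm_geomSum_le (2 * P) t
  have hpos : (0 : ℝ) < 1 + (v : ℝ) ^ 2 := by positivity
  rw [le_div_iff₀ hpos]
  push_cast at h0
  by_cases h : v = 0 ∨ v = -1
  · have h1 : (v : ℝ) ^ 2 ≤ 1 := by rcases h with h | h <;> rw [h] <;> norm_num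
    have h2 : ‖geomSum (2 * P) t‖ ^ 2 ≤ (5 * P) ^ 2 :=
      pow_le_pow_left₀ (norm_nonneg _) (by linarith) 2
    nlinarith [sq_nonneg ‖geomSum (2 * P) t‖]
  · have h1 : |v| * q ≤ 2 * (|t.valMinAbs| * P) := by
      have hPa : |t.valMinAbs| * (P : ℤ) = |t.valMinAbs * P| := by rw [abs_mul, Nat.abs_cast]
      rw [hPa]
      rcases lt_or_ge v 0 with h3 | h3
      · have h4 : v ≤ -2 := by omega
        rw [abs_of_neg h3]
        have : (q : ℤ) * v ≤ q * (-2) := by gcongr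
        rw [← abs_neg]
        refine le_trans ?_ (mul_le_mul_of_nonneg_left (le_abs_self _) two_pos.le)
        nlinarith
      · have h4 : 1 ≤ v := by omega
        rw [abs_of_nonneg h3]
        refine le_trans ?_ (mul_le_mul_of_nonneg_left (le_abs_self _) two_pos.le)
        nlinarith
    have h1r : |(v : ℝ)| * q ≤ 2 * (|(t.valMinAbs : ℝ)| * P) := by exact_mod_cast h1
    have hv0 : 1 ≤ |(v : ℝ)| := by
      have : 1 ≤ |v| := Int.one_le_abs (by tauto)
      exact_mod_cast this
    have h5 := norm_geomSum_mul_le (2 * P) t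
    have h6 := le_norm_stdAddChar_sub_one q t
    have h7 : ‖geomSum (2 * P) t‖ * |(v : ℝ)| ≤ P := by
      have h8 : ‖geomSum (2 * P) t‖ * (4 * |(t.valMinAbs : ℝ)| / q) ≤ 2 :=
        (mul_le_mul_of_nonneg_left h6 (norm_nonneg _)).trans h5
      have h9 : 2 * |(v : ℝ)| / P ≤ 4 * |(t.valMinAbs : ℝ)| / q := by
        rw [div_le_div_iff₀ (by linarith) hqr]
        linarith
      have h10 := (mul_le_mul_of_nonneg_left h9 (norm_nonneg (geomSum (2 * P) t))).trans h8
      rw [mul_div_assoc', div_le_iff₀ (by linarith)] at h10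
      linarith
    have h8 : ‖geomSum (2 * P) t‖ ^ 2 * (v : ℝ) ^ 2 ≤ P ^ 2 := by
      rw [← sq_abs (v : ℝ), ← mul_pow]
      exact pow_le_pow_left₀ (by positivity) h7 2
    have h9 : 1 ≤ (v : ℝ) ^ 2 := by
      rw [← sq_abs]; exact one_le_pow₀ hv0
    nlinarith [sq_nonneg ‖geomSum (2 * P) t‖, mul_le_mul_of_nonneg_left h9 (sq_nonneg ‖geomSum (2 * P) t‖)]

theorem exists_sum_one_div_one_add_sq_le :
    ∃ Z : ℝ, 0 < Z ∧ ∀ s : Finset ℤ, ∑ v ∈ s, 1 / (1 + (v : ℝ) ^ 2) ≤ Z := by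
  have hs : Summable fun v : ℤ => 1 / (v : ℝ) ^ 2 := Real.summable_one_div_int_pow.2 one_lt_two
  refine ⟨1 + ∑' v : ℤ, 1 / (v : ℝ) ^ 2, ?_, fun s => ?_⟩
  · have : 0 ≤ ∑' v : ℤ, 1 / (v : ℝ) ^ 2 := tsum_nonneg fun v => by positivity
    linarith
  have h1 : ∀ v : ℤ, 1 / (1 + (v : ℝ) ^ 2) ≤ (if v = 0 then 1 else 0) + 1 / (v : ℝ) ^ 2 := by
    intro v
    by_cases hv : v = 0
    · simp [hv]
    · have : (0 : ℝ) < (v : ℝ) ^ 2 := by positivity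
      rw [if_neg hv, zero_add]
      gcongr
      linarith
  refine (Finset.sum_le_sum fun v _ => h1 v).trans ?_
  rw [Finset.sum_add_distrib]
  refine add_le_add ?_ (hs.sum_le_tsum _ fun v _ => by positivity)
  rw [Finset.sum_ite_eq']
  split_ifs <;> norm_num

section

variable {R ι : Type*} [CommRing R] [Fintype ι] [DecidableEq ι] (ω : Basis ι ℤ R)

theorem addChar_sum {A M κ : Type*} [AddCommMonoid A] [CommMonoid M]
    (ψ : AddChar A M) (s : Finset κ) (f : κ → A) : ψ (∑ i ∈ s, f i) = ∏ i ∈ s, ψ (f i) :=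
  map_prod ψ.toMonoidHom (fun i => Multiplicative.ofAdd (f i)) s

theorem sum_box_stdAddChar {q : ℕ} [NeZero q] (A : R →ₗ[ℤ] ZMod q) (X : ℕ) (m : R) :
    ∑ s ∈ box ω X, ZMod.stdAddChar (A (s * m)) = ∏ i, geomSum X (A (m * ω i)) := by
  simp only [geomSum]
  rw [Finset.prod_univ_sum, box, Finset.sum_map]
  refine Finset.sum_congr rfl fun x _ => ?_
  have h1 : ω.equivFun.symm.toEquiv.toEmbedding x = ∑ i, x i • ω i := ω.equivFun_symm_apply x
  rw [h1, Finset.sum_mul, map_sum, addChar_sum]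
  refine Finset.prod_congr rfl fun i _ => ?_
  rw [smul_mul_assoc, map_smul, zsmul_eq_mul, mul_comm (ω i)]

theorem exists_sum_prod_geomSum_le (C₀ : ℕ) : ∃ C : ℝ, 0 < C ∧
    ∀ (q P : ℕ) [NeZero q] (A : R →ₗ[ℤ] ZMod q), 0 < P →
      ∑ m ∈ box ω (C₀ * P), ∏ i, ‖geomSum (2 * P) (A (m * ω i))‖ ^ 2 ≤
        C * (P ^ 2) ^ Fintype.card ι * (nearSet ω P A).card := by
  classical
  obtain ⟨Z, hZ, hZs⟩ := exists_sum_one_div_one_add_sq_le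
  set d := Fintype.card ι with hd
  refine ⟨(2 * C₀ + 1) ^ d * (50 * Z) ^ d, by positivity, fun q P _ A hP => ?_⟩
  have hq : (0 : ℤ) < q := by exact_mod_cast Nat.pos_of_ne_zero (NeZero.ne q)
  have hPz : (0 : ℤ) < P := by exact_mod_cast hP
  let cell : R → (ι → ℤ) × (ι → ℤ) := fun m =>
    (fun i => ω.repr m i / P, fun i => (A (m * ω i)).valMinAbs * P / q)
  let U : Finset (ι → ℤ) := Fintype.piFinset fun _ => Finset.Icc (-(C₀ : ℤ)) C₀
  let V : Finset (ι → ℤ) := Fintype.piFinset fun _ => Finset.Icc (-(P : ℤ)) P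
  let Φ : (ι → ℤ) × (ι → ℤ) → ℝ := fun c => ∏ i, 50 * (P : ℝ) ^ 2 / (1 + (c.2 i : ℝ) ^ 2)
  have hΦ : ∀ c, 0 ≤ Φ c := fun c => Finset.prod_nonneg fun i _ => by positivity
  have hmaps : ∀ m ∈ box ω (C₀ * P), cell m ∈ U ×ˢ V := by
    intro m hm
    rw [mem_box] at hm
    refine Finset.mem_product.2 ⟨Fintype.mem_piFinset.2 fun i => ?_,
      Fintype.mem_piFinset.2 fun i => ?_⟩
    · have := abs_le.1 (hm i)
      push_cast at this
      exact Finset.mem_Icc.2 ⟨(Int.le_ediv_iff_mul_le hPz).2 (by linarith),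
        Int.ediv_le_of_le_mul hPz (by linarith)⟩
    · have h3 := ZMod.natAbs_valMinAbs_le (A (m * ω i))
      have h4 : |(A (m * ω i)).valMinAbs| ≤ q := by rw [Int.abs_eq_natAbs]; omega
      rw [abs_le] at h4
      exact Finset.mem_Icc.2 ⟨(Int.le_ediv_iff_mul_le hq).2 (by nlinarith),
        Int.ediv_le_of_le_mul hq (by nlinarith)⟩
  have hfib : ∀ c, ((box ω (C₀ * P)).filter fun m => cell m = c).card ≤ (nearSet ω P A).card := by
    intro c
    rcases ((box ω (C₀ * P)).filter fun m => cell m = c).eq_empty_or_nonempty with h | ⟨m₀, hm₀⟩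
    · simp [h]
    · refine Finset.card_le_card_of_injOn (fun m => m - m₀) (fun m hm => ?_)
        sub_left_injective.injOn
      have e : cell m = cell m₀ := (Finset.mem_filter.1 (Finset.mem_coe.1 hm)).2.trans
        (Finset.mem_filter.1 hm₀).2.symm
      refine Finset.mem_coe.2 (Finset.mem_filter.2 ⟨(mem_box ω).2 fun i => ?_, fun i => ?_⟩)
      · have := abs_sub_lt_of_ediv_eq hPz (congrFun (congrArg Prod.fst e) i)
        simpa using this.le
      · have := abs_sub_lt_of_ediv_eq hq (congrFun (congrArg Prod.snd e) i)
        rw [← sub_mul, abs_mul, Nat.abs_cast, mul_comm] at this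
        refine le_trans (mul_le_mul_of_nonneg_left (abs_valMinAbs_le_of_cast_eq ?_)
          (by positivity)) this.le
        push_cast
        rw [sub_mul, map_sub]
  calc ∑ m ∈ box ω (C₀ * P), ∏ i, ‖geomSum (2 * P) (A (m * ω i))‖ ^ 2
      ≤ ∑ m ∈ box ω (C₀ * P), Φ (cell m) := Finset.sum_le_sum fun m _ =>
        Finset.prod_le_prod (fun i _ => by positivity) fun i _ => norm_geomSum_sq_le hP _
    _ = ∑ c ∈ U ×ˢ V, ∑ m ∈ (box ω (C₀ * P)).filter (fun m => cell m = c), Φ (cell m) :=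
        (Finset.sum_fiberwise_of_maps_to hmaps _).symm
    _ ≤ ∑ c ∈ U ×ˢ V, (nearSet ω P A).card * Φ c := by
        refine Finset.sum_le_sum fun c _ => ?_
        rw [Finset.sum_congr rfl fun m hm => by rw [(Finset.mem_filter.1 hm).2],
          Finset.sum_const, nsmul_eq_mul]
        exact mul_le_mul_of_nonneg_right (by exact_mod_cast hfib c) (hΦ c)
    _ = (2 * C₀ + 1) ^ d * (∏ i : ι, ∑ v ∈ Finset.Icc (-(P : ℤ)) P,
          50 * (P : ℝ) ^ 2 / (1 + (v : ℝ) ^ 2)) * (nearSet ω P A).card := by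
        rw [← Finset.mul_sum, Finset.sum_product, Finset.prod_univ_sum, mul_comm]
        have : U.card = (2 * C₀ + 1) ^ d := by
          have : (Finset.Icc (-(C₀ : ℤ)) C₀).card = 2 * C₀ + 1 := by rw [Int.card_Icc]; omega
          rw [Fintype.card_piFinset, Finset.prod_const, this, Finset.card_univ]
        congr 1
        simp only [Φ]
        rw [Finset.sum_const, this, nsmul_eq_mul]
        push_cast
        rfl
    _ ≤ (2 * C₀ + 1) ^ d * (50 * P ^ 2 * Z) ^ d * (nearSet ω P A).card := by
        gcongr
        rw [Finset.prod_const, Finset.card_univ]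
        refine pow_le_pow_left₀ (Finset.sum_nonneg fun v _ => by positivity) ?_ _
        have : ∀ v : ℤ, 50 * (P : ℝ) ^ 2 / (1 + (v : ℝ) ^ 2) =
            50 * (P : ℝ) ^ 2 * (1 / (1 + (v : ℝ) ^ 2)) := fun v => by ring
        simp only [this, ← Finset.mul_sum]
        exact mul_le_mul_of_nonneg_left (hZs _) (by positivity)
    _ = _ := by
        rw [show (50 * (P : ℝ) ^ 2 * Z) = 50 * Z * P ^ 2 by ring, mul_pow _ ((P : ℝ) ^ 2)]
        ring

end

open Module Matrix

section

variable {R ι κ : Type*} [CommRing R] [Fintype ι] [DecidableEq ι] (ω : Basis ι ℤ R)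
  [Fintype κ] [DecidableEq κ]

/-- The vectors all of whose entries lie in a box. -/
noncomputable def vbox (κ : Type*) [Fintype κ] [DecidableEq κ] (X : ℕ) : Finset (κ → R) :=
  Fintype.piFinset fun _ => box ω X

theorem mem_vbox {X : ℕ} {x : κ → R} : x ∈ vbox ω κ X ↔ ∀ j, x j ∈ box ω X :=
  Fintype.mem_piFinset

theorem card_vbox (X : ℕ) :
    (vbox ω κ X).card = ((2 * X + 1) ^ Fintype.card ι) ^ Fintype.card κ := by
  rw [vbox, Fintype.card_piFinset, Finset.prod_const, card_box, Finset.card_univ]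

theorem vbox_mono {X Y : ℕ} (h : X ≤ Y) : vbox ω κ X ⊆ vbox ω κ Y := fun x hx =>
  (mem_vbox ω).2 fun j => (mem_box ω).2 fun i =>
    ((mem_box ω).1 ((mem_vbox ω).1 hx j) i).trans (by exact_mod_cast h)

theorem add_mem_vbox {X : ℕ} {x y : κ → R} (hx : x ∈ vbox ω κ X) (hy : y ∈ vbox ω κ X) :
    x + y ∈ vbox ω κ (2 * X) := (mem_vbox ω).2 fun j => by
  rw [two_mul]
  exact add_mem_box ω ((mem_vbox ω).1 hx j) ((mem_vbox ω).1 hy j)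

theorem sub_mem_vbox {X : ℕ} {x y : κ → R} (hx : x ∈ vbox ω κ X) (hy : y ∈ vbox ω κ X) :
    x - y ∈ vbox ω κ (2 * X) := (mem_vbox ω).2 fun j => by
  rw [two_mul]
  exact sub_mem_box ω ((mem_vbox ω).1 hx j) ((mem_vbox ω).1 hy j)

/-- The exponential sum of `A (qf M (y + z) - N)` over `y` and `z` in a box. -/
noncomputable def expSum {q : ℕ} [NeZero q] (M : Matrix κ κ R) (N : R) (P : ℕ)
    (A : R →ₗ[ℤ] ZMod q) : ℂ :=
  ∑ y ∈ vbox ω κ P, ∑ z ∈ vbox ω κ P, ZMod.stdAddChar (A (qf M (y + z) - N))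

theorem sum_vbox_stdAddChar {q : ℕ} [NeZero q] (A : R →ₗ[ℤ] ZMod q) (X : ℕ) (M : Matrix κ κ R)
    (h : κ → R) :
    ∑ s ∈ vbox ω κ X, ZMod.stdAddChar (A (bl M s h)) =
      ∏ j, ∏ i, geomSum X (A (((M + Mᵀ) *ᵥ h) j * ω i)) := by
  simp only [← sum_box_stdAddChar]
  rw [Finset.prod_univ_sum, vbox]
  refine Finset.sum_congr rfl fun x _ => ?_
  rw [bl, dotProduct, map_sum, addChar_sum]

theorem norm_expSum_sq_le {q : ℕ} [NeZero q] (M : Matrix κ κ R) (N : R) (P : ℕ)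
    (A : R →ₗ[ℤ] ZMod q) :
    ‖expSum ω M N P A‖ ^ 2 ≤ (vbox ω κ P).card * ∑ h ∈ vbox ω κ (2 * P),
      ‖∑ s ∈ vbox ω κ (2 * P), ZMod.stdAddChar (A (bl M s h))‖ ^ 2 := by
  set e : R → ℂ := fun r => ZMod.stdAddChar (A r) with he
  have hadd : ∀ r s, e (r + s) = e r * e s := fun r s => by
    simp only [he, map_add, AddChar.map_add_eq_mul]
  have hnorm : ∀ r, ‖e r‖ = 1 := fun r => AddChar.norm_apply _ _
  have hneg : ∀ r, e (-r) = starRingEnd ℂ (e r) := fun r => by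
    simp only [he, map_neg, AddChar.map_neg_eq_conj]
  set V := vbox ω κ P
  set W := vbox ω κ (2 * P)
  set G : (κ → R) → ℂ := fun h => ∑ s ∈ W, e (bl M s h) with hG
  set T : (κ → R) → ℂ := fun y => ∑ z ∈ V, e (qf M z) * e (bl M y z) with hT
  have h1 : ‖expSum ω M N P A‖ ≤ ∑ y ∈ V, ‖T y‖ := by
    refine (norm_sum_le _ _).trans (Finset.sum_le_sum fun y _ => ?_)
    have : ∀ z, ZMod.stdAddChar (A (qf M (y + z) - N)) =
        e (qf M y - N) * (e (qf M z) * e (bl M y z)) := by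
      intro z
      rw [← hadd, ← hadd]
      simp only [he]
      congr 2
      rw [qf_add]
      ring
    rw [Finset.sum_congr rfl fun z _ => this z, ← Finset.mul_sum, norm_mul, hnorm, one_mul]
  have h2 : ‖expSum ω M N P A‖ ^ 2 ≤ V.card * ∑ y ∈ V, ‖T y‖ ^ 2 :=
    (pow_le_pow_left₀ (norm_nonneg _) h1 2).trans sq_sum_le_card_mul_sum_sq
  have h3 : (V.card : ℝ) * ∑ y ∈ V, ‖T y‖ ^ 2 ≤ ∑ t ∈ W, ∑ s ∈ W, ‖T (s - t)‖ ^ 2 := by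
    rw [← nsmul_eq_mul, ← Finset.sum_const]
    refine le_trans (Finset.sum_le_sum fun t ht => ?_)
      (Finset.sum_le_sum_of_subset_of_nonneg (vbox_mono ω (by omega : P ≤ 2 * P))
        fun t _ _ => Finset.sum_nonneg fun s _ => by positivity)
    have : ∑ y ∈ V, ‖T y‖ ^ 2 = ∑ s ∈ V.map (addRightEmbedding t), ‖T (s - t)‖ ^ 2 := by
      rw [Finset.sum_map]
      simp
    rw [this]
    refine Finset.sum_le_sum_of_subset_of_nonneg (fun s hs => ?_) fun s _ _ => by positivity
    obtain ⟨y, hy, rfl⟩ := Finset.mem_map.1 hs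
    exact add_mem_vbox ω hy ht
  have h4 : ((∑ t ∈ W, ∑ s ∈ W, ‖T (s - t)‖ ^ 2 : ℝ) : ℂ) =
      ∑ z ∈ V, ∑ z' ∈ V, e (qf M z) * starRingEnd ℂ (e (qf M z')) *
        (G (z - z') * starRingEnd ℂ (G (z - z'))) := by
    have : ∀ s t, ((‖T (s - t)‖ ^ 2 : ℝ) : ℂ) = ∑ z ∈ V, ∑ z' ∈ V,
        e (qf M z) * starRingEnd ℂ (e (qf M z')) *
          (e (bl M s (z - z')) * starRingEnd ℂ (e (bl M t (z - z')))) := by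
      intro s t
      rw [Complex.ofReal_pow, ← Complex.mul_conj', hT, map_sum, Finset.sum_mul_sum]
      refine Finset.sum_congr rfl fun z _ => Finset.sum_congr rfl fun z' _ => ?_
      rw [map_mul, ← hneg (bl M t _), ← hneg (bl M _ z'), mul_mul_mul_comm, ← hadd, ← hadd]
      congr 2
      rw [sub_eq_add_neg z, bl_add_right, ← neg_one_smul R z', bl_smul_right, bl_add_right,
        bl_smul_right, bl_sub_left, bl_sub_left]
      ring
    simp only [Complex.ofReal_sum, this, hG, map_sum, Finset.sum_mul_sum]
    rw [Finset.sum_congr rfl fun t _ => Finset.sum_comm]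
    rw [Finset.sum_comm]
    refine Finset.sum_congr rfl fun z _ => ?_
    rw [Finset.sum_congr rfl fun t _ => Finset.sum_comm]
    rw [Finset.sum_comm]
    refine Finset.sum_congr rfl fun z' _ => ?_
    rw [Finset.sum_comm]
    simp only [Finset.mul_sum]
  have h5 : ∑ t ∈ W, ∑ s ∈ W, ‖T (s - t)‖ ^ 2 ≤ ∑ z ∈ V, ∑ z' ∈ V, ‖G (z - z')‖ ^ 2 := by
    have h6 : 0 ≤ ∑ t ∈ W, ∑ s ∈ W, ‖T (s - t)‖ ^ 2 :=
      Finset.sum_nonneg fun t _ => Finset.sum_nonneg fun s _ => by positivity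
    rw [← abs_of_nonneg h6, ← Real.norm_eq_abs, ← Complex.norm_real, h4]
    refine (norm_sum_le _ _).trans (Finset.sum_le_sum fun z _ => (norm_sum_le _ _).trans
      (Finset.sum_le_sum fun z' _ => ?_))
    rw [norm_mul, norm_mul, norm_mul, RCLike.norm_conj, RCLike.norm_conj, hnorm, hnorm]
    simp [sq]
  have h6 : ∑ z ∈ V, ∑ z' ∈ V, ‖G (z - z')‖ ^ 2 ≤ V.card * ∑ h ∈ W, ‖G h‖ ^ 2 := by
    rw [← nsmul_eq_mul]
    rw [Finset.sum_comm]
    refine Finset.sum_le_card_nsmul _ _ _ fun z' hz' => ?_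
    have : ∑ z ∈ V, ‖G (z - z')‖ ^ 2 = ∑ h ∈ V.map (addRightEmbedding (-z')), ‖G h‖ ^ 2 := by
      rw [Finset.sum_map]
      simp [sub_eq_add_neg]
    rw [this]
    refine Finset.sum_le_sum_of_subset_of_nonneg (fun s hs => ?_) fun s _ _ => by positivity
    obtain ⟨y, hy, rfl⟩ := Finset.mem_map.1 hs
    simp only [addRightEmbedding_apply, ← sub_eq_add_neg]
    exact sub_mem_vbox ω hy hz'
  exact h2.trans (h3.trans (h5.trans h6))

theorem exists_mulVec_mem_vbox (B : Matrix κ κ R) : ∃ C : ℕ, ∀ (X : ℕ) (h : κ → R),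
    h ∈ vbox ω κ X → B *ᵥ h ∈ vbox ω κ (C * X) := by
  obtain ⟨C, hC, hmul⟩ := exists_mul_bound ω
  obtain ⟨b, hb⟩ : ∃ b : ℕ, ∀ j l i, |(ω.repr (B j l) i : ℝ)| ≤ b := by
    refine ⟨∑ j, ∑ l, ∑ i, (ω.repr (B j l) i).natAbs, fun j l i => ?_⟩
    have : (ω.repr (B j l) i).natAbs ≤ ∑ j, ∑ l, ∑ i, (ω.repr (B j l) i).natAbs :=
      (Finset.single_le_sum (f := fun i => (ω.repr (B j l) i).natAbs) (fun _ _ => Nat.zero_le _)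
        (Finset.mem_univ i)).trans
      ((Finset.single_le_sum (f := fun l => ∑ i, (ω.repr (B j l) i).natAbs)
        (fun _ _ => Nat.zero_le _) (Finset.mem_univ l)).trans
      (Finset.single_le_sum (f := fun j => ∑ l, ∑ i, (ω.repr (B j l) i).natAbs)
        (fun _ _ => Nat.zero_le _) (Finset.mem_univ j)))
    rw [← Int.cast_abs, ← Nat.cast_natAbs (α := ℝ)]
    exact_mod_cast this
  refine ⟨Fintype.card κ * (C * b), fun X h hh => (mem_vbox ω).2 fun j => (mem_box ω).2 fun i => ?_⟩
  have h1 : |(ω.repr ((B *ᵥ h) j) i : ℝ)| ≤ Fintype.card κ * (C * b * X) := by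
    simp only [mulVec, dotProduct, map_sum, Finsupp.finsetSum_apply, Int.cast_sum]
    refine (Finset.abs_sum_le_sum_abs _ _).trans ((Finset.sum_le_card_nsmul _ _ _
      fun l _ => ?_).trans_eq (by rw [Finset.card_univ, nsmul_eq_mul]))
    exact hmul _ _ b X (by positivity) (hb j l) (fun i => by
      exact_mod_cast (mem_box ω).1 ((mem_vbox ω).1 hh l) i) i
  have h2 : ((|ω.repr ((B *ᵥ h) j) i| : ℤ) : ℝ) ≤ ((Fintype.card κ * (C * b) * X : ℕ) : ℤ) := by
    push_cast
    linarith
  exact_mod_cast h2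

theorem exists_expSum_le [IsDomain R] (M : Matrix κ κ R) (hM : (M + Mᵀ).det ≠ 0) :
    ∃ C : ℝ, 0 < C ∧ ∀ (q P : ℕ) [NeZero q] (A : R →ₗ[ℤ] ZMod q) (N : R), 0 < P →
      ‖expSum ω M N P A‖ ≤ C * √(P ^ 3 : ℝ) ^ (Fintype.card ι * Fintype.card κ) *
        √((nearSet ω P A).card : ℝ) ^ Fintype.card κ := by
  obtain ⟨C₀, hC₀⟩ := exists_mulVec_mem_vbox ω (M + Mᵀ)
  obtain ⟨C, hC, hsum⟩ := exists_sum_prod_geomSum_le ω (C₀ * 2)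
  set d := Fintype.card ι with hd
  set n := Fintype.card κ with hn
  refine ⟨√((3 ^ d * C) ^ n), by positivity, fun q P _ A N hP => ?_⟩
  have hPr : (1 : ℝ) ≤ P := by exact_mod_cast hP
  have hinj : Function.Injective ((M + Mᵀ) *ᵥ · : (κ → R) → κ → R) := by
    intro x y hxy
    have : (M + Mᵀ) *ᵥ (x - y) = 0 := by rw [mulVec_sub]; exact sub_eq_zero.2 hxy
    exact sub_eq_zero.1 (Matrix.eq_zero_of_mulVec_eq_zero hM this)
  have h1 : ∑ h ∈ vbox ω κ (2 * P),
      ‖∑ s ∈ vbox ω κ (2 * P), ZMod.stdAddChar (A (bl M s h))‖ ^ 2 ≤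
      (C * (P ^ 2) ^ d * (nearSet ω P A).card) ^ n := by
    calc _ = ∑ m ∈ (vbox ω κ (2 * P)).map ⟨_, hinj⟩,
          ∏ j, ∏ i, ‖geomSum (2 * P) (A (m j * ω i))‖ ^ 2 := by
          rw [Finset.sum_map]
          refine Finset.sum_congr rfl fun h _ => ?_
          rw [sum_vbox_stdAddChar, norm_prod, ← Finset.prod_pow]
          simp only [norm_prod, Finset.prod_pow, Function.Embedding.coeFn_mk]
      _ ≤ ∑ m ∈ vbox ω κ (C₀ * 2 * P), ∏ j, ∏ i, ‖geomSum (2 * P) (A (m j * ω i))‖ ^ 2 := by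
          refine Finset.sum_le_sum_of_subset_of_nonneg (fun m hm => ?_)
            fun m _ _ => Finset.prod_nonneg fun j _ => Finset.prod_nonneg fun i _ => by positivity
          obtain ⟨h, hh, rfl⟩ := Finset.mem_map.1 hm
          rw [mul_assoc]
          exact hC₀ _ _ hh
      _ = (∑ m ∈ box ω (C₀ * 2 * P), ∏ i, ‖geomSum (2 * P) (A (m * ω i))‖ ^ 2) ^ n := by
          rw [hn, ← Finset.card_univ, ← Finset.prod_const, Finset.prod_univ_sum]
          rfl
      _ ≤ _ := pow_le_pow_left₀ (Finset.sum_nonneg fun m _ =>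
          Finset.prod_nonneg fun i _ => by positivity) (hsum q P A hP) _
  have h2 := norm_expSum_sq_le ω M N P A
  have h3 : ((vbox ω κ P).card : ℝ) ≤ ((3 * P) ^ d) ^ n := by
    rw [card_vbox]
    push_cast
    gcongr
    linarith
  have h4 : ‖expSum ω M N P A‖ ^ 2 ≤ ((3 ^ d * C) ^ n) * ((P ^ 3 : ℝ) ^ (d * n)) *
      ((nearSet ω P A).card : ℝ) ^ n := by
    calc _ ≤ ((3 * P : ℝ) ^ d) ^ n * (C * (P ^ 2) ^ d * (nearSet ω P A).card) ^ n :=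
          h2.trans (mul_le_mul h3 h1 (Finset.sum_nonneg fun _ _ => by positivity) (by positivity))
      _ = _ := by
        rw [pow_mul, ← mul_pow, ← mul_pow, ← mul_pow]
        congr 1
        rw [mul_pow, show (P : ℝ) ^ 3 = P * P ^ 2 by ring, mul_pow (P : ℝ)]
        ring
  refine abs_le_of_sq_le_sq' (h4.trans_eq ?_) (by positivity) |>.2
  have hsq : ∀ (x : ℝ) (k : ℕ), 0 ≤ x → (√x ^ k) ^ 2 = x ^ k := fun x k hx => by
    rw [← pow_mul, mul_comm, pow_mul, Real.sq_sqrt hx]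
  rw [mul_pow (√((3 ^ d * C) ^ n) * _), mul_pow (√((3 ^ d * C) ^ n)),
    Real.sq_sqrt (by positivity), hsq _ _ (by positivity), hsq _ _ (by positivity)]

end

open Module Matrix

section

variable {R ι κ : Type*} [CommRing R] [Fintype ι] [DecidableEq ι] (ω : Basis ι ℤ R)
  [Fintype κ] [DecidableEq κ]

theorem sum_constr_stdAddChar (q : ℕ) [NeZero q] (m : R) :
    ∑ a : ι → ZMod q, ZMod.stdAddChar (ω.constr ℤ a m) =
      if ∀ i, (ω.repr m i : ZMod q) = 0 then (q : ℂ) ^ Fintype.card ι else 0 := by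
  have h1 : ∀ a : ι → ZMod q, ZMod.stdAddChar (ω.constr ℤ a m) =
      ∏ i, ZMod.stdAddChar (a i * (ω.repr m i : ZMod q)) := fun a => by
    rw [Basis.constr_apply_fintype, addChar_sum]
    refine Finset.prod_congr rfl fun i _ => ?_
    rw [Basis.equivFun_apply, zsmul_eq_mul, mul_comm]
  have h2 : ∀ b : ZMod q, ∑ x : ZMod q, ZMod.stdAddChar (x * b) = if b = 0 then (q : ℂ) else 0 :=
    fun b => by
    rw [AddChar.sum_mulShift b (ZMod.isPrimitive_stdAddChar q), ZMod.card]
    split_ifs <;> simp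
  simp only [h1]
  have h3 := Finset.prod_univ_sum (fun _ : ι => (Finset.univ : Finset (ZMod q)))
    fun i x => (ZMod.stdAddChar (x * (ω.repr m i : ZMod q)) : ℂ)
  rw [Fintype.piFinset_univ] at h3
  rw [← h3]
  simp only [h2]
  split_ifs with h
  · simp [h]
  · obtain ⟨i, hi⟩ := not_forall.1 h
    exact Finset.prod_eq_zero (Finset.mem_univ i) (if_neg hi)

theorem exists_prime_of_finset (ω : Basis ι ℤ R) [IsDomain R] (F : Finset R) (B : ℕ) :
    ∃ q : ℕ, q.Prime ∧ B ≤ q ∧ ∀ h ∈ F, h ≠ 0 →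
      (∃ m : ℤ, h ∣ (m : R) ∧ ¬ (q : ℤ) ∣ m) ∧ ∃ i, (ω.repr h i : ZMod q) ≠ 0 := by
  classical
  have hex : ∀ h : R, ∃ m : ℤ, h ≠ 0 → m ≠ 0 ∧ h ∣ (m : R) := fun h => by
    by_cases hh : h = 0
    · exact ⟨0, fun h' => absurd hh h'⟩
    · obtain ⟨m, hm⟩ := exists_int_dvd ω hh
      exact ⟨m, fun _ => hm⟩
  choose m hm using hex
  obtain ⟨q, hq, hqp⟩ := Nat.exists_infinite_primes
    (B + 1 + ∑ h ∈ F, ((m h).natAbs + ∑ i, (ω.repr h i).natAbs))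
  have hlt : ∀ (h : R) (z : ℤ), h ∈ F → z ≠ 0 →
      z.natAbs ≤ (m h).natAbs + ∑ i, (ω.repr h i).natAbs → ¬ (q : ℤ) ∣ z := by
    intro h z hh hz hle hdvd
    have h1 := Nat.le_of_dvd (Int.natAbs_pos.2 hz) (Int.natCast_dvd.1 hdvd)
    have h2 := Finset.single_le_sum (f := fun h => (m h).natAbs + ∑ i, (ω.repr h i).natAbs)
      (fun _ _ => Nat.zero_le _) hh
    omega
  refine ⟨q, hqp, by omega, fun h hh h0 => ⟨⟨m h, (hm h h0).2, ?_⟩, ?_⟩⟩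
  · exact hlt h _ hh (hm h h0).1 (by omega)
  · obtain ⟨i, hi⟩ : ∃ i, ω.repr h i ≠ 0 := by
      by_contra! hc
      exact h0 (ω.repr.map_eq_zero_iff.1 (Finsupp.ext hc))
    refine ⟨i, fun hc => hlt h _ hh hi ?_ ((ZMod.intCast_zmod_eq_zero_iff_dvd _ _).1 hc)⟩
    have := Finset.single_le_sum (f := fun i => (ω.repr h i).natAbs)
      (fun _ _ => Nat.zero_le _) (Finset.mem_univ i)
    omega

theorem sqrt_pow_eq {x : ℝ} (hx : 0 ≤ x) (k : ℕ) : √(x ^ k) = √x ^ k := by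
  rw [Real.sqrt_eq_iff_mul_self_eq (by positivity) (by positivity), ← mul_pow,
    Real.mul_self_sqrt hx]

theorem sqrt_pow_le_dyadic {x C : ℝ} (hC : 0 ≤ C) (d n J : ℕ)
    (hx : x < C * (2 ^ J) ^ d) :
    √x ^ n ≤ √C ^ n * √2 ^ (d * n) *
      (1 + ∑ j ∈ Finset.range J, if C * (2 ^ j) ^ d ≤ x then (√2 ^ (d * n)) ^ j else 0) := by
  have h2 : 1 ≤ √(2 : ℝ) := Real.one_le_sqrt.2 (by norm_num)
  have hτ : 1 ≤ √(2 : ℝ) ^ (d * n) := one_le_pow₀ h2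
  have hs : ∀ k, √((2 ^ k) ^ d : ℝ) ^ n = (√2 ^ (d * n)) ^ k := fun k => by
    rw [sqrt_pow_eq (by positivity), sqrt_pow_eq (by norm_num), ← pow_mul, ← pow_mul, ← pow_mul]
    congr 1
    ring
  induction J with
  | zero =>
    simp only [pow_zero, one_pow, mul_one, Finset.range_zero, Finset.sum_empty, add_zero] at hx ⊢
    calc √x ^ n ≤ √C ^ n * 1 := by
          rw [mul_one]
          gcongr
      _ ≤ _ := by gcongr
  | succ J ih =>
    rw [Finset.sum_range_succ]
    by_cases h : C * (2 ^ J) ^ d ≤ x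
    · rw [if_pos h]
      have : 0 ≤ ∑ j ∈ Finset.range J, if C * (2 ^ j) ^ d ≤ x then (√2 ^ (d * n)) ^ j else 0 :=
        Finset.sum_nonneg fun j _ => by positivity
      calc √x ^ n ≤ √(C * (2 ^ (J + 1)) ^ d) ^ n := by gcongr
        _ = √C ^ n * √2 ^ (d * n) * (√2 ^ (d * n)) ^ J := by
          rw [Real.sqrt_mul hC, mul_pow, hs, pow_succ]
          ring
        _ ≤ _ := by
          gcongr
          linarith
    · rw [if_neg h, add_zero]
      exact ih (not_le.1 h)

/-- The sum of the exponential sums over all characters with few near elements. -/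
theorem exists_sum_expSum_le [IsDomain R] [Nonempty ι] (hκ : 5 ≤ Fintype.card κ)
    (M : Matrix κ κ R) (hM : (M + Mᵀ).det ≠ 0) {C₁ : ℕ}
    (hnear : ∀ (q P k : ℕ) [NeZero q] (A : R →ₗ[ℤ] ZMod q), 0 < P → 0 < k →
      C₁ * k ^ Fintype.card ι ≤ (nearSet ω P A).card →
      ∃ h : R, h ≠ 0 ∧ (∀ i, k * |ω.repr h i| ≤ P) ∧
        ∀ i, k * P * |(A (h * ω i)).valMinAbs| ≤ q) :
    ∃ C : ℝ, 0 < C ∧ ∀ (q P J : ℕ) [Fact q.Prime] (N : R), 0 < P → P ^ 2 ≤ q →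
      (∀ j < J, 2 ^ j ≤ P) →
      (∀ h ∈ box ω P, h ≠ 0 → ∃ m : ℤ, h ∣ (m : R) ∧ ¬ (q : ℤ) ∣ m) →
      ∑ a : ι → ZMod q with (nearSet ω P (ω.constr ℤ a)).card < C₁ * (2 ^ J) ^ Fintype.card ι,
        ‖expSum ω M N P (ω.constr ℤ a)‖ ≤ C * q ^ Fintype.card ι *
          √(P ^ 3 : ℝ) ^ (Fintype.card ι * Fintype.card κ) *
          √(2 ^ J : ℝ) ^ (Fintype.card ι * (Fintype.card κ - 4)) := by
  obtain ⟨C, hC, hS⟩ := exists_expSum_le ω M hM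
  set d := Fintype.card ι with hd
  set n := Fintype.card κ with hn
  have hd0 : d ≠ 0 := Fintype.card_ne_zero
  set τ : ℝ := √2 ^ (d * n) with hτ
  set ρ : ℝ := √2 ^ (d * (n - 4)) with hρ
  have h2 : 1 < √(2 : ℝ) := Real.lt_sqrt_of_sq_lt (by norm_num)
  have hρ1 : 1 < ρ := one_lt_pow₀ h2 (Nat.mul_ne_zero hd0 (by omega))
  have hτρ : τ = 4 ^ d * ρ := by
    have : d * n = 4 * d + d * (n - 4) := by
      obtain ⟨k, hk⟩ := Nat.exists_eq_add_of_le hκ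
      rw [hk, show 5 + k - 4 = 1 + k by omega]
      ring
    rw [hτ, hρ, this, pow_add, pow_mul, show √(2 : ℝ) ^ 4 = (√2 ^ 2) ^ 2 by ring,
      Real.sq_sqrt (by norm_num)]
    norm_num
  refine ⟨C * (√(C₁ : ℝ) ^ n + 1) * τ * (1 + 9 ^ d * (1 / (ρ - 1))), by
    have : 0 < ρ - 1 := by linarith
    positivity, fun q P J _ N hP hq hJ hdvd => ?_⟩
  set f : (ι → ZMod q) → ℝ := fun a => (nearSet ω P (ω.constr ℤ a)).card with hf
  have h1 : ∀ a : ι → ZMod q, f a < C₁ * (2 ^ J) ^ d → √(f a) ^ n ≤ √(C₁ : ℝ) ^ n * τ *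
      (1 + ∑ j ∈ Finset.range J, if C₁ * (2 ^ j) ^ d ≤ f a then τ ^ j else 0) := fun a ha =>
    sqrt_pow_le_dyadic (Nat.cast_nonneg _) d n J ha
  have h3 : ∀ j < J, ∑ a : ι → ZMod q, (if C₁ * (2 ^ j) ^ d ≤ f a then τ ^ j else 0) ≤
      (9 * q) ^ d * ρ ^ j := by
    intro j hj
    rw [← Finset.sum_filter, Finset.sum_const, nsmul_eq_mul]
    have := card_exists_near_le ω q P (2 ^ j) hq (by positivity) (hJ j hj) hdvd
      (Finset.univ.filter fun a => C₁ * (2 ^ j) ^ d ≤ f a) (fun a ha => by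
        have ha := (Finset.mem_filter.1 ha).2
        simp only [hf] at ha
        exact_mod_cast hnear q P (2 ^ j) _ hP (by positivity) (by exact_mod_cast ha))
    have h4 : ((Finset.univ.filter fun a => C₁ * (2 ^ j) ^ d ≤ f a).card : ℝ) * ((2 ^ j) ^ 2) ^ d ≤
        (9 * q) ^ d := by exact_mod_cast this
    rw [hτρ, mul_pow, ← mul_assoc]
    refine mul_le_mul_of_nonneg_right (le_trans (le_of_eq ?_) h4) (by positivity)
    congr 1
    rw [← pow_mul, ← pow_mul, ← pow_mul, show (4 : ℝ) = 2 ^ 2 by norm_num, ← pow_mul]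
    congr 1
    ring
  have hgeo : ∑ j ∈ Finset.range J, ρ ^ j ≤ 1 / (ρ - 1) * ρ ^ J := by
    rw [geom_sum_eq hρ1.ne', div_eq_mul_one_div, mul_comm]
    have : 0 < ρ - 1 := by linarith
    gcongr
    linarith
  have h5 : ∑ a : ι → ZMod q with (nearSet ω P (ω.constr ℤ a)).card < C₁ * (2 ^ J) ^ d,
      √(f a) ^ n ≤ √(C₁ : ℝ) ^ n * τ * (q ^ d + (9 * q) ^ d * (1 / (ρ - 1) * ρ ^ J)) := by
    calc _ ≤ ∑ a : ι → ZMod q with (nearSet ω P (ω.constr ℤ a)).card < C₁ * (2 ^ J) ^ d,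
          √(C₁ : ℝ) ^ n * τ *
          (1 + ∑ j ∈ Finset.range J, if C₁ * (2 ^ j) ^ d ≤ f a then τ ^ j else 0) :=
          Finset.sum_le_sum fun a ha => h1 a (by
            simp only [hf]
            exact_mod_cast (Finset.mem_filter.1 ha).2)
      _ ≤ ∑ a : ι → ZMod q, √(C₁ : ℝ) ^ n * τ *
          (1 + ∑ j ∈ Finset.range J, if C₁ * (2 ^ j) ^ d ≤ f a then τ ^ j else 0) :=
          Finset.sum_le_sum_of_subset_of_nonneg (Finset.filter_subset _ _) fun a _ _ =>
            mul_nonneg (by positivity) (add_nonneg zero_le_one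
              (Finset.sum_nonneg fun j _ => by positivity))
      _ = √(C₁ : ℝ) ^ n * τ * (q ^ d + ∑ j ∈ Finset.range J,
          ∑ a : ι → ZMod q, if C₁ * (2 ^ j) ^ d ≤ f a then τ ^ j else 0) := by
          rw [← Finset.mul_sum, Finset.sum_add_distrib, Finset.sum_comm]
          simp [hd]
      _ ≤ _ := by
          gcongr
          refine (Finset.sum_le_sum fun j hj => h3 j (Finset.mem_range.1 hj)).trans ?_
          rw [← Finset.mul_sum]
          gcongr
  have hρJ : √(2 ^ J : ℝ) ^ (d * (n - 4)) = ρ ^ J := by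
    rw [hρ, sqrt_pow_eq (by norm_num), ← pow_mul, ← pow_mul, mul_comm]
  rw [hρJ]
  have hρJ1 : 1 ≤ ρ ^ J := one_le_pow₀ hρ1.le
  calc _ ≤ ∑ a : ι → ZMod q with (nearSet ω P (ω.constr ℤ a)).card < C₁ * (2 ^ J) ^ d,
        C * √(P ^ 3 : ℝ) ^ (d * n) * √(f a) ^ n := Finset.sum_le_sum fun a _ => hS q P _ N hP
    _ ≤ C * √(P ^ 3 : ℝ) ^ (d * n) *
        (√(C₁ : ℝ) ^ n * τ * (q ^ d + (9 * q) ^ d * (1 / (ρ - 1) * ρ ^ J))) := by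
        rw [← Finset.mul_sum]
        gcongr
    _ ≤ C * √(P ^ 3 : ℝ) ^ (d * n) *
        ((√(C₁ : ℝ) ^ n + 1) * τ * (q ^ d * ρ ^ J + (9 * q) ^ d * (1 / (ρ - 1) * ρ ^ J))) := by
        have : 0 < ρ - 1 := by linarith
        gcongr
        · linarith
        · exact le_mul_of_one_le_right (by positivity) hρJ1
    _ = _ := by
        rw [mul_pow]
        ring

end

open Module Matrix

section

variable {R ι κ : Type*} [CommRing R] [Fintype ι] [DecidableEq ι] (ω : Basis ι ℤ R)
  [Fintype κ] [DecidableEq κ]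

theorem card_mul_le_sum_expSum {q : ℕ} [NeZero q] (M : Matrix κ κ R) (N D : R) (P K : ℕ)
    (hq : ∀ y ∈ vbox ω κ P, ∀ z ∈ vbox ω κ P, ∃ i, (ω.repr (qf M (y + z) - N) i : ZMod q) ≠ 0)
    (T : Finset ((κ → R) × (κ → R) × R))
    (hT : ∀ p ∈ T, p.1 ∈ vbox ω κ P ∧ p.2.1 ∈ vbox ω κ P ∧ p.2.2 ∈ box ω K ∧
      qf M (p.1 + p.2.1) = N + D * p.2.2) :
    T.card * (q : ℝ) ^ Fintype.card ι ≤ ∑ a : ι → ZMod q, ‖expSum ω M N P (ω.constr ℤ a)‖ *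
      ‖∑ j ∈ box ω K, (ZMod.stdAddChar (-ω.constr ℤ a (D * j)) - 1 : ℂ)‖ := by
  classical
  have h0 : ∑ a : ι → ZMod q, expSum ω M N P (ω.constr ℤ a) = 0 := by
    simp only [expSum]
    rw [Finset.sum_comm]
    refine Finset.sum_eq_zero fun y hy => ?_
    rw [Finset.sum_comm]
    refine Finset.sum_eq_zero fun z hz => ?_
    rw [sum_constr_stdAddChar, if_neg]
    push Not
    exact hq y hy z hz
  set U := vbox ω κ P ×ˢ vbox ω κ P ×ˢ box ω K with hU
  have h1 : ∑ a : ι → ZMod q, expSum ω M N P (ω.constr ℤ a) *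
      ∑ j ∈ box ω K, (ZMod.stdAddChar (-ω.constr ℤ a (D * j)) - 1 : ℂ) =
      ∑ p ∈ U, if ∀ i, (ω.repr (qf M (p.1 + p.2.1) - N - D * p.2.2) i : ZMod q) = 0
        then (q : ℂ) ^ Fintype.card ι else 0 := by
    simp only [← sum_constr_stdAddChar]
    rw [Finset.sum_comm]
    simp only [Finset.sum_sub_distrib, mul_sub, ← Finset.sum_mul, h0, zero_mul, sub_zero,
      Finset.sum_const]
    refine Finset.sum_congr rfl fun a _ => ?_
    rw [expSum, hU, Finset.sum_product, Finset.sum_mul]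
    refine Finset.sum_congr rfl fun y _ => ?_
    rw [Finset.sum_product, Finset.sum_mul]
    refine Finset.sum_congr rfl fun z _ => ?_
    rw [Finset.mul_sum]
    refine Finset.sum_congr rfl fun j _ => ?_
    rw [← AddChar.map_add_eq_mul, ← sub_eq_add_neg, ← map_sub]
  have h2 : (T.card * (q : ℝ) ^ Fintype.card ι) ≤ ‖∑ p ∈ U,
      if ∀ i, (ω.repr (qf M (p.1 + p.2.1) - N - D * p.2.2) i : ZMod q) = 0
        then (q : ℂ) ^ Fintype.card ι else 0‖ := by
    rw [← Finset.sum_filter, Finset.sum_const, nsmul_eq_mul, norm_mul, norm_pow, Complex.norm_natCast,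
      Complex.norm_natCast]
    gcongr
    intro p hp
    obtain ⟨h3, h4, h5, h6⟩ := hT p hp
    refine Finset.mem_filter.2 ⟨by simp [hU, h3, h4, h5], fun i => ?_⟩
    rw [h6]
    simp
  rw [← h1] at h2
  exact h2.trans ((norm_sum_le _ _).trans_eq (Finset.sum_congr rfl fun a _ => norm_mul _ _))

theorem exists_norm_stdAddChar_sub_one_le (ω : Basis ι ℤ R) (D : R) (H : ℕ)
    (hD : ∀ h ∈ box ω (2 * H), h ≠ 0 → h ∣ D) :
    ∃ C : ℝ, 0 < C ∧ ∀ (q P K : ℕ) [NeZero q] (A : R →ₗ[ℤ] ZMod q) (h : R), 0 < P → h ≠ 0 →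
      (∀ i, |ω.repr h i| ≤ 2 * H) → (∀ i, P ^ 2 * |(A (h * ω i)).valMinAbs| ≤ 2 * H * q) →
      ∀ j ∈ box ω K, ‖(ZMod.stdAddChar (-A (D * j)) - 1 : ℂ)‖ * P ^ 2 ≤ C * K := by
  classical
  obtain ⟨C, hC, hmul⟩ := exists_mul_bound ω
  have hex : ∀ h : R, ∃ t, h ∈ box ω (2 * H) → h ≠ 0 → D = h * t := fun h => by
    by_cases hh : h ∈ box ω (2 * H) ∧ h ≠ 0
    · obtain ⟨t, ht⟩ := hD h hh.1 hh.2
      exact ⟨t, fun _ _ => ht⟩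
    · exact ⟨0, fun h1 h2 => absurd ⟨h1, h2⟩ hh⟩
  choose t ht using hex
  set T : ℕ := ∑ h ∈ box ω (2 * H), ∑ i, (ω.repr (t h) i).natAbs with hT
  have htT : ∀ h ∈ box ω (2 * H), ∀ i, |(ω.repr (t h) i : ℝ)| ≤ T := by
    intro h hh i
    have h1 : (ω.repr (t h) i).natAbs ≤ T :=
      (Finset.single_le_sum (f := fun i => (ω.repr (t h) i).natAbs) (fun _ _ => Nat.zero_le _)
        (Finset.mem_univ i)).trans
      (Finset.single_le_sum (f := fun h => ∑ i, (ω.repr (t h) i).natAbs)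
        (fun _ _ => Nat.zero_le _) hh)
    rw [← Int.cast_abs, ← Nat.cast_natAbs (α := ℝ)]
    exact_mod_cast h1
  refine ⟨2 * Real.pi * (Fintype.card ι * (C * T * (2 * H))) + 1, by positivity,
    fun q P K _ A h hP h0 hh hA j hj => ?_⟩
  have hhb : h ∈ box ω (2 * H) := (mem_box ω).2 fun i => by exact_mod_cast hh i
  have hqr : (0 : ℝ) < q := by exact_mod_cast Nat.pos_of_ne_zero (NeZero.ne q)
  have h1 : -A (D * j) = ((-lift ω A h (t h * j) : ℤ) : ZMod q) := by
    rw [Int.cast_neg, lift_cast, ← mul_assoc, ← ht h hhb h0]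
  have h2 : |(lift ω A h (t h * j) : ℝ)| * P ^ 2 ≤ Fintype.card ι * (C * T * K * (2 * H * q)) := by
    rw [lift, Basis.constr_apply_fintype, Int.cast_sum]
    have : |∑ i, ((ω.equivFun (t h * j) i • (A (h * ω i)).valMinAbs : ℤ) : ℝ)| * P ^ 2 ≤
        (∑ i, |((ω.equivFun (t h * j) i • (A (h * ω i)).valMinAbs : ℤ) : ℝ)|) * P ^ 2 := by
      gcongr
      exact Finset.abs_sum_le_sum_abs _ _
    refine this.trans ?_
    rw [Finset.sum_mul]
    refine (Finset.sum_le_card_nsmul _ _ _ fun i _ => ?_).trans_eq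
      (by rw [Finset.card_univ, nsmul_eq_mul])
    have h3 : (P ^ 2 * |((A (h * ω i)).valMinAbs : ℝ)|) ≤ 2 * H * q := by exact_mod_cast hA i
    have h4 := hmul (t h) j T K (by positivity) (htT h hhb)
      (fun i => by exact_mod_cast (mem_box ω).1 hj i) i
    rw [Basis.equivFun_apply, smul_eq_mul, Int.cast_mul, abs_mul, mul_assoc,
      mul_comm _ ((P : ℝ) ^ 2)]
    exact mul_le_mul h4 h3 (by positivity) (by positivity)
  have h3 := norm_stdAddChar_sub_one_le (q := q) (-lift ω A h (t h * j))
  rw [h1]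
  push_cast at h3 ⊢
  rw [abs_neg] at h3
  calc _ ≤ 2 * Real.pi * |(lift ω A h (t h * j) : ℝ)| / q * P ^ 2 := by gcongr
    _ = 2 * Real.pi * (|(lift ω A h (t h * j) : ℝ)| * P ^ 2) / q := by ring
    _ ≤ 2 * Real.pi * (Fintype.card ι * (C * T * K * (2 * H * q))) / q := by gcongr
    _ = 2 * Real.pi * (Fintype.card ι * (C * T * (2 * H))) * K := by field_simp
    _ ≤ _ := by
      gcongr
      linarith

end

open Module Matrix

section

variable {R ι κ : Type*} [CommRing R] [Fintype ι] [DecidableEq ι] (ω : Basis ι ℤ R)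
  [Fintype κ] [DecidableEq κ]

theorem sqrt_pow_mul_eq (P : ℝ) (hP : 0 ≤ P) (d n : ℕ) (hn : 4 ≤ n) :
    √(P ^ 3) ^ (d * n) * √P ^ (d * (n - 4)) * P ^ (2 * d) = P ^ (2 * n * d) := by
  obtain ⟨k, rfl⟩ := Nat.exists_eq_add_of_le hn
  rw [sqrt_pow_eq hP]
  obtain ⟨s, hs, rfl⟩ : ∃ s, 0 ≤ s ∧ P = s ^ 2 := ⟨√P, Real.sqrt_nonneg _, (Real.sq_sqrt hP).symm⟩
  rw [Real.sqrt_sq hs, ← pow_mul, ← pow_mul, ← pow_mul, ← pow_add, ← pow_add]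
  congr 1
  rw [Nat.add_sub_cancel_left]
  ring

theorem card_nearSet_lt [Nonempty ι] {q : ℕ} [NeZero q] {P C : ℕ} (hC : 3 ^ Fintype.card ι ≤ C)
    (hP : 0 < P) (A : R →ₗ[ℤ] ZMod q) :
    (nearSet ω P A).card < C * (2 ^ (Nat.log 2 P + 1)) ^ Fintype.card ι := by
  have h1 : P < 2 ^ (Nat.log 2 P + 1) := Nat.lt_pow_succ_log_self (by norm_num) P
  calc (nearSet ω P A).card ≤ (2 * P + 1) ^ Fintype.card ι :=
        (Finset.card_filter_le _ _).trans_eq (card_box ω P)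
    _ ≤ (3 * P) ^ Fintype.card ι := by gcongr; omega
    _ < (3 * 2 ^ (Nat.log 2 P + 1)) ^ Fintype.card ι := by
        gcongr
    _ ≤ _ := by
        rw [mul_pow]
        gcongr

/-- If `N + D * j` has about as many representations as expected on average over `j` in a box, then
`N` is represented. -/
theorem exists_qf_eq [IsDomain R] [Nonempty ι] (hκ : 5 ≤ Fintype.card κ)
    (M : Matrix κ κ R) (hM : (M + Mᵀ).det ≠ 0) {c : ℝ} (hc : 0 < c) :
    ∃ D : ℕ, 0 < D ∧ ∃ δ : ℝ, 0 < δ ∧ ∃ P₁ : ℕ, ∀ P K : ℕ, P₁ ≤ P → (K : ℝ) ≤ δ * P ^ 2 →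
      ∀ (N : R) (T : Finset ((κ → R) × (κ → R) × R)),
      (∀ p ∈ T, p.1 ∈ vbox ω κ P ∧ p.2.1 ∈ vbox ω κ P ∧ p.2.2 ∈ box ω K ∧
        qf M (p.1 + p.2.1) = N + D * p.2.2) →
      c * (2 * K + 1) ^ Fintype.card ι * (P : ℝ) ^ (2 * Fintype.card κ * Fintype.card ι) ≤
        T.card * (P : ℝ) ^ (2 * Fintype.card ι) → ∃ x, qf M x = N := by
  classical
  obtain ⟨C₁, hC₁, hnear⟩ := exists_near ω
  obtain ⟨C, hC, hsum⟩ := exists_sum_expSum_le ω hκ M hM hnear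
  set d := Fintype.card ι with hd
  set n := Fintype.card κ with hn
  have hd0 : d ≠ 0 := Fintype.card_ne_zero
  have hm0 : d * (n - 4) ≠ 0 := Nat.mul_ne_zero hd0 (by omega)
  obtain ⟨H, hH⟩ := exists_nat_ge ((6 * C / c) ^ 2 + 1)
  have hH1 : (1 : ℝ) ≤ H := by nlinarith [sq_nonneg (6 * C / c)]
  have hH0 : 0 < H := by exact_mod_cast (zero_lt_one.trans_le hH1)
  have hHs : √(1 / H : ℝ) ^ (d * (n - 4)) ≤ c / (6 * C) := by
    have h1 : √(1 / H : ℝ) ≤ 1 := Real.sqrt_le_one.2 (by rw [div_le_one (by positivity)]; exact hH1)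
    refine (pow_le_of_le_one (Real.sqrt_nonneg _) h1 hm0).trans ?_
    rw [Real.sqrt_le_left (by positivity), div_le_iff₀ (by positivity)]
    have h2 : (c / (6 * C)) ^ 2 * (6 * C / c) ^ 2 = 1 := by field_simp
    calc (1 : ℝ) = (c / (6 * C)) ^ 2 * (6 * C / c) ^ 2 := h2.symm
      _ ≤ (c / (6 * C)) ^ 2 * H := by gcongr; linarith
  have hex : ∀ h : R, ∃ m : ℤ, h ≠ 0 → m ≠ 0 ∧ h ∣ (m : R) := fun h => by
    by_cases hh : h = 0
    · exact ⟨0, fun h' => absurd hh h'⟩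
    · obtain ⟨m, hm⟩ := exists_int_dvd ω hh
      exact ⟨m, fun _ => hm⟩
  choose m hm using hex
  set D : ℕ := ∏ h ∈ (box ω (2 * H)).filter (· ≠ 0), (m h).natAbs with hD
  have hD0 : 0 < D := Finset.prod_pos fun h hh =>
    Int.natAbs_pos.2 (hm h (Finset.mem_filter.1 hh).2).1
  have hDdvd : ∀ h ∈ box ω (2 * H), h ≠ 0 → h ∣ (D : R) := fun h hh h0 => by
    have h1 : m h ∣ (D : ℤ) := Int.natAbs_dvd.1 (Int.natCast_dvd_natCast.2
      (Finset.dvd_prod_of_mem (fun h => (m h).natAbs) (Finset.mem_filter.2 ⟨hh, h0⟩)))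
    have h2 : ((m h : ℤ) : R) ∣ ((D : ℤ) : R) := map_dvd (Int.castRingHom R) h1
    exact (hm h h0).2.trans (by simpa using h2)
  obtain ⟨C₂, hC₂, hmaj⟩ := exists_norm_stdAddChar_sub_one_le ω (D : R) H hDdvd
  set C' : ℝ := C * √2 ^ (d * (n - 4)) with hC'
  have hC'0 : 0 < C' := by positivity
  refine ⟨D, hD0, c / (3 * C' * C₂), by positivity, H, fun P K hP hK N T hT hle => ?_⟩
  by_contra! hno
  have hP0 : 0 < P := hH0.trans_le hP
  have hPr : (0 : ℝ) < P := by exact_mod_cast hP0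
  obtain ⟨q, hqp, hPq, hq⟩ := exists_prime_of_finset ω (box ω P ∪
    (vbox ω κ P ×ˢ vbox ω κ P).image fun p => qf M (p.1 + p.2) - N) (P ^ 2)
  have : Fact q.Prime := ⟨hqp⟩
  have hqr : (0 : ℝ) < q := by exact_mod_cast hqp.pos
  have hdvd : ∀ h ∈ box ω P, h ≠ 0 → ∃ m : ℤ, h ∣ (m : R) ∧ ¬ (q : ℤ) ∣ m := fun h hh h0 =>
    (hq h (Finset.mem_union_left _ hh) h0).1
  have hcard := card_mul_le_sum_expSum ω M N D P K (q := q) (fun y hy z hz =>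
    (hq _ (Finset.mem_union_right _ (Finset.mem_image.2
      ⟨(y, z), Finset.mem_product.2 ⟨hy, hz⟩, rfl⟩)) (sub_ne_zero.2 (hno _))).2) T hT
  set S : (ι → ZMod q) → ℝ := fun a => ‖expSum ω M N P (ω.constr ℤ a)‖ with hSdef
  have hall : (∑ a, S a) * P ^ (2 * d) ≤ C' * q ^ d * P ^ (2 * n * d) := by
    have h1 := hsum q P (Nat.log 2 P + 1) N hP0 hPq (fun j hj =>
      (Nat.pow_le_pow_right (by norm_num) (by omega)).trans (Nat.pow_log_le_self 2 hP0.ne')) hdvd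
    rw [Finset.filter_true_of_mem fun a _ => card_nearSet_lt ω hC₁ hP0 _] at h1
    have h2 : √(2 ^ (Nat.log 2 P + 1) : ℝ) ^ (d * (n - 4)) ≤
        √2 ^ (d * (n - 4)) * √P ^ (d * (n - 4)) := by
      rw [← mul_pow, ← Real.sqrt_mul (by norm_num)]
      gcongr
      rw [pow_succ, mul_comm]
      gcongr
      exact_mod_cast Nat.pow_log_le_self 2 hP0.ne'
    calc _ ≤ C * q ^ d * √(P ^ 3 : ℝ) ^ (d * n) *
          (√2 ^ (d * (n - 4)) * √P ^ (d * (n - 4))) * P ^ (2 * d) := by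
          gcongr
          exact h1.trans (by gcongr)
      _ = C' * q ^ d * (√(P ^ 3) ^ (d * n) * √P ^ (d * (n - 4)) * P ^ (2 * d)) := by
          rw [hC']
          ring
      _ = _ := by rw [sqrt_pow_mul_eq _ hPr.le _ _ (by omega)]
  set J := Nat.log 2 (P / H) with hJ
  have hPH : P / H ≠ 0 := (Nat.div_pos hP hH0).ne'
  have hJle : 2 ^ J ≤ P / H := Nat.pow_log_le_self 2 hPH
  have hJlt : P < 2 ^ J * (2 * H) := by
    have h1 : P / H < 2 ^ (J + 1) := Nat.lt_pow_succ_log_self (by norm_num) _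
    have h2 := (Nat.div_lt_iff_lt_mul hH0).1 h1
    rw [pow_succ] at h2
    linarith
  set B := (Finset.univ : Finset (ι → ZMod q)).filter fun a =>
    (nearSet ω P (ω.constr ℤ a)).card < C₁ * (2 ^ J) ^ d with hB
  have hminor : (∑ a ∈ B, S a) * P ^ (2 * d) ≤ c / 6 * q ^ d * P ^ (2 * n * d) := by
    have h1 := hsum q P J N hP0 hPq (fun j hj =>
      (Nat.pow_le_pow_right (by norm_num) hj.le).trans (hJle.trans (Nat.div_le_self _ _))) hdvd
    have h2 : √(2 ^ J : ℝ) ^ (d * (n - 4)) ≤ √P ^ (d * (n - 4)) * (c / (6 * C)) := by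
      refine le_trans ?_ (mul_le_mul_of_nonneg_left hHs (by positivity))
      rw [← mul_pow, ← Real.sqrt_mul hPr.le]
      gcongr
      rw [mul_one_div, le_div_iff₀ (by positivity)]
      exact_mod_cast (Nat.le_div_iff_mul_le hH0).1 hJle
    calc _ ≤ C * q ^ d * √(P ^ 3 : ℝ) ^ (d * n) *
          (√P ^ (d * (n - 4)) * (c / (6 * C))) * P ^ (2 * d) := by
          gcongr
          exact h1.trans (by gcongr)
      _ = c / 6 * q ^ d * (√(P ^ 3) ^ (d * n) * √P ^ (d * (n - 4)) * P ^ (2 * d)) := by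
          field_simp
      _ = _ := by rw [sqrt_pow_mul_eq _ hPr.le _ _ (by omega)]
  have hK1 : ((box ω K).card : ℝ) = (2 * K + 1) ^ d := by
    rw [card_box]
    push_cast
    rfl
  have hinner : ∀ a, S a * ‖∑ j ∈ box ω K, (ZMod.stdAddChar (-ω.constr ℤ a (D * j)) - 1 : ℂ)‖ ≤
      (2 * K + 1) ^ d * (2 * (if a ∈ B then S a else 0) + c / (3 * C') * S a) := by
    intro a
    have hS0 : 0 ≤ S a := norm_nonneg _
    rw [← hK1, mul_comm]
    by_cases ha : a ∈ B
    · rw [if_pos ha]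
      have h1 : ‖∑ j ∈ box ω K, (ZMod.stdAddChar (-ω.constr ℤ a (D * j)) - 1 : ℂ)‖ ≤
          (box ω K).card * 2 := by
        refine (norm_sum_le _ _).trans ((Finset.sum_le_card_nsmul _ _ 2 fun j _ => ?_).trans_eq
          (nsmul_eq_mul _ _))
        refine (norm_sub_le _ _).trans ?_
        rw [AddChar.norm_apply, norm_one]
        norm_num
      calc _ ≤ (box ω K).card * 2 * S a := by gcongr
        _ = (box ω K).card * (2 * S a + 0) := by ring
        _ ≤ _ := by
          gcongr
          positivity
    · rw [if_neg ha]
      have hge : C₁ * (2 ^ J) ^ d ≤ (nearSet ω P (ω.constr ℤ a)).card := by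
        simpa [hB] using ha
      obtain ⟨h, h0, hh, hA⟩ := hnear q P (2 ^ J) _ hP0 (by positivity) hge
      have hJz : (P : ℤ) < 2 ^ J * (2 * H) := by exact_mod_cast hJlt
      push_cast at hh hA
      have h2J : (0 : ℤ) < 2 ^ J := by positivity
      have h1 : ‖∑ j ∈ box ω K, (ZMod.stdAddChar (-ω.constr ℤ a (D * j)) - 1 : ℂ)‖ ≤
          (box ω K).card * (c / (3 * C')) := by
        refine (norm_sum_le _ _).trans ((Finset.sum_le_card_nsmul _ _ _ fun j hj => ?_).trans_eq
          (nsmul_eq_mul _ _))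
        have h2 := hmaj q P K (ω.constr ℤ a) h hP0 h0 (fun i => ?_) (fun i => ?_) j hj
        · have h3 : C₂ * K ≤ c / (3 * C') * P ^ 2 := by
            calc C₂ * K ≤ C₂ * (c / (3 * C' * C₂) * P ^ 2) := by gcongr
              _ = _ := by field_simp
          exact le_of_mul_le_mul_right (h2.trans h3) (by positivity)
        · exact le_of_mul_le_mul_left ((hh i).trans hJz.le) h2J
        · have h3 := hA i
          set v := |(ω.constr ℤ a (h * ω i)).valMinAbs|
          have hv : 0 ≤ v := abs_nonneg _
          calc (P : ℤ) ^ 2 * v = P * (P * v) := by ring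
            _ ≤ 2 ^ J * (2 * H) * (P * v) := by gcongr
            _ = 2 * H * (2 ^ J * P * v) := by ring
            _ ≤ 2 * H * q := by gcongr
      calc _ ≤ (box ω K).card * (c / (3 * C')) * S a := by gcongr
        _ = _ := by ring
  have htot : T.card * (q : ℝ) ^ d ≤
      (2 * K + 1) ^ d * (2 * ∑ a ∈ B, S a + c / (3 * C') * ∑ a, S a) := by
    refine hcard.trans ((Finset.sum_le_sum fun a _ => hinner a).trans_eq ?_)
    rw [← Finset.mul_sum, Finset.sum_add_distrib, ← Finset.mul_sum, ← Finset.mul_sum,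
      ← Finset.sum_filter]
    simp
  have hfin : c * ((2 * K + 1) ^ d * P ^ (2 * n * d) * q ^ d) ≤
      2 / 3 * c * ((2 * K + 1) ^ d * P ^ (2 * n * d) * q ^ d) := by
    calc _ = c * (2 * K + 1) ^ d * (P : ℝ) ^ (2 * n * d) * q ^ d := by ring
      _ ≤ T.card * (P : ℝ) ^ (2 * d) * q ^ d := by gcongr
      _ = T.card * (q : ℝ) ^ d * P ^ (2 * d) := by ring
      _ ≤ (2 * K + 1) ^ d * (2 * ∑ a ∈ B, S a + c / (3 * C') * ∑ a, S a) * P ^ (2 * d) := by gcongr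
      _ = (2 * K + 1) ^ d * (2 * ((∑ a ∈ B, S a) * P ^ (2 * d)) +
          c / (3 * C') * ((∑ a, S a) * P ^ (2 * d))) := by ring
      _ ≤ (2 * K + 1) ^ d * (2 * (c / 6 * q ^ d * P ^ (2 * n * d)) +
          c / (3 * C') * (C' * q ^ d * P ^ (2 * n * d))) := by gcongr
      _ = _ := by
        field_simp
        ring
  have hpos : 0 < c * ((2 * K + 1) ^ d * (P : ℝ) ^ (2 * n * d) * q ^ d) := by positivity
  linarith

end

open Module Matrix NumberField NumberField.InfinitePlace NumberField.mixedEmbedding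

section

variable {E κ : Type*} [NormedCommRing E] [Fintype κ]

theorem exists_norm_qf_le (M : Matrix κ κ E) : ∃ C : ℝ, 0 < C ∧ ∀ (x : κ → E) (X : ℝ),
    (∀ i, ‖x i‖ ≤ X) → ‖qf M x‖ ≤ C * X ^ 2 := by
  refine ⟨∑ i, ∑ j, ‖M i j‖ + 1, by positivity, fun x X hx => ?_⟩
  have h1 : ‖qf M x‖ ≤ (∑ i, ∑ j, ‖M i j‖) * X ^ 2 := by
    rw [qf_eq_sum, Finset.sum_mul]
    refine (norm_sum_le _ _).trans (Finset.sum_le_sum fun i _ => ?_)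
    rw [Finset.sum_mul]
    refine (norm_sum_le _ _).trans (Finset.sum_le_sum fun j _ => ?_)
    have h0 : 0 ≤ X := (norm_nonneg _).trans (hx i)
    calc _ ≤ ‖M i j‖ * ‖x i‖ * ‖x j‖ :=
          (norm_mul_le _ _).trans (mul_le_mul_of_nonneg_right (norm_mul_le _ _) (norm_nonneg _))
      _ ≤ ‖M i j‖ * X * X := by
          gcongr
          · exact hx i
          · exact hx j
      _ = _ := by ring
  nlinarith [sq_nonneg X]

theorem exists_norm_bl_le (M : Matrix κ κ E) (v : κ → E) : ∃ C : ℝ, 0 < C ∧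
    ∀ (x : κ → E) (X : ℝ), 0 ≤ X → (∀ i, ‖x i‖ ≤ X) → ‖bl M x v‖ ≤ C * X := by
  refine ⟨∑ i, ∑ j, ‖M i j + M j i‖ * ‖v j‖ + 1, by positivity, fun x X h0 hx => ?_⟩
  have h1 : ‖bl M x v‖ ≤ (∑ i, ∑ j, ‖M i j + M j i‖ * ‖v j‖) * X := by
    rw [bl_eq_sum, Finset.sum_mul]
    refine (norm_sum_le _ _).trans (Finset.sum_le_sum fun i _ => ?_)
    rw [Finset.sum_mul]
    refine (norm_sum_le _ _).trans (Finset.sum_le_sum fun j _ => ?_)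
    calc _ ≤ ‖M i j + M j i‖ * ‖x i‖ * ‖v j‖ :=
          (norm_mul_le _ _).trans (mul_le_mul_of_nonneg_right (norm_mul_le _ _) (norm_nonneg _))
      _ ≤ ‖M i j + M j i‖ * X * ‖v j‖ := by
          gcongr
          exact hx i
      _ = _ := by ring
  nlinarith

end

theorem exists_real_root {b u w X : ℝ} (hb : 0 < b) (hw0 : w ≤ 0) (hX : 0 ≤ X) (hu : |u| ≤ X)
    (hw : |w| ≤ X ^ 2) : ∃ s : ℝ, b * s ^ 2 + u * s + w = 0 ∧ |s| ≤ (1 + b) / b * X := by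
  have h0 : 0 ≤ u ^ 2 - 4 * b * w := by nlinarith [sq_nonneg u]
  refine ⟨(-u + √(u ^ 2 - 4 * b * w)) / (2 * b), ?_, ?_⟩
  · have h1 := Real.sq_sqrt h0
    set r := √(u ^ 2 - 4 * b * w)
    field_simp
    linear_combination h1
  · have h1 : √(u ^ 2 - 4 * b * w) ≤ (1 + 2 * b) * X := by
      rw [Real.sqrt_le_left (by positivity)]
      have : u ^ 2 ≤ X ^ 2 := sq_le_sq' (abs_le.1 hu).1 (abs_le.1 hu).2
      nlinarith [(abs_le.1 hw).1, mul_le_mul_of_nonneg_left (abs_le.1 hw).1 hb.le,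
        mul_nonneg (sq_nonneg b) (sq_nonneg X)]
    rw [abs_div, abs_of_pos (by positivity : 0 < 2 * b), div_le_iff₀ (by positivity)]
    have h2 : |-u + √(u ^ 2 - 4 * b * w)| ≤ |u| + √(u ^ 2 - 4 * b * w) := by
      refine (abs_add_le _ _).trans_eq ?_
      rw [abs_neg, abs_of_nonneg (Real.sqrt_nonneg _)]
    calc _ ≤ X + (1 + 2 * b) * X := by linarith
      _ = _ := by
        field_simp
        ring

theorem exists_complex_root {b u w : ℂ} {X : ℝ} (hb : b ≠ 0) (hX : 0 ≤ X) (hu : ‖u‖ ≤ X)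
    (hw : ‖w‖ ≤ X ^ 2) : ∃ s : ℂ, b * s ^ 2 + u * s + w = 0 ∧ ‖s‖ ≤ (1 + ‖b‖) / ‖b‖ * X := by
  obtain ⟨r, hr⟩ := IsAlgClosed.exists_pow_nat_eq (u ^ 2 - 4 * b * w) (by norm_num : 0 < 2)
  have hb' : 0 < ‖b‖ := norm_pos_iff.2 hb
  refine ⟨(-u + r) / (2 * b), ?_, ?_⟩
  · field_simp
    linear_combination hr
  · have h1 : ‖r‖ ≤ (1 + 2 * ‖b‖) * X := by
      refine le_of_sq_le_sq ?_ (by positivity)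
      rw [← norm_pow, hr]
      calc _ ≤ ‖u‖ ^ 2 + 4 * ‖b‖ * ‖w‖ := by
            refine (norm_sub_le _ _).trans_eq ?_
            simp
        _ ≤ X ^ 2 + 4 * ‖b‖ * X ^ 2 := by gcongr
        _ ≤ _ := by nlinarith [mul_nonneg (sq_nonneg ‖b‖) (sq_nonneg X)]
    rw [norm_div, norm_mul, Complex.norm_ofNat, div_le_iff₀ (by positivity)]
    calc _ ≤ ‖u‖ + ‖r‖ := (norm_add_le _ _).trans_eq (by rw [norm_neg])
      _ ≤ X + (1 + 2 * ‖b‖) * X := by linarith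
      _ = _ := by
        field_simp
        ring

variable {L : Type*} [Field L] [NumberField L]

open scoped Classical in
theorem exists_mixedSpace_root {b : mixedSpace L} (hb : ∀ w, 0 < b.1 w) (hb' : ∀ w, b.2 w ≠ 0) :
    ∃ C : ℝ, 0 < C ∧ ∀ (u w : mixedSpace L) (X : ℝ), 0 ≤ X → (∀ v, w.1 v ≤ 0) → ‖u‖ ≤ X →
      ‖w‖ ≤ X ^ 2 → ∃ s, b * s ^ 2 + u * s + w = 0 ∧ ‖s‖ ≤ C * X := by
  refine ⟨∑ v, (1 + b.1 v) / b.1 v + ∑ v, (1 + ‖b.2 v‖) / ‖b.2 v‖ + 1, ?_, ?_⟩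
  · have h1 : 0 ≤ ∑ v, (1 + b.1 v) / b.1 v := Finset.sum_nonneg fun v _ => by
      have := hb v
      positivity
    positivity
  · intro u w X hX hw0 hu hw
    have h1 : ∀ v, ∃ s : ℝ, b.1 v * s ^ 2 + u.1 v * s + w.1 v = 0 ∧
        |s| ≤ (1 + b.1 v) / b.1 v * X := fun v =>
      exists_real_root (hb v) (hw0 v) hX
        ((norm_le_pi_norm u.1 v).trans ((norm_fst_le u).trans hu))
        ((norm_le_pi_norm w.1 v).trans ((norm_fst_le w).trans hw))
    have h2 : ∀ v, ∃ s : ℂ, b.2 v * s ^ 2 + u.2 v * s + w.2 v = 0 ∧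
        ‖s‖ ≤ (1 + ‖b.2 v‖) / ‖b.2 v‖ * X := fun v =>
      exists_complex_root (hb' v) hX
        ((norm_le_pi_norm u.2 v).trans ((norm_snd_le u).trans hu))
        ((norm_le_pi_norm w.2 v).trans ((norm_snd_le w).trans hw))
    choose s hs hs' using h1
    choose t ht ht' using h2
    have h3 : ∀ v, 0 ≤ (1 + b.1 v) / b.1 v := fun v => by
      have := hb v
      positivity
    have h4 : ∀ v, 0 ≤ (1 + ‖b.2 v‖) / ‖b.2 v‖ := fun v => by positivity
    have h5 : 0 ≤ ∑ v, (1 + b.1 v) / b.1 v := Finset.sum_nonneg fun v _ => h3 v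
    have h6 : 0 ≤ ∑ v, (1 + ‖b.2 v‖) / ‖b.2 v‖ := Finset.sum_nonneg fun v _ => h4 v
    refine ⟨(s, t), Prod.ext (funext hs) (funext ht), ?_⟩
    have h7 : 0 ≤ (∑ v, (1 + b.1 v) / b.1 v + ∑ v, (1 + ‖b.2 v‖) / ‖b.2 v‖ + 1) * X := by
      positivity
    refine norm_prod_le_iff.2 ⟨(pi_norm_le_iff_of_nonneg h7).2 fun v => ?_,
      (pi_norm_le_iff_of_nonneg h7).2 fun v => ?_⟩
    · refine (hs' v).trans (mul_le_mul_of_nonneg_right ?_ hX)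
      have := Finset.single_le_sum (f := fun v => (1 + b.1 v) / b.1 v) (fun v _ => h3 v)
        (Finset.mem_univ v)
      linarith
    · refine (ht' v).trans (mul_le_mul_of_nonneg_right ?_ hX)
      have := Finset.single_le_sum (f := fun v => (1 + ‖b.2 v‖) / ‖b.2 v‖) (fun v _ => h4 v)
        (Finset.mem_univ v)
      linarith

theorem latticeBasis_repr_eq (x : 𝓞 L) (i) :
    (mixedEmbedding.latticeBasis L).repr (mixedEmbedding L x) i =
      ((RingOfIntegers.basis L).repr x i : ℝ) := by
  rw [mixedEmbedding.latticeBasis_repr_apply]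
  have := integralBasis_repr_apply L x i
  rw [this]
  simp

open scoped Classical in
theorem exists_norm_le_repr : ∃ C : ℝ, 1 ≤ C ∧
    (∀ (e : mixedSpace L) (X : ℝ), 0 ≤ X → (∀ i, |(mixedEmbedding.latticeBasis L).repr e i| ≤ X) →
      ‖e‖ ≤ C * X) ∧
    ∀ (e : mixedSpace L) i, |(mixedEmbedding.latticeBasis L).repr e i| ≤ C * ‖e‖ := by
  set f : mixedSpace L ≃L[ℝ] (Free.ChooseBasisIndex ℤ (𝓞 L) → ℝ) :=
    (mixedEmbedding.latticeBasis L).equivFun.toContinuousLinearEquiv with hf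
  refine ⟨max 1 (max
     ‖(f.symm : (Free.ChooseBasisIndex ℤ (𝓞 L) → ℝ) →L[ℝ] mixedSpace L)‖ ‖(f : mixedSpace L →L[ℝ] (Free.ChooseBasisIndex ℤ (𝓞 L) → ℝ))‖),
    le_max_left _ _, fun e X hX he => ?_, fun e i => ?_⟩
  · have h1 := (f.symm : (Free.ChooseBasisIndex ℤ (𝓞 L) → ℝ) →L[ℝ] mixedSpace L).le_opNorm (f e)
    have h2 : ‖f e‖ ≤ X := (pi_norm_le_iff_of_nonneg hX).2 he
    simp only [ContinuousLinearEquiv.coe_coe, ContinuousLinearEquiv.symm_apply_apply] at h1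
    refine h1.trans ?_
    gcongr
    exact (le_max_left _ _).trans (le_max_right _ _)
  · have h1 := (f : mixedSpace L →L[ℝ] (Free.ChooseBasisIndex ℤ (𝓞 L) → ℝ)).le_opNorm e
    refine (norm_le_pi_norm (f e) i).trans (h1.trans ?_)
    gcongr
    exact (le_max_right _ _).trans (le_max_right _ _)

open Module Matrix NumberField NumberField.InfinitePlace NumberField.mixedEmbedding

variable {L κ : Type*} [Field L] [NumberField L] [Fintype κ] [DecidableEq κ]

open scoped Classical in
theorem norm_mixedEmbedding_le {x : L} {C : ℝ} (h : ∀ w : InfinitePlace L, w x ≤ C) :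
    ‖mixedEmbedding L x‖ ≤ C := by
  have hC : 0 ≤ C := (apply_nonneg _ _).trans (h (Classical.arbitrary _))
  refine norm_prod_le_iff.2 ⟨(pi_norm_le_iff_of_nonneg hC).2 fun v => ?_,
    (pi_norm_le_iff_of_nonneg hC).2 fun v => ?_⟩
  · rw [mixedEmbedding_apply_isReal, norm_embedding_of_isReal]
    exact h v
  · rw [mixedEmbedding_apply_isComplex, norm_embedding_eq]
    exact h v

open scoped Classical in
/-- Over the reals, `qf M (x + y • v) = N` can be solved for `y`; integral approximations `y` to the
solution make `qf M (x + y • v) - N` small. -/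
theorem exists_approx_root (M : Matrix κ κ (𝓞 L)) (v : κ → 𝓞 L) (hv0 : qf M v ≠ 0)
    (hv : ∀ σ : L →+* ℝ, 0 < σ ((qf M v : 𝓞 L) : L)) :
    ∃ c₂ : ℝ, 0 < c₂ ∧ ∃ C : ℕ, 0 < C ∧ ∃ η : ℝ, 0 < η ∧ η ≤ 1 / 2 ∧
      ∀ c₁ : ℝ, 0 < c₁ → ∃ ρ : ℝ, 0 < ρ ∧ ∀ (P : ℕ) (N : 𝓞 L), 0 < P →
        (∀ σ : L →+* ℝ, c₁ * P ^ 2 ≤ σ N) → (∀ w : InfinitePlace L, w N ≤ c₂ * P ^ 2) →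
        ∀ x : κ → 𝓞 L, (∀ l i, |((RingOfIntegers.basis L).repr (x l) i : ℝ)| ≤ ρ * P) →
        ∃ s : Free.ChooseBasisIndex ℤ (𝓞 L) → ℝ, (∀ i, |s i| ≤ P / 2) ∧
          ∀ (y : 𝓞 L) (r : ℝ), 0 ≤ r → r ≤ η * P →
          (∀ i, |((RingOfIntegers.basis L).repr y i : ℝ) - s i| ≤ r) →
          (∀ i, |((RingOfIntegers.basis L).repr (qf M (x + y • v) - N) i : ℝ)| ≤ C * r * P) ∧
          ∀ l i, |((RingOfIntegers.basis L).repr ((x + y • v) l) i : ℝ)| ≤ P := by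
  set φ : 𝓞 L →+* mixedSpace L := (mixedEmbedding L).comp (algebraMap (𝓞 L) L) with hφ
  have hrepr : ∀ (x : 𝓞 L) i, (mixedEmbedding.latticeBasis L).repr (φ x) i =
      ((RingOfIntegers.basis L).repr x i : ℝ) := fun x i => latticeBasis_repr_eq x i
  obtain ⟨Ca, hCa1, hCa, hCa'⟩ := exists_norm_le_repr (L := L)
  obtain ⟨Cq, hCq0, hCq⟩ := exists_norm_qf_le (M.map φ)
  obtain ⟨Cb, hCb0, hCb⟩ := exists_norm_bl_le (M.map φ) (φ ∘ v)
  obtain ⟨Cm, hCm0, hCm⟩ := exists_mul_bound (RingOfIntegers.basis L)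
  obtain ⟨Cr, hCr0, hCr⟩ := exists_mixedSpace_root (b := φ (qf M v))
    (fun w => hv (embedding_of_isReal w.2)) (fun w h => hv0 (by
      have h1 : w.1.embedding ((qf M v : 𝓞 L) : L) = 0 := h
      exact RingOfIntegers.coe_eq_zero_iff.1 ((map_eq_zero _).1 h1)))
  obtain ⟨Cv, hCv1, hCv⟩ : ∃ Cv : ℝ, 1 ≤ Cv ∧ ∀ (y : 𝓞 L) (Y : ℝ), 0 ≤ Y →
      (∀ i, |((RingOfIntegers.basis L).repr y i : ℝ)| ≤ Y) →
      ∀ l i, |((RingOfIntegers.basis L).repr ((y • v) l) i : ℝ)| ≤ Cv * Y := by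
    have h0 : 0 ≤ ∑ l, ∑ i, |((RingOfIntegers.basis L).repr (v l) i : ℝ)| := by positivity
    refine ⟨Cm * (∑ l, ∑ i, |((RingOfIntegers.basis L).repr (v l) i : ℝ)|) + 1, by
      have := mul_nonneg (Nat.cast_nonneg (α := ℝ) Cm) h0
      linarith, fun y Y hY hy l i => ?_⟩
    have h1 := hCm y (v l) Y (∑ l, ∑ i, |((RingOfIntegers.basis L).repr (v l) i : ℝ)|) hY hy
      (fun i => (Finset.single_le_sum
        (f := fun i => |((RingOfIntegers.basis L).repr (v l) i : ℝ)|)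
        (fun _ _ => abs_nonneg _) (Finset.mem_univ i)).trans
        (Finset.single_le_sum
          (f := fun l => ∑ i, |((RingOfIntegers.basis L).repr (v l) i : ℝ)|)
          (fun _ _ => by positivity) (Finset.mem_univ l))) i
    rw [Pi.smul_apply, smul_eq_mul]
    refine h1.trans ?_
    nlinarith
  set κ₀ : ℝ := 1 / (4 * Cv * Ca * Cr) with hκ₀
  have hκ0 : 0 < κ₀ := by positivity
  obtain ⟨C, hC⟩ := exists_nat_ge
    (Ca * (Ca * (‖φ (qf M v)‖ * (Ca + Cr * κ₀) + κ₀)) + 1)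
  have hC0 : 0 < C := by
    have : (0 : ℝ) < C := lt_of_lt_of_le (by positivity) hC
    exact_mod_cast this
  refine ⟨κ₀ ^ 2 / 2, by positivity, C, hC0, 1 / (4 * Cv), by positivity, ?_, fun c₁ hc₁ => ?_⟩
  · rw [div_le_div_iff₀ (by positivity) (by norm_num)]
    linarith
  refine ⟨min (1 / 2) (min (κ₀ / (Cb * Ca)) (min (κ₀ ^ 2 / 2) c₁ / (Cq * Ca ^ 2))), by positivity,
    fun P N hP hN hN' x hx => ?_⟩
  set ρ : ℝ := min (1 / 2) (min (κ₀ / (Cb * Ca)) (min (κ₀ ^ 2 / 2) c₁ / (Cq * Ca ^ 2))) with hρ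
  have hρ0 : 0 < ρ := by positivity
  have hρ1 : ρ ≤ 1 / 2 := min_le_left _ _
  have hρ2 : Cb * Ca * ρ ≤ κ₀ := by
    rw [← le_div_iff₀' (by positivity)]
    exact (min_le_right _ _).trans (min_le_left _ _)
  have hρ3 : Cq * Ca ^ 2 * ρ ≤ min (κ₀ ^ 2 / 2) c₁ := by
    rw [← le_div_iff₀' (by positivity)]
    exact (min_le_right _ _).trans (min_le_right _ _)
  have hPr : (0 : ℝ) < P := by exact_mod_cast hP
  have hxn : ∀ l, ‖(φ ∘ x) l‖ ≤ Ca * (ρ * P) := fun l =>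
    hCa _ _ (by positivity) fun i => by
      rw [Function.comp_apply, hrepr]
      exact hx l i
  have hU : ‖φ (bl M x v)‖ ≤ κ₀ * P := by
    rw [← bl_map]
    refine (hCb _ _ (by positivity) hxn).trans ?_
    calc _ = Cb * Ca * ρ * P := by ring
      _ ≤ _ := by gcongr
  have hQ : ‖φ (qf M x)‖ ≤ min (κ₀ ^ 2 / 2) c₁ * P ^ 2 := by
    rw [← qf_map]
    refine (hCq _ _ hxn).trans ?_
    calc _ = Cq * Ca ^ 2 * ρ * P ^ 2 * ρ := by ring
      _ ≤ Cq * Ca ^ 2 * ρ * P ^ 2 * 1 := by gcongr; linarith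
      _ = Cq * Ca ^ 2 * ρ * P ^ 2 := by ring
      _ ≤ _ := by gcongr
  have hW : ‖φ (qf M x - N)‖ ≤ (κ₀ * P) ^ 2 := by
    rw [map_sub]
    have h1 : ‖φ N‖ ≤ κ₀ ^ 2 / 2 * P ^ 2 := norm_mixedEmbedding_le hN'
    have h2 : min (κ₀ ^ 2 / 2) c₁ * P ^ 2 ≤ κ₀ ^ 2 / 2 * P ^ 2 := by
      gcongr
      exact min_le_left _ _
    refine (norm_sub_le _ _).trans ?_
    rw [mul_pow]
    linarith
  obtain ⟨s, hs, hsn⟩ := hCr (φ (bl M x v)) (φ (qf M x - N)) (κ₀ * P) (by positivity) (fun w => by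
    have h1 : (φ (qf M x)).1 w ≤ c₁ * P ^ 2 :=
      (le_abs_self _).trans ((norm_le_pi_norm (φ (qf M x)).1 w).trans
        ((norm_fst_le _).trans (hQ.trans (by gcongr; exact min_le_right _ _))))
    have h2 : c₁ * P ^ 2 ≤ (φ N).1 w := hN (embedding_of_isReal w.2)
    rw [map_sub, Prod.fst_sub, Pi.sub_apply]
    linarith) hU hW
  have hsc : ∀ i, |(mixedEmbedding.latticeBasis L).repr s i| ≤ P / (4 * Cv) := fun i => by
    refine (hCa' s i).trans ?_
    calc Ca * ‖s‖ ≤ Ca * (Cr * (κ₀ * P)) := by gcongr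
      _ = _ := by
        rw [hκ₀]
        field_simp
  refine ⟨fun i => (mixedEmbedding.latticeBasis L).repr s i, fun i => (hsc i).trans ?_,
    fun y r hr hrP hy => ⟨fun i => ?_, fun l i => ?_⟩⟩
  · gcongr
    linarith
  · have h1 : φ (qf M (x + y • v) - N) =
        (φ y - s) * (φ (qf M v) * (φ y + s) + φ (bl M x v)) := by
      rw [qf_add_smul]
      simp only [map_sub, map_add, map_mul, map_pow] at hs ⊢
      linear_combination hs
    have h2 : ‖φ y - s‖ ≤ Ca * r := hCa _ _ hr fun i => by
      rw [map_sub, Finsupp.sub_apply, hrepr]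
      exact hy i
    have hyc : ∀ i, |((RingOfIntegers.basis L).repr y i : ℝ)| ≤ P := fun i => by
      have h3 := abs_le.1 (hy i)
      have h4 := abs_le.1 (hsc i)
      have h5 : (P : ℝ) / (4 * Cv) ≤ P / 4 := by
        gcongr
        linarith
      have h6 : 1 / (4 * Cv) * (P : ℝ) ≤ P / 4 := by
        rw [one_div_mul_eq_div]
        exact h5
      exact abs_le.2 ⟨by linarith [h3.1, h4.1], by linarith [h3.2, h4.2]⟩
    have h3 : ‖φ y‖ ≤ Ca * P := hCa _ _ hPr.le fun i => by
      rw [hrepr]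
      exact hyc i
    rw [← hrepr]
    refine (hCa' _ i).trans ?_
    rw [h1]
    calc _ ≤ Ca * (‖φ y - s‖ * (‖φ (qf M v)‖ * (‖φ y‖ + ‖s‖) + ‖φ (bl M x v)‖)) := by
          refine mul_le_mul_of_nonneg_left ((norm_mul_le _ _).trans
            (mul_le_mul_of_nonneg_left ?_ (norm_nonneg _))) (by positivity)
          refine (norm_add_le _ _).trans (add_le_add_left ((norm_mul_le _ _).trans ?_) _)
          exact mul_le_mul_of_nonneg_left (norm_add_le _ _) (norm_nonneg _)
      _ ≤ Ca * (Ca * r * (‖φ (qf M v)‖ * (Ca * P + Cr * (κ₀ * P)) + κ₀ * P)) := by gcongr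
      _ = Ca * (Ca * (‖φ (qf M v)‖ * (Ca + Cr * κ₀) + κ₀)) * (r * P) := by ring
      _ ≤ C * (r * P) := by
          gcongr
          linarith
      _ = _ := by ring
  · have hyc : ∀ i, |((RingOfIntegers.basis L).repr y i : ℝ)| ≤ P / (2 * Cv) := fun i => by
      have h3 := abs_le.1 (hy i)
      have h4 := abs_le.1 (hsc i)
      have h5 : 1 / (4 * Cv) * (P : ℝ) + P / (4 * Cv) = P / (2 * Cv) := by
        field_simp
        norm_num
      exact abs_le.2 ⟨by linarith [h3.1, h4.1], by linarith [h3.2, h4.2]⟩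
    have h1 := hCv y _ (by positivity) hyc l i
    have h2 : Cv * (P / (2 * Cv)) = P / 2 := by
      field_simp
    rw [Pi.add_apply, map_add, Finsupp.add_apply, Int.cast_add]
    have h3 : ρ * P ≤ 1 / 2 * P := by gcongr
    refine (abs_add_le _ _).trans ?_
    linarith [hx l i]

open Module Matrix NumberField

section

variable {R ι κ : Type*} [CommRing R] [Fintype ι] [DecidableEq ι] (ω : Basis ι ℤ R)
  [Fintype κ] [DecidableEq κ]

theorem repr_natCast_mul (D : ℕ) (x : R) (i : ι) : ω.repr (D * x) i = D * ω.repr x i := by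
  rw [← nsmul_eq_mul, map_nsmul, Finsupp.smul_apply, nsmul_eq_mul]

theorem natCast_mul_injective (ω : Basis ι ℤ R) {D : ℕ} (hD : 0 < D) :
    Function.Injective fun x : R => (D : R) * x := fun x y h => by
  refine ω.ext_elem fun i => ?_
  have h1 := congrArg (fun z => ω.repr z i) h
  simp only [repr_natCast_mul] at h1
  exact mul_left_cancel₀ (by exact_mod_cast hD.ne') h1

theorem exists_mem_box_mk_eq {D : ℕ} (hD : 0 < D) (a : R ⧸ Ideal.span {(D : R)}) :
    ∃ x ∈ box ω D, Ideal.Quotient.mk (Ideal.span {(D : R)}) x = a := by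
  obtain ⟨x, rfl⟩ := Ideal.Quotient.mk_surjective a
  have hD' : (0 : ℤ) < D := by exact_mod_cast hD
  refine ⟨ω.equivFun.symm fun i => ω.repr x i % D, (mem_box ω).2 fun i => ?_, ?_⟩
  · have : ω.repr (ω.equivFun.symm fun i => ω.repr x i % D) i = ω.repr x i % D := by
      rw [← ω.equivFun_apply, LinearEquiv.apply_symm_apply]
    rw [this, abs_of_nonneg (Int.emod_nonneg _ hD'.ne')]
    exact (Int.emod_lt_of_pos _ hD').le
  · rw [Ideal.Quotient.eq, Ideal.mem_span_singleton]
    refine ⟨ω.equivFun.symm fun i => -(ω.repr x i / D), ω.ext_elem fun i => ?_⟩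
    rw [repr_natCast_mul, map_sub, Finsupp.sub_apply]
    simp only [← ω.equivFun_apply, LinearEquiv.apply_symm_apply]
    have := Int.mul_ediv_add_emod (ω.equivFun x i) D
    linear_combination this

theorem exists_finset_qf_eq (M : Matrix κ κ R) (N : R) {D : ℕ} (hD : 0 < D) (m : ℕ) :
    ∃ A : Finset (κ → R), (∀ x ∈ A, x ∈ vbox ω κ (D + D * m) ∧ ∃ j, qf M x = N + D * j) ∧
      solCount M N (Ideal.span {(D : R)}) * ((2 * m + 1) ^ Fintype.card ι) ^ Fintype.card κ ≤
        A.card := by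
  classical
  set I := Ideal.span {(D : R)} with hI
  choose ξ hξ hξ' using exists_mem_box_mk_eq ω hD
  have hfinq : Finite (R ⧸ I) :=
    Set.finite_univ_iff.1 (((box ω D).finite_toSet.image (Ideal.Quotient.mk I)).subset
      fun a _ => ⟨ξ a, hξ a, hξ' a⟩)
  have : Fintype {x : κ → R ⧸ I // qf (M.map (Ideal.Quotient.mk I)) x = Ideal.Quotient.mk I N} :=
    Fintype.ofFinite _
  let f : {x : κ → R ⧸ I // qf (M.map (Ideal.Quotient.mk I)) x = Ideal.Quotient.mk I N} ×
      (κ → R) → κ → R := fun p l => ξ (p.1.1 l) + D * p.2 l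
  have hmk : ∀ p, (Ideal.Quotient.mk I) ∘ f p = p.1.1 := fun p => by
    funext l
    have : Ideal.Quotient.mk I (D : R) = 0 :=
      Ideal.Quotient.eq_zero_iff_mem.2 (Ideal.mem_span_singleton_self _)
    simp only [f, Function.comp_apply, map_add, map_mul, this, zero_mul, add_zero]
    exact hξ' _
  have hf : Function.Injective f := fun p q h => by
    have h1 : p.1 = q.1 := Subtype.ext (by rw [← hmk p, ← hmk q, h])
    refine Prod.ext h1 (funext fun l => natCast_mul_injective ω hD ?_)
    have h2 := congrFun h l
    simp only [f, h1] at h2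
    exact add_left_cancel h2
  refine ⟨(Finset.univ ×ˢ vbox ω κ m).image f, fun x hx => ?_, ?_⟩
  · obtain ⟨p, hp, rfl⟩ := Finset.mem_image.1 hx
    have hp2 := (mem_vbox ω).1 (Finset.mem_product.1 hp).2
    refine ⟨(mem_vbox ω).2 fun l => add_mem_box ω (hξ _) ((mem_box ω).2 fun i => ?_), ?_⟩
    · rw [repr_natCast_mul, abs_mul, Nat.abs_cast]
      push_cast
      exact mul_le_mul_of_nonneg_left ((mem_box ω).1 (hp2 l) i) (by positivity)
    · have h1 := p.1.2
      rw [← hmk p, qf_map, Ideal.Quotient.eq, Ideal.mem_span_singleton] at h1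
      obtain ⟨j, hj⟩ := h1
      exact ⟨j, by rw [← hj]; ring⟩
  · rw [Finset.card_image_of_injective _ hf, Finset.card_product, card_vbox, Finset.card_univ,
      solCount, Nat.card_eq_fintype_card]

theorem exists_finset_qf_add_eq (M : Matrix κ κ R) (N : R) (v : κ → R) {D : ℕ} (m P K J : ℕ)
    (A : Finset (κ → R)) (hA : ∀ x ∈ A, ∃ j₀ : R, ∀ t ∈ box ω m, j₀ + t ∈ box ω J ∧
      x + (D * (j₀ + t)) • v ∈ vbox ω κ P ∧
      ∃ j ∈ box ω K, qf M (x + (D * (j₀ + t)) • v) = N + D * j) :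
    ∃ T : Finset ((κ → R) × (κ → R) × R),
      (∀ p ∈ T, p.1 ∈ vbox ω κ (2 * P) ∧ p.2.1 ∈ vbox ω κ (2 * P) ∧ p.2.2 ∈ box ω K ∧
        qf M (p.1 + p.2.1) = N + D * p.2.2) ∧
      A.card * (2 * m + 1) ^ Fintype.card ι * ((2 * P + 1) ^ Fintype.card ι) ^ Fintype.card κ ≤
        (2 * J + 1) ^ Fintype.card ι * T.card := by
  classical
  choose! j₀ hJ hP j hj hq using hA
  let f : (κ → R) × R × (κ → R) → (κ → R) × (κ → R) × R := fun p =>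
    (p.2.2, p.1 + ((D : R) * (j₀ p.1 + p.2.1)) • v - p.2.2, j p.1 p.2.1)
  refine ⟨(A ×ˢ box ω m ×ˢ vbox ω κ P).image f, fun q hq' => ?_, ?_⟩
  · obtain ⟨p, hp, rfl⟩ := Finset.mem_image.1 hq'
    simp only [Finset.mem_product] at hp
    refine ⟨vbox_mono ω (by omega) hp.2.2,
      sub_mem_vbox ω (hP _ hp.1 _ hp.2.1) hp.2.2, hj _ hp.1 _ hp.2.1, ?_⟩
    simp only [f, add_sub_cancel]
    exact hq _ hp.1 _ hp.2.1
  · rw [← card_vbox ω P, ← card_box ω m, ← card_box ω J, mul_assoc, ← Finset.card_product,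
      ← Finset.card_product]
    refine Finset.card_le_mul_card_image _ _ fun q _ => ?_
    refine Finset.card_le_card_of_injOn (fun p => j₀ p.1 + p.2.1) (fun p hp => ?_)
      fun p hp p' hp' h => ?_
    · have hp := Finset.mem_product.1 (Finset.mem_filter.1 hp).1
      exact hJ _ hp.1 _ (Finset.mem_product.1 hp.2).1
    · have h1 := (Finset.mem_filter.1 hp).2.trans (Finset.mem_filter.1 hp').2.symm
      simp only [f, Prod.mk.injEq] at h1 h
      obtain ⟨h2, h3, -⟩ := h1
      rw [h2, h] at h3
      have h4 : p.1 = p'.1 := add_right_cancel (sub_left_injective h3)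
      rw [h4] at h
      exact Prod.ext h4 (Prod.ext (add_left_cancel h) h2)

end

theorem count_lower_bound {c₀ ρ D P m m₁ J s A T : ℝ} (d n : ℕ) (hD : 0 < D) (hP : 0 < P)
    (hρ : 0 < ρ) (hc₀ : 0 < c₀) (hm : 0 ≤ m) (hm₁ : 0 ≤ m₁) (hJ : 0 ≤ J) (hs : 0 ≤ s) (hT : 0 ≤ T)
    (h : c₀ * (D ^ d) ^ n ≤ s * D ^ d) (hA : s * ((2 * m₁ + 1) ^ d) ^ n ≤ A)
    (hAT : A * (2 * m + 1) ^ d * ((2 * P + 1) ^ d) ^ n ≤ (2 * J + 1) ^ d * T)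
    (hm₁ρ : ρ / (2 * D) * P < m₁ + 1) (hJP : 2 * J + 1 ≤ 3 * (P / D)) :
    c₀ * (ρ / 2) ^ (d * n) * m ^ d * (P ^ (n * d)) ^ 2 ≤ 3 ^ d * P ^ d * T := by
  have h1 : ρ / (2 * D) * P = ρ / 2 * P / D := by field_simp
  have h2 : 2 * m₁ + 1 ≥ ρ / (2 * D) * P := by linarith
  calc _ = c₀ * (D ^ d) ^ n * (((ρ / (2 * D) * P) ^ d) ^ n * m ^ d * (P ^ d) ^ n) := by
        rw [h1, div_pow (ρ / 2 * P) D, div_pow _ (D ^ d), mul_pow (ρ / 2), mul_pow _ (P ^ d),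
          mul_comm n d, pow_mul (ρ / 2), pow_mul P]
        field_simp
    _ ≤ s * D ^ d * (((2 * m₁ + 1) ^ d) ^ n * (2 * m + 1) ^ d * ((2 * P + 1) ^ d) ^ n) := by
        gcongr <;> linarith
    _ = D ^ d * (s * ((2 * m₁ + 1) ^ d) ^ n * (2 * m + 1) ^ d * ((2 * P + 1) ^ d) ^ n) := by ring
    _ ≤ D ^ d * (A * (2 * m + 1) ^ d * ((2 * P + 1) ^ d) ^ n) := by gcongr
    _ ≤ D ^ d * ((2 * J + 1) ^ d * T) := by gcongr
    _ ≤ D ^ d * ((3 * (P / D)) ^ d * T) := by gcongr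
    _ = _ := by
        rw [mul_pow, div_pow]
        field_simp

theorem count_le {c C m P K T : ℝ} (d n : ℕ) (hP : 0 < P) (hc : 0 < c) (hC : 0 < C)
    (hK : 0 ≤ K) (hT : 0 ≤ T) (hKC : 2 * K + 1 ≤ 5 * C * (m * P))
    (h : c * m ^ d * (P ^ (n * d)) ^ 2 ≤ 3 ^ d * P ^ d * T) :
    c / (3 ^ d * (5 * C) ^ d * 2 ^ (2 * n * d)) * (2 * K + 1) ^ d * (2 * P) ^ (2 * n * d) ≤
      T * (2 * P) ^ (2 * d) := by
  have e1 : P ^ (2 * n * d) = (P ^ (n * d)) ^ 2 := by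
    rw [← pow_mul]
    congr 1
    ring
  have e2 : P ^ (2 * d) = P ^ d * P ^ d := by
    rw [two_mul, pow_add]
  calc _ ≤ c / (3 ^ d * (5 * C) ^ d * 2 ^ (2 * n * d)) * (5 * C * (m * P)) ^ d *
        (2 * P) ^ (2 * n * d) := by gcongr
    _ = c * m ^ d * (P ^ (n * d)) ^ 2 / 3 ^ d * P ^ d := by
        rw [mul_pow (5 * C), mul_pow m, mul_pow 2 P, e1]
        field_simp
    _ ≤ 3 ^ d * P ^ d * T / 3 ^ d * P ^ d := by gcongr
    _ = T * P ^ (2 * d) := by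
        rw [e2]
        field_simp
    _ ≤ T * (2 * P) ^ (2 * d) := by
        gcongr
        linarith

variable {L κ : Type*} [Field L] [NumberField L] [Fintype κ]

theorem card_quotient_span_natCast (D : ℕ) :
    Nat.card (𝓞 L ⧸ Ideal.span {(D : 𝓞 L)}) =
      D ^ Fintype.card (Free.ChooseBasisIndex ℤ (𝓞 L)) := by
  rw [← finrank_eq_card_chooseBasisIndex, ← Submodule.cardQuot_apply, ← Ideal.absNorm_apply,
    Ideal.absNorm_span_natCast]

/-- Integers which are represented modulo every `D` and which are of comparable large size at all
archimedean places are represented. -/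
theorem exists_qf_eq_of_congRep [LinearOrder κ] (hκ : 5 ≤ Fintype.card κ)
    (M : Matrix κ κ (𝓞 L)) (hM : (M + Mᵀ).det ≠ 0) (v : κ → 𝓞 L) (hv0 : qf M v ≠ 0)
    (hv : ∀ σ : L →+* ℝ, 0 < σ ((qf M v : 𝓞 L) : L)) :
    ∃ c₂ : ℝ, 0 < c₂ ∧ ∀ c₁ : ℝ, 0 < c₁ → ∃ P₀ : ℕ, ∀ P : ℕ, P₀ ≤ P → ∀ N : 𝓞 L, CongRep M N →
      (∀ σ : L →+* ℝ, c₁ * P ^ 2 ≤ σ N) → (∀ w : InfinitePlace L, w N ≤ c₂ * P ^ 2) →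
      ∃ x, qf M x = N := by
  set ω := RingOfIntegers.basis L with hω
  obtain ⟨c₂, hc₂, C, hC, η, hη, hη2, H⟩ := exists_approx_root M v hv0 hv
  obtain ⟨c₀, hc₀, hsol⟩ := exists_solCount_ge hκ M hM
  refine ⟨c₂, hc₂, fun c₁ hc₁ => ?_⟩
  obtain ⟨ρ, hρ, H⟩ := H c₁ hc₁
  set d := Fintype.card (Free.ChooseBasisIndex ℤ (𝓞 L)) with hd
  set n := Fintype.card κ with hn
  obtain ⟨D, hD, δ, hδ, P₁, hmain⟩ := exists_qf_eq ω hκ M hM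
    (c := c₀ * (ρ / 2) ^ (d * n) / (3 ^ d * (5 * C) ^ d * 2 ^ (2 * n * d))) (by positivity)
  have hD0 : (0 : ℝ) < D := by exact_mod_cast hD
  have hC0 : (0 : ℝ) < C := by exact_mod_cast hC
  set η' : ℝ := min (η / (2 * D)) (2 * δ / C) with hη'
  have hη'0 : 0 < η' := by positivity
  obtain ⟨P₂, hP₂⟩ := exists_nat_ge (1 / η')
  obtain ⟨P₃, hP₃⟩ := exists_nat_ge (1 / (ρ / (2 * D)))
  refine ⟨P₁ + P₂ + P₃ + D, fun P hP N hN hN1 hN2 => ?_⟩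
  have hPD : (D : ℝ) ≤ P := by exact_mod_cast (by omega : D ≤ P)
  have hP0 : (0 : ℝ) < P := hD0.trans_le hPD
  set m := ⌊η' * P⌋₊ with hm
  set m₁ := ⌊ρ / (2 * D) * P⌋₊ with hm₁
  set J := P / D with hJ
  have hm1 : 1 ≤ m := by
    rw [hm, Nat.one_le_floor_iff, ← div_le_iff₀' hη'0]
    exact hP₂.trans (by exact_mod_cast (by omega : P₂ ≤ P))
  have hm11 : 1 ≤ m₁ := by
    rw [hm₁, Nat.one_le_floor_iff, ← div_le_iff₀' (by positivity)]
    exact hP₃.trans (by exact_mod_cast (by omega : P₃ ≤ P))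
  have hmle : (m : ℝ) ≤ η' * P := Nat.floor_le (by positivity)
  have hm1le : (m₁ : ℝ) ≤ ρ / (2 * D) * P := Nat.floor_le (by positivity)
  have hm1lt : ρ / (2 * D) * P < m₁ + 1 := Nat.lt_floor_add_one _
  have hmr : (1 : ℝ) ≤ m := by exact_mod_cast hm1
  have hm1r : (1 : ℝ) ≤ m₁ := by exact_mod_cast hm11
  have hmη : 2 * D * m ≤ η * P := by
    calc 2 * D * (m : ℝ) ≤ 2 * D * (η / (2 * D) * P) := by
          gcongr
          exact hmle.trans (by gcongr; exact min_le_left _ _)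
      _ = η * P := by field_simp
  obtain ⟨A, hA, hAcard⟩ := exists_finset_qf_eq ω M N hD m₁
  obtain ⟨T, hT, hTcard⟩ := exists_finset_qf_add_eq ω M N v (D := D) m P (2 * C * m * P) J A
    fun x hx => by
      obtain ⟨hxb, j, hj⟩ := hA x hx
      obtain ⟨s, hs, hs'⟩ := H P N (by exact_mod_cast hP0) hN1 hN2 x fun l i => by
        have h1 := (mem_box ω).1 ((mem_vbox ω).1 hxb l) i
        have h2 : |(ω.repr (x l) i : ℝ)| ≤ D + D * m₁ := by exact_mod_cast h1
        refine h2.trans ?_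
        calc (D : ℝ) + D * m₁ ≤ 2 * D * m₁ := by nlinarith
          _ ≤ 2 * D * (ρ / (2 * D) * P) := by gcongr
          _ = ρ * P := by field_simp
      refine ⟨ω.equivFun.symm fun i => ⌊s i / D⌋, fun t ht => ?_⟩
      set y := ω.equivFun.symm (fun i => ⌊s i / D⌋) + t with hy
      have hys : ∀ i, |(ω.repr (D * y) i : ℝ) - s i| ≤ 2 * D * m := fun i => by
        have h1 : ω.repr (D * y) i = D * (⌊s i / D⌋ + ω.repr t i) := by
          rw [repr_natCast_mul, hy, map_add, Finsupp.add_apply]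
          simp only [← ω.equivFun_apply, LinearEquiv.apply_symm_apply]
        have h2 : |(ω.repr t i : ℝ)| ≤ m := by exact_mod_cast (mem_box ω).1 ht i
        have h3 := Int.floor_le (s i / D)
        have h4 := Int.lt_floor_add_one (s i / D)
        rw [le_div_iff₀ hD0] at h3
        rw [div_lt_iff₀ hD0] at h4
        have h5 := abs_le.1 h2
        rw [h1]
        push_cast
        refine abs_le.2 ⟨?_, ?_⟩ <;> nlinarith [h5.1, h5.2]
      obtain ⟨h1, h2⟩ := hs' (D * y) (2 * D * m) (by positivity) hmη hys
      refine ⟨(mem_box ω).2 fun i => ?_, (mem_vbox ω).2 fun l => (mem_box ω).2 fun i => ?_,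
        j + y * bl M x v + D * y ^ 2 * qf M v, (mem_box ω).2 fun i => ?_, ?_⟩
      · have h3 : |(ω.repr (D * y) i : ℝ)| ≤ P := by
          have h4 := abs_le.1 (hys i)
          have h5 := abs_le.1 (hs i)
          have h6 : η * P ≤ 1 / 2 * P := by gcongr
          exact abs_le.2 ⟨by linarith [h4.1, h5.1], by linarith [h4.2, h5.2]⟩
        rw [repr_natCast_mul] at h3
        have h4 : (D : ℤ) * |ω.repr y i| ≤ P := by
          rw [← Nat.abs_cast D, ← abs_mul]
          exact_mod_cast h3
        rw [hJ, Int.natCast_div]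
        exact Int.le_ediv_of_mul_le (by exact_mod_cast hD) (by linarith)
      · exact_mod_cast h2 l i
      · have h3 : qf M (x + (D * y) • v) - N = D * (j + y * bl M x v + D * y ^ 2 * qf M v) := by
          rw [qf_add_smul, hj]
          ring
        have h4 := h1 i
        rw [h3, repr_natCast_mul] at h4
        push_cast at h4
        rw [abs_mul, Nat.abs_cast] at h4
        have h5 : |(ω.repr (j + y * bl M x v + D * y ^ 2 * qf M v) i : ℝ)| ≤ 2 * C * m * P := by
          refine le_of_mul_le_mul_left (h4.trans (le_of_eq ?_)) hD0
          ring
        exact_mod_cast h5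
      · rw [qf_add_smul, hj]
        ring
  refine hmain (2 * P) (2 * C * m * P) (by omega) ?_ N T hT ?_
  · push_cast
    calc 2 * C * (m : ℝ) * P ≤ 2 * C * (2 * δ / C * P) * P := by
          gcongr
          exact hmle.trans (by gcongr; exact min_le_right _ _)
      _ = _ := by
        field_simp
  · have e1 : (2 * (2 * C * m * P : ℕ) + 1 : ℝ) ≤ 5 * C * (m * P) := by
      have h1 : (1 : ℝ) ≤ C := by exact_mod_cast hC
      have h2 : (1 : ℝ) ≤ P := by exact_mod_cast (by omega : 1 ≤ P)
      have h3 : (1 : ℝ) ≤ C * (m * P) := one_le_mul_of_one_le_of_one_le h1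
        (one_le_mul_of_one_le_of_one_le hmr h2)
      push_cast
      linarith
    have e2 : (2 * J + 1 : ℝ) ≤ 3 * (P / D) := by
      have h1 : (J : ℝ) ≤ P / D := Nat.cast_div_le
      have h2 : (1 : ℝ) ≤ P / D := (one_le_div hD0).2 hPD
      linarith
    have e3 : c₀ * (D ^ d : ℝ) ^ n ≤ solCount M N (Ideal.span {(D : 𝓞 L)}) * D ^ d := by
      have := hsol (Ideal.span {(D : 𝓞 L)}) (by
        rw [Ne, Ideal.span_singleton_eq_bot]
        exact_mod_cast hD.ne') N hN
      rw [card_quotient_span_natCast] at this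
      exact_mod_cast this
    have hTr : (0 : ℝ) ≤ T.card := Nat.cast_nonneg _
    have e4 := count_lower_bound (A := A.card) (T := T.card) d n hD0 hP0 hρ hc₀
      (Nat.cast_nonneg m) (Nat.cast_nonneg m₁) (Nat.cast_nonneg J) (Nat.cast_nonneg _) hTr e3
      (by exact_mod_cast hAcard) (by exact_mod_cast hTcard) hm1lt e2
    have e5 := count_le d n hP0 (by positivity) hC0 (Nat.cast_nonneg (2 * C * m * P)) hTr e1 e4
    rw [Nat.cast_mul 2 P, Nat.cast_ofNat]
    exact e5

open Module NumberField NumberField.InfinitePlace NumberField.Units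
  NumberField.Units.dirichletUnitTheorem

variable (L : Type*) [Field L] [NumberField L]

open scoped Classical in
/-- Dirichlet's unit theorem: the logarithms of units are relatively dense. -/
theorem exists_log_unit_sub_le : ∃ B : ℝ, 0 ≤ B ∧ ∀ ℓ : InfinitePlace L → ℝ,
    ∑ w, w.mult * ℓ w = 0 → ∃ u : (𝓞 L)ˣ, ∀ w, |Real.log (w (u : L)) - ℓ w| ≤ B := by
  set b := (basisUnitLattice L).ofZLatticeBasis ℝ (unitLattice L) with hb
  set B₀ : ℝ := ∑ i, ‖b i‖ with hB₀
  have hB₀0 : 0 ≤ B₀ := by positivity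
  refine ⟨Fintype.card (InfinitePlace L) * B₀, by positivity, fun ℓ hℓ => ?_⟩
  set x : logSpace L := fun w => mult w.1 * ℓ w.1 with hx
  have h1 : (ZSpan.floor b x : logSpace L) ∈ unitLattice L := by
    rw [← (basisUnitLattice L).ofZLatticeBasis_span ℝ (unitLattice L)]
    exact (ZSpan.floor b x).2
  obtain ⟨u, -, hu⟩ := h1
  have hu : logEmbedding L u = ZSpan.floor b x := hu
  have h2 : ‖x - logEmbedding L u‖ ≤ B₀ := by
    rw [hu]
    exact ZSpan.norm_fract_le b x
  refine ⟨u.toMul, ?_⟩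
  set e : InfinitePlace L → ℝ := fun w => w.mult * (Real.log (w (u.toMul : L)) - ℓ w) with he
  have h3 : ∀ w, w ≠ w₀ → |e w| ≤ B₀ := fun w hw => by
    have h4 := (norm_le_pi_norm (x - logEmbedding L u) ⟨w, hw⟩).trans h2
    have h5 : e w = -(x - logEmbedding L u) ⟨w, hw⟩ := by
      rw [Pi.sub_apply, neg_sub]
      exact mul_sub _ _ _
    rwa [h5, abs_neg]
  have h5 : ∑ w, e w = 0 := by
    simp only [he, mul_sub, Finset.sum_sub_distrib, hℓ, sum_mult_mul_log, sub_zero]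
  have hcard : (1 : ℝ) ≤ Fintype.card (InfinitePlace L) := by
    exact_mod_cast Fintype.card_pos
  have h6 : ∀ w, |e w| ≤ Fintype.card (InfinitePlace L) * B₀ := fun w => by
    by_cases hw : w = w₀
    · rw [← Finset.add_sum_erase _ _ (Finset.mem_univ w)] at h5
      rw [eq_neg_of_add_eq_zero_left h5, abs_neg]
      refine (Finset.abs_sum_le_sum_abs _ _).trans ((Finset.sum_le_sum fun v hv =>
        h3 v (hw ▸ Finset.ne_of_mem_erase hv)).trans ?_)
      rw [Finset.sum_const, nsmul_eq_mul]
      gcongr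
      exact Finset.card_le_univ _
    · exact (h3 w hw).trans (le_mul_of_one_le_left hB₀0 hcard)
  intro w
  refine le_trans ?_ (h6 w)
  simp only [he, abs_mul, Nat.abs_cast]
  exact le_mul_of_one_le_left (abs_nonneg _) (by exact_mod_cast one_le_mult)

variable {L}

theorem exists_infinitePlace_eq_abs (σ : L →+* ℝ) :
    ∃ w : InfinitePlace L, w.IsReal ∧ ∀ x, w x = |σ x| := by
  refine ⟨InfinitePlace.mk (Complex.ofRealHom.comp σ), ?_, fun x => ?_⟩
  · rw [isReal_mk_iff]
    ext x
    simp [ComplexEmbedding.conjugate_coe_eq]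
  · simp

theorem infinitePlace_mul_sq (w : InfinitePlace L) {N : L} (hN : N ≠ 0) (u : (𝓞 L)ˣ) :
    w (N * (u : L) ^ 2) = Real.exp (Real.log (w N) + 2 * Real.log (w (u : L))) := by
  rw [map_mul, map_pow, Real.exp_add, Real.exp_log (pos_iff.2 hN), mul_comm 2, Real.exp_mul,
    Real.exp_log (pos_iff.2 (by simp))]
  norm_num

theorem exists_unit_balance (L : Type*) [Field L] [NumberField L] :
    ∃ B : ℝ, 1 ≤ B ∧ ∀ N : L, N ≠ 0 → ∃ (u : (𝓞 L)ˣ) (t : ℝ), 0 < t ∧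
    ∀ w : InfinitePlace L, t / B ≤ w (N * (u : L) ^ 2) ∧ w (N * (u : L) ^ 2) ≤ B * t := by
  obtain ⟨B, hB0, hB⟩ := exists_log_unit_sub_le L
  refine ⟨Real.exp (2 * B), Real.one_le_exp (by positivity), fun N hN => ?_⟩
  set s : ℝ := ∑ w : InfinitePlace L, (w.mult : ℝ) with hs
  have hs0 : 0 < s := Finset.sum_pos (fun w _ => by exact_mod_cast mult_pos) Finset.univ_nonempty
  set τ : ℝ := (∑ w : InfinitePlace L, w.mult * Real.log (w N)) / s with hτ
  obtain ⟨u, hu⟩ := hB (fun w => (τ - Real.log (w N)) / 2) (by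
    simp only [← mul_div_assoc, mul_sub]
    rw [← Finset.sum_div, Finset.sum_sub_distrib, ← Finset.sum_mul, ← hs, hτ,
      mul_div_cancel₀ _ hs0.ne', sub_self, zero_div])
  refine ⟨u, Real.exp τ, Real.exp_pos _, fun w => ?_⟩
  have h := abs_le.1 (hu w)
  rw [infinitePlace_mul_sq w hN, ← Real.exp_sub, ← Real.exp_add, Real.exp_le_exp, Real.exp_le_exp]
  constructor <;> linarith [h.1, h.2]

/-- There are units which are large, of comparable size, at all places but one. -/
theorem exists_unit_large (w₁ : InfinitePlace L) : ∃ B : ℝ, 1 ≤ B ∧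
    ∀ R : ℝ, 1 ≤ R → ∃ u : (𝓞 L)ˣ, (∀ w : InfinitePlace L, w (u : L) ≤ B * R) ∧
      ∀ w : InfinitePlace L, w ≠ w₁ → R / B ≤ w (u : L) := by
  classical
  obtain ⟨B, hB0, hB⟩ := exists_log_unit_sub_le L
  refine ⟨Real.exp B, Real.one_le_exp hB0, fun R hR => ?_⟩
  have hR0 : 0 < R := by linarith
  have hm : (0 : ℝ) < w₁.mult := by exact_mod_cast mult_pos
  set s : ℝ := ∑ w ∈ Finset.univ.erase w₁, (w.mult : ℝ) with hs
  have hs0 : 0 ≤ s := by positivity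
  have hlog := Real.log_nonneg hR
  obtain ⟨u, hu⟩ := hB (Function.update (fun _ => Real.log R) w₁ (-(s * Real.log R / w₁.mult))) (by
    rw [← Finset.add_sum_erase _ _ (Finset.mem_univ w₁), Function.update_self,
      Finset.sum_congr rfl fun w hw => by
        rw [Function.update_of_ne (Finset.ne_of_mem_erase hw)], ← Finset.sum_mul, ← hs]
    field_simp
    ring)
  refine ⟨u, fun w => ?_, fun w hw => ?_⟩
  · have h0 : 0 < w (u : L) := pos_iff.2 (by simp)
    have h1 : Function.update (fun _ => Real.log R) w₁ (-(s * Real.log R / w₁.mult)) w ≤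
        Real.log R := by
      by_cases hw : w = w₁
      · rw [hw, Function.update_self]
        have : 0 ≤ s * Real.log R / w₁.mult := by positivity
        linarith
      · rw [Function.update_of_ne hw]
    rw [← Real.log_le_log_iff h0 (by positivity), Real.log_mul (Real.exp_pos _).ne' hR0.ne',
      Real.log_exp]
    linarith [(abs_le.1 (hu w)).2]
  · have h0 : 0 < w (u : L) := pos_iff.2 (by simp)
    have h1 := (abs_le.1 (hu w)).1
    rw [Function.update_of_ne hw] at h1
    rw [← Real.log_le_log_iff (by positivity) h0, Real.log_div hR0.ne' (Real.exp_pos _).ne',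
      Real.log_exp]
    linarith

open Module Matrix NumberField NumberField.InfinitePlace

theorem exists_qf_eq_of_mul_sq {R κ : Type*} [CommRing R] [Fintype κ] {M : Matrix κ κ R} {N : R}
    (u : Rˣ) (h : ∃ x, qf M x = N * (u : R) ^ 2) : ∃ x, qf M x = N := by
  obtain ⟨x, hx⟩ := h
  refine ⟨(↑u⁻¹ : R) • x, ?_⟩
  rw [qf_smul, hx, mul_left_comm, ← mul_pow, Units.inv_mul, one_pow, mul_one]

section

variable {L κ : Type*} [Field L] [NumberField L] [Fintype κ] [LinearOrder κ]

theorem exists_infinitePlace_eq_mul_sq (σ : L →+* ℝ) {N : L} (hN : 0 < σ N) :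
    ∃ w : InfinitePlace L, w.IsReal ∧ ∀ u : (𝓞 L)ˣ, w (N * (u : L) ^ 2) = σ (N * (u : L) ^ 2) := by
  obtain ⟨w, hw, h⟩ := exists_infinitePlace_eq_abs σ
  refine ⟨w, hw, fun u => ?_⟩
  rw [h, abs_of_nonneg]
  rw [map_mul, map_pow]
  positivity

/-- Up to squares of units, a totally positive integer which is represented modulo every `D` is
represented or bounded. -/
theorem exists_bound_or_qf_eq (hκ : 5 ≤ Fintype.card κ)
    (M : Matrix κ κ (𝓞 L)) (hM : (M + Mᵀ).det ≠ 0) (v : κ → 𝓞 L) (hv0 : qf M v ≠ 0)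
    (hv : ∀ σ : L →+* ℝ, 0 < σ ((qf M v : 𝓞 L) : L)) :
    ∃ C : ℝ, ∀ N : 𝓞 L, N ≠ 0 → (∀ σ : L →+* ℝ, 0 < σ N) → CongRep M N →
      (∃ x, qf M x = N) ∨ ∃ u : (𝓞 L)ˣ, ∀ w : InfinitePlace L, w (N * (u : L) ^ 2) ≤ C := by
  obtain ⟨c₂, hc₂, H⟩ := exists_qf_eq_of_congRep hκ M hM v hv0 hv
  obtain ⟨B, hB1, hB⟩ := exists_unit_balance L
  have hB0 : 0 < B := by linarith
  obtain ⟨P₀, H⟩ := H (c₂ / (4 * B ^ 2)) (by positivity)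
  refine ⟨c₂ * (P₀ ^ 2 + 1), fun N hN0 hNpos hN => ?_⟩
  obtain ⟨u, t, ht, hu⟩ := hB N (RingOfIntegers.coe_ne_zero_iff.2 hN0)
  rcases le_or_gt (B * t) (c₂ * (P₀ ^ 2 + 1)) with hsmall | hlarge
  · exact Or.inr ⟨u, fun w => (hu w).2.trans hsmall⟩
  left
  refine exists_qf_eq_of_mul_sq u ?_
  have h1 : (P₀ : ℝ) ^ 2 + 1 ≤ B * t / c₂ := by
    rw [le_div_iff₀' hc₂]
    exact hlarge.le
  set q := √(B * t / c₂) with hq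
  have hq2 : q ^ 2 = B * t / c₂ := Real.sq_sqrt (by positivity)
  have hq1 : 1 ≤ q := Real.one_le_sqrt.2 (by nlinarith [sq_nonneg (P₀ : ℝ)])
  have hqP : (P₀ : ℝ) ≤ q := Real.le_sqrt_of_sq_le (by linarith)
  have hP1 : q ≤ ⌈q⌉₊ := Nat.le_ceil q
  have hP2 : (⌈q⌉₊ : ℝ) ≤ 2 * q := by
    have := Nat.ceil_lt_add_one (a := q) (by linarith)
    linarith
  refine H ⌈q⌉₊ (by exact_mod_cast hqP.trans hP1) _ (hN.mul_sq _) (fun σ => ?_) fun w => ?_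
  · obtain ⟨w, -, hw⟩ := exists_infinitePlace_eq_mul_sq σ (hNpos σ)
    push_cast
    rw [← hw]
    refine le_trans ?_ (hu w).1
    calc c₂ / (4 * B ^ 2) * (⌈q⌉₊ : ℝ) ^ 2 ≤ c₂ / (4 * B ^ 2) * (2 * q) ^ 2 := by gcongr
      _ = t / B := by
        rw [mul_pow, hq2]
        field_simp
        norm_num
  · push_cast
    refine (hu w).2.trans ?_
    calc B * t = c₂ * q ^ 2 := by
          rw [hq2]
          field_simp
      _ ≤ _ := by gcongr

theorem exists_qf_eq_of_isComplex (hκ : 5 ≤ Fintype.card κ)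
    (M : Matrix κ κ (𝓞 L)) (hM : (M + Mᵀ).det ≠ 0) (v : κ → 𝓞 L) (hv0 : qf M v ≠ 0)
    (hv : ∀ σ : L →+* ℝ, 0 < σ ((qf M v : 𝓞 L) : L)) {w₁ : InfinitePlace L} (hw₁ : w₁.IsComplex)
    {N : 𝓞 L} (hN0 : N ≠ 0) (hNpos : ∀ σ : L →+* ℝ, 0 < σ N) (hN : CongRep M N) :
    ∃ x, qf M x = N := by
  obtain ⟨c₂, hc₂, H⟩ := exists_qf_eq_of_congRep hκ M hM v hv0 hv
  obtain ⟨B, hB1, hB⟩ := exists_unit_large w₁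
  have hB0 : 0 < B := by linarith
  have hw0 : ∀ w : InfinitePlace L, 0 < w N := fun w =>
    pos_iff.2 (RingOfIntegers.coe_ne_zero_iff.2 hN0)
  obtain ⟨wa, ha⟩ := Finite.exists_max fun w : InfinitePlace L => w N
  obtain ⟨wb, hb⟩ := Finite.exists_min fun w : InfinitePlace L => w N
  have ha0 := hw0 wa
  have hb0 := hw0 wb
  set a := wa N
  set b := wb N
  set q := √(c₂ / (a * B ^ 2)) with hq
  have hq0 : 0 < q := Real.sqrt_pos.2 (by positivity)
  have hq2 : q ^ 2 = c₂ / (a * B ^ 2) := Real.sq_sqrt (by positivity)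
  obtain ⟨P₀, H⟩ := H (b * q ^ 2 / B ^ 2) (by positivity)
  obtain ⟨P₁, hP₁⟩ := exists_nat_ge (1 / q)
  have hP : (P₁ : ℝ) ≤ (P₀ + P₁ : ℕ) := by exact_mod_cast Nat.le_add_left _ _
  set P := P₀ + P₁ with hPdef
  have hR : 1 ≤ P * q := by
    rw [← div_le_iff₀ hq0]
    exact hP₁.trans hP
  obtain ⟨u, hu, hu'⟩ := hB (P * q) hR
  refine exists_qf_eq_of_mul_sq u (H P (Nat.le_add_right _ _) _ (hN.mul_sq _) (fun σ => ?_)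
    fun w => ?_)
  · obtain ⟨w, hwr, hw⟩ := exists_infinitePlace_eq_mul_sq σ (hNpos σ)
    have hne : w ≠ w₁ := fun h => not_isReal_iff_isComplex.2 hw₁ (h ▸ hwr)
    push_cast
    rw [← hw, map_mul, map_pow]
    calc b * q ^ 2 / B ^ 2 * (P : ℝ) ^ 2 = b * (P * q / B) ^ 2 := by ring
      _ ≤ w N * w (u : L) ^ 2 := by
        gcongr
        · exact hb w
        · exact hu' w hne
  · push_cast
    rw [map_mul, map_pow]
    calc w N * w (u : L) ^ 2 ≤ a * (B * (P * q)) ^ 2 := by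
          gcongr
          · exact ha w
          · exact hu w
      _ = a * B ^ 2 * P ^ 2 * q ^ 2 := by ring
      _ = _ := by
        rw [hq2]
        field_simp

end

section

variable {K κ : Type*} [Field K] [NumberField K] [Fintype κ] [DecidableEq κ]

theorem det_ne_zero_of_pos {M : Matrix κ κ (𝓞 K)} (σ : K →+* ℝ)
    (hpos : ∀ v : κ → 𝓞 K, v ≠ 0 → 0 < σ ((qf M v : 𝓞 K) : K)) : (M + Mᵀ).det ≠ 0 := fun h => by
  obtain ⟨v, hv, hv0⟩ := exists_mulVec_eq_zero_iff.2 h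
  have h1 : bl M v v = 0 := by rw [bl, hv0, dotProduct_zero]
  rw [bl_self, mul_eq_zero, or_iff_right two_ne_zero] at h1
  have := hpos v hv
  simp [h1] at this

theorem exists_real_embedding (hK : ∀ σ : K →+* ℂ, ∀ x : K, (σ x).im = 0) :
    Nonempty (K →+* ℝ) := by
  obtain ⟨φ⟩ := (inferInstance : Nonempty (K →+* ℂ))
  have h : ComplexEmbedding.IsReal φ := by
    rw [ComplexEmbedding.isReal_iff]
    ext x
    rw [ComplexEmbedding.conjugate_coe_eq, Complex.conj_eq_iff_im, hK]
  exact ⟨h.embedding⟩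

theorem finite_forall_infinitePlace_le (C : ℝ) :
    {N : 𝓞 K | ∀ w : InfinitePlace K, w N ≤ C}.Finite := by
  refine Set.Finite.of_finite_image ((Embeddings.finite_of_norm_le K ℂ C).subset ?_)
    RingOfIntegers.coe_injective.injOn
  rintro _ ⟨N, hN, rfl⟩
  exact ⟨N.isIntegral_coe, fun φ => by simpa using hN (InfinitePlace.mk φ)⟩

theorem exists_isComplex (h : ¬ ∀ σ : K →+* ℂ, ∀ x : K, (σ x).im = 0) :
    ∃ w : InfinitePlace K, w.IsComplex := by
  push Not at h
  obtain ⟨σ, x, hx⟩ := h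
  refine ⟨InfinitePlace.mk σ, isComplex_mk_iff.2 fun hσ => hx ?_⟩
  rw [ComplexEmbedding.isReal_iff] at hσ
  rw [← Complex.conj_eq_iff_im, ← ComplexEmbedding.conjugate_coe_eq, hσ]

end

end QuadRep

open NumberField MvPolynomial

/-- Let `K` be a totally real number field and `Q` a positive definite
quadratic form in `n ≥ 5` variables over `𝓞 K`. There is a finite set
`S ⊆ 𝓞 K⁺ \ Q(𝓞 K)` such that for every extension `L/K` of number fields of odd degree,
`Q(𝓞 L) ∩ 𝓞 K⁺ ⊆ Q(𝓞 K) ∪ S · 𝓞 K ^{×2}`, and if moreover `L` is not totally real then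
`(Q(𝓞 L) ∩ 𝓞 K⁺) ∪ {0} = Q(𝓞 K) ∪ S · 𝓞 K ^{×2}`. -/
theorem statement3
    (K : Type) [Field K] [NumberField K]
    (hK : ∀ σ : K →+* ℂ, ∀ x : K, (σ x).im = 0)
    (n : ℕ) (hn : 5 ≤ n)
    (Q : MvPolynomial (Fin n) (𝓞 K)) (hQ : Q.IsHomogeneous 2)
    (hpos : ∀ v : Fin n → 𝓞 K, v ≠ 0 →
      ∀ σ : K →+* ℝ, 0 < σ (algebraMap (𝓞 K) K (eval v Q))) :
    ∃ S : Set (𝓞 K), S.Finite ∧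
      S ⊆ {b : 𝓞 K | ∀ σ : K →+* ℝ, 0 < σ (algebraMap (𝓞 K) K b)} \
          {b : 𝓞 K | ∃ x : Fin n → 𝓞 K, eval x Q = b} ∧
      ∀ (L : Type) [Field L] [NumberField L] [Algebra K L],
        Odd (Module.finrank K L) →
        (({b : 𝓞 K | ∃ x : Fin n → 𝓞 L, aeval x Q = algebraMap (𝓞 K) (𝓞 L) b} ∩
            {b : 𝓞 K | ∀ σ : K →+* ℝ, 0 < σ (algebraMap (𝓞 K) K b)} ⊆
          {b : 𝓞 K | ∃ x : Fin n → 𝓞 K, eval x Q = b} ∪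
            {b : 𝓞 K | ∃ s ∈ S, ∃ u : (𝓞 K)ˣ, b = s * (u : 𝓞 K) ^ 2}) ∧
        ((¬ ∀ σ : L →+* ℂ, ∀ x : L, (σ x).im = 0) →
          ({b : 𝓞 K | ∃ x : Fin n → 𝓞 L, aeval x Q = algebraMap (𝓞 K) (𝓞 L) b} ∩
            {b : 𝓞 K | ∀ σ : K →+* ℝ, 0 < σ (algebraMap (𝓞 K) K b)} ∪ {0} =
          {b : 𝓞 K | ∃ x : Fin n → 𝓞 K, eval x Q = b} ∪
            {b : 𝓞 K | ∃ s ∈ S, ∃ u : (𝓞 K)ˣ, b = s * (u : 𝓞 K) ^ 2}))) := by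
  obtain ⟨M, hMQ⟩ := QuadRep.exists_matrix_of_isHomogeneous Q hQ
  have hev : ∀ x, eval x Q = QuadRep.qf M x := fun x => by
    simp [hMQ, QuadRep.qf_eq_sum]
  have haev : ∀ (L : Type) [Field L] [NumberField L] [Algebra K L] (x : Fin n → 𝓞 L),
      aeval x Q = QuadRep.qf (M.map (algebraMap (𝓞 K) (𝓞 L))) x := fun L _ _ _ x => by
    simp [hMQ, QuadRep.qf_eq_sum]
  simp only [hev] at hpos ⊢
  have hκ : 5 ≤ Fintype.card (Fin n) := by rwa [Fintype.card_fin]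
  obtain ⟨σ₀⟩ := QuadRep.exists_real_embedding hK
  have hM : (M + M.transpose).det ≠ 0 :=
    QuadRep.det_ne_zero_of_pos σ₀ fun v hv => hpos v hv σ₀
  set v : Fin n → 𝓞 K := fun _ => 1 with hv
  have hv0 : v ≠ 0 := fun h => one_ne_zero (congrFun h ⟨0, by omega⟩)
  have hne : ∀ N : 𝓞 K, (∀ σ : K →+* ℝ, 0 < σ (algebraMap (𝓞 K) K N)) → N ≠ 0 := fun N hN h => by
    have := hN σ₀
    simp [h] at this
  have hmul : ∀ (N : 𝓞 K) (u : (𝓞 K)ˣ), (∀ σ : K →+* ℝ, 0 < σ (algebraMap (𝓞 K) K N)) →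
      ∀ σ : K →+* ℝ, 0 < σ (algebraMap (𝓞 K) K (N * (u : 𝓞 K) ^ 2)) := fun N u hN σ => by
    rw [map_mul, map_mul, map_pow, map_pow]
    have : σ (algebraMap (𝓞 K) K u) ≠ 0 := by simp
    have := hN σ
    positivity
  have hqv := hpos v hv0
  obtain ⟨C, hC⟩ := QuadRep.exists_bound_or_qf_eq hκ M hM v (hne _ hqv) hqv
  refine ⟨{N | (∀ w : InfinitePlace K, w N ≤ C) ∧ (∀ σ : K →+* ℝ, 0 < σ (algebraMap (𝓞 K) K N)) ∧
    QuadRep.CongRep M N ∧ ¬ ∃ x, QuadRep.qf M x = N},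
    (QuadRep.finite_forall_infinitePlace_le C).subset fun N hN => hN.1,
    fun N hN => ⟨hN.2.1, hN.2.2.2⟩, fun L _ _ _ hodd => ?_⟩
  have hsub : ∀ N : 𝓞 K, (∃ x : Fin n → 𝓞 L, QuadRep.qf (M.map (algebraMap (𝓞 K) (𝓞 L))) x =
      algebraMap (𝓞 K) (𝓞 L) N) → (∀ σ : K →+* ℝ, 0 < σ (algebraMap (𝓞 K) K N)) →
      (∃ x, QuadRep.qf M x = N) ∨ ∃ s : 𝓞 K, ((∀ w : InfinitePlace K, w s ≤ C) ∧
        (∀ σ : K →+* ℝ, 0 < σ (algebraMap (𝓞 K) K s)) ∧ QuadRep.CongRep M s ∧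
        ¬ ∃ x, QuadRep.qf M x = s) ∧ ∃ u : (𝓞 K)ˣ, N = s * (u : 𝓞 K) ^ 2 := by
    rintro N ⟨x, hx⟩ hN
    have hcr := QuadRep.congRep_of_odd_finrank hodd M N x hx
    by_cases hrep : ∃ x, QuadRep.qf M x = N
    · exact Or.inl hrep
    right
    obtain ⟨u, hu⟩ := (hC N (hne N hN) hN hcr).resolve_left hrep
    refine ⟨N * (u : 𝓞 K) ^ 2, ⟨fun w => ?_, hmul N u hN, hcr.mul_sq _, fun h =>
      hrep (QuadRep.exists_qf_eq_of_mul_sq u h)⟩, u⁻¹, ?_⟩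
    · push_cast
      exact hu w
    · rw [mul_assoc, ← mul_pow, Units.mul_inv, one_pow, mul_one]
  have hrepr : ∀ N : 𝓞 K, (∃ x : Fin n → 𝓞 L, aeval x Q = algebraMap (𝓞 K) (𝓞 L) N) →
      ∃ x : Fin n → 𝓞 L, QuadRep.qf (M.map (algebraMap (𝓞 K) (𝓞 L))) x =
        algebraMap (𝓞 K) (𝓞 L) N := fun N ⟨x, hx⟩ => ⟨x, (haev L x).symm.trans hx⟩
  refine ⟨fun N hN => hsub N (hrepr N hN.1) hN.2, fun hL => Set.Subset.antisymm ?_ ?_⟩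
  · rintro N (hN | rfl)
    · exact hsub N (hrepr N hN.1) hN.2
    · exact Or.inl ⟨0, QuadRep.qf_zero M⟩
  · have hmap : ∀ x : Fin n → 𝓞 K, QuadRep.qf (M.map (algebraMap (𝓞 K) (𝓞 L)))
        (algebraMap (𝓞 K) (𝓞 L) ∘ x) = algebraMap (𝓞 K) (𝓞 L) (QuadRep.qf M x) :=
      QuadRep.qf_map M _
    have hinj : Function.Injective (algebraMap (𝓞 K) (𝓞 L)) :=
      RingOfIntegers.algebraMap.injective K L
    rintro N (⟨x, rfl⟩ | ⟨s, ⟨-, hspos, hscr, -⟩, u, rfl⟩)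
    · by_cases hx : x = 0
      · exact Or.inr (by rw [hx, QuadRep.qf_zero]; rfl)
      · exact Or.inl ⟨⟨_, (haev L _).trans (hmap x)⟩, hpos x hx⟩
    · left
      refine ⟨?_, hmul s u hspos⟩
      obtain ⟨w₁, hw₁⟩ := QuadRep.exists_isComplex hL
      have hres : ∀ N : 𝓞 K, (∀ σ : K →+* ℝ, 0 < σ (algebraMap (𝓞 K) K N)) →
          ∀ σ : L →+* ℝ, 0 < σ (algebraMap (𝓞 K) (𝓞 L) N : 𝓞 L) := fun N hN σ =>
        hN (σ.comp (algebraMap K L))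
      have hML : (M.map (algebraMap (𝓞 K) (𝓞 L)) +
          (M.map (algebraMap (𝓞 K) (𝓞 L))).transpose).det ≠ 0 := by
        rw [← Matrix.transpose_map, ← Matrix.map_add _ (map_add _), ← RingHom.mapMatrix_apply,
          ← RingHom.map_det]
        exact (map_ne_zero_iff _ hinj).2 hM
      obtain ⟨x, hx⟩ := QuadRep.exists_qf_eq_of_isComplex hκ _ hML (algebraMap (𝓞 K) (𝓞 L) ∘ v)
        (by rw [hmap]; exact (map_ne_zero_iff _ hinj).2 (hne _ hqv))
        (by rw [hmap]; exact hres _ hqv) hw₁ ((map_ne_zero_iff _ hinj).2 (hne s hspos))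
        (hres s hspos) (hscr.map (algebraMap (𝓞 K) (𝓞 L)))
      refine ⟨algebraMap (𝓞 K) (𝓞 L) u • x, ?_⟩
      rw [haev, QuadRep.qf_smul, hx, map_mul, map_pow, mul_comm]
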